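/- Let k ≥ 2 and let G be a graph with |H_k(G)| − |L_k(G)| ≥ 3k. Then G contains k vertex-disjoint cycles. -/

import Mathlib

/-- `G` contains `k` pairwise vertex-disjoint cycles. -/
def HasDisjointCycles {V : Type*} (G : SimpleGraph V) (k : ℕ) : Prop :=
  ∃ c : Fin k → (v : V) × G.Walk v v,
    (∀ i, (c i).2.IsCycle) ∧
    ∀ i j, i ≠ j → List.Disjoint (c i).2.support (c j).2.support

/-- `H_k(G)`: the set of vertices of degree at least `2k`. -/
def highSet {V : Type*} [Fintype V] (G : SimpleGraph V) [DecidableRel G.Adj] (k : ℕ) :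
    Finset V :=
  Finset.univ.filter fun v => 2 * k ≤ G.degree v

/-- `L_k(G)`: the set of vertices of degree at most `2k - 2`. -/
def lowSet {V : Type*} [Fintype V] (G : SimpleGraph V) [DecidableRel G.Adj] (k : ℕ) :
    Finset V :=
  Finset.univ.filter fun v => G.degree v ≤ 2 * k - 2

namespace DisjointCycles
open Finset
open scoped Classical

variable {V : Type*}

/-- The number of neighbours of `v` in `S`. -/
noncomputable def dg (G : SimpleGraph V) (S : Finset V) (v : V) : ℕ := (S.filter (G.Adj v)).card

/-- `S` induces a subgraph of minimum degree at least two. -/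
def Cyc (G : SimpleGraph V) (S : Finset V) : Prop := S.Nonempty ∧ ∀ v ∈ S, 2 ≤ dg G S v

/-- `S` induces a forest. -/
def Acyc (G : SimpleGraph V) (S : Finset V) : Prop := ∀ T ⊆ S, ¬ Cyc G T

/-- `S` is the vertex set of a triangle. -/
def Tri (G : SimpleGraph V) (S : Finset V) : Prop :=
  S.card = 3 ∧ ∀ x ∈ S, ∀ y ∈ S, x ≠ y → G.Adj x y

/-- `X` contains `n` pairwise disjoint sets satisfying `p`. -/
def Has (p : Finset V → Prop) : Finset V → ℕ → Prop
  | _, 0 => True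
  | X, n + 1 => ∃ C ⊆ X, p C ∧ Has p (X \ C) n

/-- A family of pairwise disjoint sets satisfying `p`, contained in `X`. -/
structure Fam (p : Finset V → Prop) (X : Finset V) (P : Finset (Finset V)) : Prop where
  prop : ∀ C ∈ P, p C
  sub : ∀ C ∈ P, C ⊆ X
  disj : ∀ C ∈ P, ∀ D ∈ P, C ≠ D → Disjoint C D

/-- The union of a family of sets. -/
noncomputable def un (P : Finset (Finset V)) : Finset V := P.biUnion id

lemma mem_un {P : Finset (Finset V)} {v : V} : v ∈ un P ↔ ∃ C ∈ P, v ∈ C := by simp [un]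

lemma subset_un {P : Finset (Finset V)} {C : Finset V} (h : C ∈ P) : C ⊆ un P :=
  fun _ hv => mem_un.2 ⟨C, h, hv⟩

lemma un_mono {P Q : Finset (Finset V)} (h : P ⊆ Q) : un P ⊆ un Q :=
  fun _ hv => let ⟨C, hC, hvC⟩ := mem_un.1 hv; mem_un.2 ⟨C, h hC, hvC⟩

@[simp] lemma un_empty : un (∅ : Finset (Finset V)) = ∅ := by simp [un]

lemma un_insert (C : Finset V) (P : Finset (Finset V)) : un (insert C P) = C ∪ un P := by
  simp [un]

lemma un_union (P Q : Finset (Finset V)) : un (P ∪ Q) = un P ∪ un Q := by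
  ext v; simp only [mem_un, mem_union]; grind

lemma Fam.un_sub {p : Finset V → Prop} {X : Finset V} {P : Finset (Finset V)} (h : Fam p X P) :
    un P ⊆ X := fun _ hv => let ⟨C, hC, hvC⟩ := mem_un.1 hv; h.sub C hC hvC

lemma Fam.mono {p : Finset V → Prop} {X Y : Finset V} {P Q : Finset (Finset V)} (h : Fam p X P)
    (hQ : Q ⊆ P) (hY : un Q ⊆ Y) : Fam p Y Q :=
  ⟨fun C hC => h.prop C (hQ hC), fun _ hC => (subset_un hC).trans hY,
    fun C hC D hD => h.disj C (hQ hC) D (hQ hD)⟩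

lemma Fam.disjoint_un {p : Finset V → Prop} {X : Finset V} {P Q : Finset (Finset V)}
    (h : Fam p X P) {C : Finset V} (hC : C ∈ P) (hQ : Q ⊆ P) (hCQ : C ∉ Q) :
    Disjoint C (un Q) := by
  rw [disjoint_left]
  intro v hv hv'
  obtain ⟨D, hD, hvD⟩ := mem_un.1 hv'
  exact disjoint_left.1 (h.disj C hC D (hQ hD) (fun e => hCQ (e ▸ hD))) hv hvD

lemma Fam.eq_of_mem {p : Finset V → Prop} {X : Finset V} {P : Finset (Finset V)}
    (h : Fam p X P) {C D : Finset V} (hC : C ∈ P) (hD : D ∈ P) {v : V} (hv : v ∈ C) (hv' : v ∈ D) :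
    C = D := by
  by_contra hne
  exact disjoint_left.1 (h.disj C hC D hD hne) hv hv'

section degrees
variable {G : SimpleGraph V} {S T : Finset V} {v : V}

lemma dg_mono (h : S ⊆ T) (v : V) : dg G S v ≤ dg G T v :=
  card_le_card (filter_subset_filter _ h)

lemma dg_le_card (S : Finset V) (v : V) : dg G S v ≤ S.card := card_filter_le _ _

@[simp] lemma dg_empty (v : V) : dg G ∅ v = 0 := by simp [dg]

lemma dg_union (h : Disjoint S T) (v : V) : dg G (S ∪ T) v = dg G S v + dg G T v := by
  rw [dg, filter_union, card_union_of_disjoint (disjoint_filter_filter h)]; rfl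

lemma dg_sdiff (h : T ⊆ S) (v : V) : dg G S v = dg G T v + dg G (S \ T) v := by
  rw [← dg_union disjoint_sdiff, union_sdiff_of_subset h]

lemma dg_singleton (u v : V) : dg G {u} v = if G.Adj v u then 1 else 0 := by
  rw [dg, filter_singleton]; split_ifs <;> simp

lemma dg_insert {u : V} (h : u ∉ S) (v : V) :
    dg G (insert u S) v = dg G S v + if G.Adj v u then 1 else 0 := by
  rw [insert_eq, dg_union (by simpa using h), dg_singleton, add_comm]

lemma dg_erase {u : V} (h : u ∈ S) (v : V) :
    dg G S v = dg G (S.erase u) v + if G.Adj v u then 1 else 0 := by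
  rw [← dg_insert (notMem_erase u S), insert_erase h]

lemma dg_erase_self (v : V) : dg G (S.erase v) v = dg G S v := by
  by_cases h : v ∈ S
  · rw [dg_erase h]; simp
  · rw [erase_eq_of_notMem h]

lemma dg_insert_self (v : V) : dg G (insert v S) v = dg G S v := by
  by_cases h : v ∈ S
  · rw [insert_eq_of_mem h]
  · rw [dg_insert h]; simp

lemma dg_pos : 0 < dg G S v ↔ ∃ u ∈ S, G.Adj v u := by
  rw [dg, card_pos]; simp [Finset.Nonempty]

lemma dg_eq_zero : dg G S v = 0 ↔ ∀ u ∈ S, ¬ G.Adj v u := by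
  simp [dg, filter_eq_empty_iff]

lemma dg_full : dg G S v = S.card ↔ ∀ u ∈ S, G.Adj v u := by
  rw [dg, card_filter_eq_iff]

lemma dg_lt_card {u : V} (hu : u ∈ S) (h : ¬ G.Adj v u) :
    dg G S v + 1 ≤ S.card := by
  have := dg_erase (G := G) hu v
  have h2 := dg_le_card (G := G) (S.erase u) v
  rw [card_erase_of_mem hu] at h2
  have := card_pos.2 ⟨u, hu⟩
  rw [if_neg h] at *
  omega

lemma dg_lt_card_self (hu : v ∈ S) : dg G S v + 1 ≤ S.card := dg_lt_card hu (by simp)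

lemma dg_un {p : Finset V → Prop} {X : Finset V} {P : Finset (Finset V)} (h : Fam p X P) (v : V) :
    dg G (un P) v = ∑ C ∈ P, dg G C v := by
  induction P using Finset.induction with
  | empty => simp
  | insert C P hC ih =>
    rw [un_insert, dg_union, sum_insert hC, ih (h.mono (subset_insert _ _)
      ((un_mono (subset_insert _ _)).trans h.un_sub))]
    exact h.disjoint_un (mem_insert_self _ _) (subset_insert _ _) hC

lemma sum_dg_comm (S T : Finset V) : ∑ v ∈ S, dg G T v = ∑ v ∈ T, dg G S v := by
  simp only [dg, card_filter]
  rw [sum_comm]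
  simp only [G.adj_comm]

lemma dg_two_of_adj {a b : V} (ha : a ∈ S) (hb : b ∈ S) (hab : a ≠ b) (h1 : G.Adj v a)
    (h2 : G.Adj v b) : 2 ≤ dg G S v := by
  rw [dg, ← card_pair hab]
  exact card_le_card (by intro x; simp; rintro (rfl | rfl) <;> tauto)

lemma dg_congr {G' : SimpleGraph V} (h : ∀ u ∈ S, G.Adj v u ↔ G'.Adj v u) :
    dg G S v = dg G' S v := by
  rw [dg, dg, filter_congr h]

lemma dg_mono_graph {G' : SimpleGraph V} (h : ∀ u ∈ S, G.Adj v u → G'.Adj v u) :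
    dg G S v ≤ dg G' S v :=
  card_le_card fun u hu => by
    rw [mem_filter] at hu ⊢; exact ⟨hu.1, h u hu.1 hu.2⟩

end degrees

section cyc
variable {G : SimpleGraph V} {S T : Finset V} {v : V}

lemma Tri.nonempty (h : Tri G S) : S.Nonempty := card_pos.1 (by rw [h.1]; norm_num)

lemma Tri.dg (h : Tri G S) (hv : v ∈ S) : dg G S v = 2 := by
  rw [← dg_erase_self, dg_full.2, card_erase_of_mem hv, h.1]
  intro u hu
  exact h.2 v hv u (mem_of_mem_erase hu) (ne_of_mem_erase hu).symm

lemma Tri.cyc (h : Tri G S) : Cyc G S := ⟨h.nonempty, fun _ hv => (h.dg hv).ge⟩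

lemma Acyc.mono (h : Acyc G S) (hT : T ⊆ S) : Acyc G T := fun U hU => h U (hU.trans hT)

lemma not_acyc : ¬ Acyc G S ↔ ∃ T ⊆ S, Cyc G T := by simp [Acyc]

lemma Acyc.exists_dg_le (h : Acyc G S) (hS : S.Nonempty) : ∃ v ∈ S, dg G S v ≤ 1 := by
  by_contra! hc
  exact h S Subset.rfl ⟨hS, fun v hv => hc v hv⟩

lemma sum_dg_erase (hv : v ∈ S) :
    ∑ u ∈ S, dg G S u = ∑ u ∈ S.erase v, dg G (S.erase v) u + 2 * dg G S v := by
  rw [← add_sum_erase S _ hv, sum_congr rfl fun u _ => dg_erase (G := G) hv u, sum_add_distrib]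
  have : ∑ u ∈ S.erase v, (if G.Adj u v then 1 else 0) = dg G S v := by
    rw [← dg_erase_self, dg, card_filter]
    simp only [G.adj_comm]
  rw [this]; ring

lemma Acyc.sum_le : ∀ {S : Finset V}, Acyc G S → S.Nonempty →
    ∑ v ∈ S, dg G S v + 2 ≤ 2 * S.card := by
  intro S
  induction S using Finset.strongInduction with
  | H S ih =>
    intro h hS
    obtain ⟨v, hv, hd⟩ := h.exists_dg_le hS
    rw [sum_dg_erase hv]
    have hc := card_erase_add_one hv
    rcases (S.erase v).eq_empty_or_nonempty with he | hne
    · have : dg G S v = 0 := by rw [← dg_erase_self, he, dg_empty]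
      simp [he, this]; have := card_pos.2 hS; omega
    · have := ih _ (erase_ssubset hv) (h.mono (erase_subset _ _)) hne
      omega

end cyc

section has
variable {p p' : Finset V → Prop} {X Y : Finset V} {n m : ℕ}

lemma Has.mono (h : Has p X n) (hXY : X ⊆ Y) : Has p Y n := by
  induction n generalizing X Y with
  | zero => trivial
  | succ n ih =>
    obtain ⟨C, hC, hp, hr⟩ := h
    exact ⟨C, hC.trans hXY, hp, ih hr (sdiff_subset_sdiff hXY Subset.rfl)⟩

lemma Has.imp (h : Has p X n) (hp : ∀ C, p C → p' C) : Has p' X n := by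
  induction n generalizing X with
  | zero => trivial
  | succ n ih =>
    obtain ⟨C, hC, h1, hr⟩ := h
    exact ⟨C, hC, hp C h1, ih hr⟩

lemma Has.add (h : Has p X n) (h' : Has p Y m) (hd : Disjoint X Y) : Has p (X ∪ Y) (n + m) := by
  induction n generalizing X with
  | zero => rw [zero_add]; exact h'.mono subset_union_right
  | succ n ih =>
    obtain ⟨C, hC, h1, hr⟩ := h
    rw [Nat.succ_add]
    refine ⟨C, hC.trans subset_union_left, h1, (ih hr (hd.mono_left sdiff_subset)).mono ?_⟩
    intro v; simp only [mem_union, mem_sdiff]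
    rintro (h | h)
    · tauto
    · exact ⟨Or.inr h, fun hv => disjoint_left.1 hd (hC hv) h⟩

lemma Has.le (h : Has p X n) (hm : m ≤ n) : Has p X m := by
  induction n generalizing X m with
  | zero => rw [Nat.le_zero.1 hm]; trivial
  | succ n ih =>
    cases m with
    | zero => trivial
    | succ m =>
      obtain ⟨C, hC, h1, hr⟩ := h
      exact ⟨C, hC, h1, ih hr (by omega)⟩

lemma has_one {C : Finset V} (h : p C) (hC : C ⊆ X) : Has p X 1 := ⟨C, hC, h, trivial⟩

lemma has_cyc_one {G : SimpleGraph V} : Has (Cyc G) X 1 ↔ ¬ Acyc G X := by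
  rw [not_acyc]; simp [Has]

lemma Fam.has {P : Finset (Finset V)} (h : Fam p X P) : Has p (un P) P.card := by
  induction P using Finset.induction with
  | empty => trivial
  | insert C P hC ih =>
    rw [card_insert_of_notMem hC, un_insert, add_comm]
    refine Has.add (has_one (h.prop C (mem_insert_self _ _)) Subset.rfl)
      (ih (h.mono (subset_insert _ _) ((un_mono (subset_insert _ _)).trans h.un_sub))) ?_
    exact h.disjoint_un (mem_insert_self _ _) (subset_insert _ _) hC

lemma Has.exists_fam (hp : ∀ C, p C → C.Nonempty) (h : Has p X n) :
    ∃ P, Fam p X P ∧ P.card = n := by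
  induction n generalizing X with
  | zero => exact ⟨∅, ⟨by simp, by simp, by simp⟩, rfl⟩
  | succ n ih =>
    obtain ⟨C, hC, h1, hr⟩ := h
    obtain ⟨P, hP, hc⟩ := ih hr
    have hdis : ∀ D ∈ P, Disjoint C D := fun D hD =>
      disjoint_of_subset_right (hP.sub D hD) disjoint_sdiff
    have hCP : C ∉ P := fun hCP => by
      have := hdis C hCP
      rw [disjoint_self_iff_empty] at this
      exact (hp C h1).ne_empty this
    refine ⟨insert C P, ⟨?_, ?_, ?_⟩, by rw [card_insert_of_notMem hCP, hc]⟩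
    · simp only [mem_insert]; rintro D (rfl | hD); exacts [h1, hP.prop D hD]
    · simp only [mem_insert]; rintro D (rfl | hD); exacts [hC, (hP.sub D hD).trans sdiff_subset]
    · simp only [mem_insert]
      rintro D (rfl | hD) E (rfl | hE) hne
      · exact absurd rfl hne
      · exact hdis E hE
      · exact (hdis D hD).symm
      · exact hP.disj D hD E hE hne

lemma Fam.insert_fam {P : Finset (Finset V)} {C : Finset V} (h : Fam p X P) (hp : p C) (hC : C ⊆ X)
    (hd : Disjoint C (un P)) : Fam p X (insert C P) := by
  refine ⟨?_, ?_, ?_⟩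
  · simp only [mem_insert]; rintro D (rfl | hD); exacts [hp, h.prop D hD]
  · simp only [mem_insert]; rintro D (rfl | hD); exacts [hC, h.sub D hD]
  · simp only [mem_insert]
    rintro D (rfl | hD) E (rfl | hE) hne
    · exact absurd rfl hne
    · exact hd.mono_right (subset_un hE)
    · exact (hd.mono_right (subset_un hD)).symm
    · exact h.disj D hD E hE hne

end has

section weight

/-- The weight of a vertex of degree `d` relative to `q` cycles. -/
def phi (q d : ℕ) : ℤ := if 2 * q ≤ d then 1 else if 2 * q ≤ d + 1 then 0 else -1

/-- The number of high vertices minus the number of low vertices of the graph induced on `X`. -/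
noncomputable def Wt (G : SimpleGraph V) (q : ℕ) (X : Finset V) : ℤ := ∑ v ∈ X, phi q (dg G X v)

lemma phi_le_one (q d : ℕ) : phi q d ≤ 1 := by unfold phi; split_ifs <;> omega

lemma neg_one_le_phi (q d : ℕ) : -1 ≤ phi q d := by unfold phi; split_ifs <;> omega

lemma phi_mono (q : ℕ) {d e : ℕ} (h : d ≤ e) : phi q d ≤ phi q e := by
  unfold phi; split_ifs <;> omega

lemma phi_le_of_le {q k d e m : ℕ} (hk : q + m = k) (h : d ≤ e + 2 * m) : phi k d ≤ phi q e := by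
  unfold phi; split_ifs <;> omega

lemma phi_eq_one {q d : ℕ} : phi q d = 1 ↔ 2 * q ≤ d := by
  unfold phi; split_ifs <;> simp <;> omega

lemma phi_eq_zero {q d : ℕ} : phi q d = 0 ↔ 2 * q = d + 1 := by
  unfold phi; split_ifs <;> simp <;> omega

lemma sum_phi_le {S : Finset V} (q : ℕ) (f : V → ℕ) : ∑ v ∈ S, phi q (f v) ≤ S.card := by
  have := sum_le_card_nsmul S (fun v => phi q (f v)) 1 fun v _ => phi_le_one q (f v)
  simpa using this

end weight

/-- `X` carries enough weight for `k` cycles but no `k` disjoint cycles, while every proper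
subset and every contraction of `X` satisfies the theorem. -/
structure Bad (G : SimpleGraph V) (k : ℕ) (X : Finset V) : Prop where
  hk : 2 ≤ k
  wt : 3 * (k : ℤ) ≤ Wt G k X
  no : ¬ Has (Cyc G) X k
  ih : ∀ Y, Y ⊂ X → ∀ q : ℕ, 2 ≤ q → 3 * (q : ℤ) ≤ Wt G q Y → Has (Cyc G) Y q
  ctr : ∀ x ∈ X, ∀ y ∈ X, G.Adj x y → (∀ z ∈ X, ¬ (G.Adj x z ∧ G.Adj y z)) →
    2 * k ≤ dg G X x ∧ 2 * k ≤ dg G X y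

section contraction

/-- Contraction of the pair `x y` onto `x`. -/
def merge (G : SimpleGraph V) (x y : V) : SimpleGraph V where
  Adj a b := a ≠ b ∧ (G.Adj a b ∨ (a = x ∧ G.Adj y b) ∨ (b = x ∧ G.Adj a y))
  symm := ⟨by
    rintro a b ⟨hne, h⟩
    refine ⟨hne.symm, ?_⟩
    rcases h with h | ⟨h, h'⟩ | ⟨h, h'⟩
    exacts [Or.inl h.symm, Or.inr (Or.inr ⟨h, h'.symm⟩), Or.inr (Or.inl ⟨h, h'.symm⟩)]⟩
  loopless := ⟨fun a h => h.1 rfl⟩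

variable {G : SimpleGraph V} {x y : V}

lemma merge_adj {a b : V} : (merge G x y).Adj a b ↔
    a ≠ b ∧ (G.Adj a b ∨ (a = x ∧ G.Adj y b) ∨ (b = x ∧ G.Adj a y)) := Iff.rfl

lemma merge_adj_of_ne {a b : V} (ha : a ≠ x) (hb : b ≠ x) : (merge G x y).Adj a b ↔ G.Adj a b := by
  rw [merge_adj]
  constructor
  · tauto
  · intro h; exact ⟨h.ne, Or.inl h⟩

lemma merge_cyc_of_notMem {C : Finset V} (hx : x ∉ C) (h : Cyc (merge G x y) C) : Cyc G C := by
  refine ⟨h.1, fun v hv => (h.2 v hv).trans_eq ?_⟩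
  refine dg_congr fun u hu => merge_adj_of_ne ?_ ?_ <;> rintro rfl <;> exact hx (by assumption)

lemma has_of_merge_of_notMem {Y : Finset V} {n : ℕ} (hx : x ∉ Y) (h : Has (Cyc (merge G x y)) Y n) :
    Has (Cyc G) Y n := by
  induction n generalizing Y with
  | zero => trivial
  | succ n ih =>
    obtain ⟨C, hC, h1, hr⟩ := h
    exact ⟨C, hC, merge_cyc_of_notMem (fun h => hx (hC h)) h1,
      ih (fun h => hx (mem_sdiff.1 h).1) hr⟩

lemma exists_cyc_of_merge (hxy : G.Adj x y) {C : Finset V} (hx : x ∈ C) (hy : y ∉ C)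
    (h : Cyc (merge G x y) C) : ∃ D ⊆ insert y C, Cyc G D := by
  by_cases h1 : ∃ u ∈ C.erase x, G.Adj x u
  · by_cases h2 : ∃ u ∈ C.erase x, G.Adj y u
    · refine ⟨insert y C, Subset.rfl, ⟨y, mem_insert_self _ _⟩, fun v hv => ?_⟩
      by_cases hvx : v = x
      · subst hvx
        obtain ⟨u, hu, hu'⟩ := h1
        exact dg_two_of_adj (mem_insert_self _ _) (mem_insert_of_mem (mem_of_mem_erase hu))
          (by rintro rfl; exact hy (mem_of_mem_erase hu)) hxy hu'
      by_cases hvy : v = y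
      · subst hvy
        obtain ⟨u, hu, hu'⟩ := h2
        exact dg_two_of_adj (mem_insert_of_mem hx) (mem_insert_of_mem (mem_of_mem_erase hu))
          (ne_of_mem_erase hu).symm hxy.symm hu'
      · have hvC : v ∈ C := mem_of_mem_insert_of_ne hv hvy
        refine (h.2 v hvC).trans ?_
        rw [dg_erase hx, dg_insert hy, dg_erase (G := G) hx]
        rw [dg_congr (G := merge G x y) (G' := G)
          (fun u hu => merge_adj_of_ne hvx (ne_of_mem_erase hu))]
        have : (merge G x y).Adj v x → G.Adj v x ∨ G.Adj v y := by
          rw [merge_adj]; tauto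
        split_ifs <;> first | omega | tauto
    · push Not at h2
      refine ⟨C, subset_insert _ _, h.1, fun v hv =>
        (h.2 v hv).trans (dg_mono_graph fun u hu huv => ?_)⟩
      rw [merge_adj] at huv
      rcases huv with ⟨hne, huv | ⟨rfl, huv⟩ | ⟨rfl, huv⟩⟩
      · exact huv
      · exact absurd huv (h2 u (mem_erase.2 ⟨hne.symm, hu⟩))
      · exact absurd huv.symm (h2 v (mem_erase.2 ⟨hne, hv⟩))
  · push Not at h1
    refine ⟨insert y (C.erase x), insert_subset_insert _ (erase_subset _ _),
      ⟨y, mem_insert_self _ _⟩, fun v hv => ?_⟩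
    have hy' : y ∉ C.erase x := fun h => hy (mem_of_mem_erase h)
    by_cases hvy : v = y
    · subst hvy
      rw [dg_insert_self]
      refine (h.2 x hx).trans ?_
      rw [← dg_erase_self]
      refine card_le_card fun u hu => ?_
      rw [mem_filter, merge_adj] at *
      refine ⟨hu.1, ?_⟩
      rcases hu.2.2 with h' | h' | h'
      · exact absurd h' (h1 u hu.1)
      · exact h'.2
      · exact absurd h'.1 (ne_of_mem_erase hu.1)
    · have hvC := mem_of_mem_insert_of_ne hv hvy
      refine (h.2 v (mem_of_mem_erase hvC)).trans ?_
      rw [dg_erase hx, dg_insert hy', dg_congr (G := merge G x y) (G' := G)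
        (fun u hu => merge_adj_of_ne (ne_of_mem_erase hvC) (ne_of_mem_erase hu))]
      have : (merge G x y).Adj v x → G.Adj v y := by
        rw [merge_adj]
        have := h1 v hvC
        have := ne_of_mem_erase hvC
        have := G.adj_comm x v
        tauto
      split_ifs <;> first | omega | tauto

lemma has_of_merge (hxy : G.Adj x y) {Y : Finset V} {n : ℕ} (hy : y ∉ Y)
    (h : Has (Cyc (merge G x y)) Y n) : Has (Cyc G) (insert y Y) n := by
  induction n generalizing Y with
  | zero => trivial
  | succ n ih =>
    obtain ⟨C, hC, h1, hr⟩ := h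
    by_cases hx : x ∈ C
    · obtain ⟨D, hD, hc⟩ := exists_cyc_of_merge hxy hx (fun h => hy (hC h)) h1
      refine ⟨D, hD.trans (insert_subset_insert _ hC), hc,
        (has_of_merge_of_notMem (by simp [hx]) hr).mono fun v hv => ?_⟩
      rw [mem_sdiff] at *
      refine ⟨mem_insert_of_mem hv.1, fun hvD => ?_⟩
      rcases mem_insert.1 (hD hvD) with rfl | h'
      · exact hy hv.1
      · exact hv.2 h'
    · refine ⟨C, hC.trans (subset_insert _ _), merge_cyc_of_notMem hx h1,
        (ih (fun h => hy (mem_sdiff.1 h).1) hr).mono ?_⟩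
      intro v hv
      simp only [mem_insert, mem_sdiff] at *
      rcases hv with rfl | hv
      · exact ⟨Or.inl rfl, fun h => hy (hC h)⟩
      · tauto

lemma wt_merge (hxy : G.Adj x y) {X : Finset V} (hx : x ∈ X) (hy : y ∈ X)
    (hno : ∀ z ∈ X, ¬ (G.Adj x z ∧ G.Adj y z)) {k : ℕ} (hk : 2 ≤ k)
    (hh : ¬ (2 * k ≤ dg G X x ∧ 2 * k ≤ dg G X y)) :
    Wt G k X ≤ Wt (merge G x y) k (X.erase y) := by
  have hxe : x ∈ X.erase y := mem_erase.2 ⟨hxy.ne, hx⟩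
  rw [Wt, Wt, ← add_sum_erase X _ hy, ← add_sum_erase _ _ hxe, ← add_sum_erase (X.erase y) _ hxe,
    ← add_assoc]
  refine add_le_add ?_ (sum_le_sum fun v hv => phi_mono _ ?_)
  · have e : dg G X x + dg G X y = dg (merge G x y) (X.erase y) x + 2 := by
      rw [dg_erase (v := x) hy, if_pos hxy, ← dg_erase_self (v := x), dg_erase (v := y) hx,
        if_pos hxy.symm,
        ← dg_erase_self (S := X.erase y), ← dg_erase_self (S := X.erase x),
        erase_right_comm (a := x) (b := y)]
      have : dg (merge G x y) ((X.erase y).erase x) x =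
          dg G ((X.erase y).erase x) x + dg G ((X.erase y).erase x) y := by
        rw [dg, dg, dg, ← card_union_of_disjoint, ← filter_or]
        · congr 1
          refine filter_congr fun u hu => ?_
          rw [merge_adj]
          have := (ne_of_mem_erase hu)
          tauto
        · rw [disjoint_filter]
          intro z hz h1 h2
          exact hno z (mem_of_mem_erase (mem_of_mem_erase hz)) ⟨h1, h2⟩
      omega
    have h1 : 0 < dg G X x := dg_pos.2 ⟨y, hy, hxy⟩
    have h2 : 0 < dg G X y := dg_pos.2 ⟨x, hx, hxy.symm⟩
    unfold phi
    split_ifs <;> omega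
  · have hvx := ne_of_mem_erase hv
    have hvX : v ∈ X := mem_of_mem_erase (mem_of_mem_erase hv)
    have := hno v hvX
    rw [dg_erase hy, dg_erase (G := G) hxe, dg_erase (G := merge G x y) hxe]
    rw [dg_congr (G := merge G x y) (G' := G)
      (fun u hu => merge_adj_of_ne hvx (ne_of_mem_erase hu))]
    have h1 : (merge G x y).Adj v x ↔ G.Adj v x ∨ G.Adj v y := by rw [merge_adj]; tauto
    have := G.adj_comm v x
    have := G.adj_comm v y
    split_ifs <;> first | omega | tauto

end contraction

theorem has_of_wt (main : ∀ (G : SimpleGraph V) (k : ℕ) (X : Finset V), ¬ Bad G k X)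
    {k : ℕ} (hk : 2 ≤ k) (G : SimpleGraph V) {X : Finset V} (h : 3 * (k : ℤ) ≤ Wt G k X) :
    Has (Cyc G) X k := by
  induction hn : X.card using Nat.strong_induction_on generalizing G X k with
  | _ n ih =>
    by_contra hno
    refine main G k X ⟨hk, h, hno, fun Y hY q hq hw => ih _ (hn ▸ card_lt_card hY) hq G hw rfl, ?_⟩
    intro x hx y hy hxy hz
    by_contra hh
    refine hno ?_
    have := ih _ (hn ▸ card_erase_lt_of_mem hy) hk (merge G x y) (X := X.erase y)
      (h.trans (wt_merge hxy hx hy hz hk hh)) rfl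
    have := has_of_merge hxy (notMem_erase y X) this
    rwa [insert_erase hy] at this

section walks

lemma exists_isCycle {G : SimpleGraph V} {S : Finset V} (h : Cyc G S) :
    ∃ (v : V) (c : G.Walk v v), c.IsCycle ∧ ∀ u ∈ c.support, u ∈ S := by
  let H := G.induce (S : Set V)
  have hdeg : ∀ v : (S : Set V), H.degree v = dg G S v := by
    intro v
    rw [← SimpleGraph.card_neighborFinset_eq_degree, dg, ← card_map (Function.Embedding.subtype _)]
    congr 1
    ext u
    simp only [mem_map, SimpleGraph.mem_neighborFinset, Function.Embedding.subtype_apply,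
      mem_filter]
    constructor
    · rintro ⟨w, hw, rfl⟩; exact ⟨w.2, hw⟩
    · rintro ⟨hu, hw⟩; exact ⟨⟨u, hu⟩, hw, rfl⟩
  have hna : ¬ H.IsAcyclic := by
    intro ha
    obtain ⟨v, hv⟩ := h.1
    let c := H.connectedComponentMk ⟨v, hv⟩
    have ht := ha.isTree_connectedComponent c
    have hdeg' : ∀ u : c.supp, c.toSimpleGraph.degree u = H.degree u.1 := by
      intro u
      rw [← SimpleGraph.card_neighborFinset_eq_degree, ← SimpleGraph.card_neighborFinset_eq_degree,
        ← card_map (Function.Embedding.subtype _)]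
      congr 1
      ext w
      simp only [mem_map, SimpleGraph.mem_neighborFinset, Function.Embedding.subtype_apply]
      constructor
      · rintro ⟨w, hw, rfl⟩; exact hw
      · intro hw
        exact ⟨⟨w, c.mem_supp_of_adj_mem_supp u.2 hw⟩, hw, rfl⟩
    have hv2 : ∀ u : c.supp, 2 ≤ c.toSimpleGraph.degree u := fun u => by
      rw [hdeg', hdeg]; exact h.2 _ u.1.2
    have : Nontrivial c.supp := by
      have h0 := hv2 ⟨⟨v, hv⟩, rfl⟩
      obtain ⟨w, hw⟩ := (SimpleGraph.degree_pos_iff_exists_adj _ _).1 (lt_of_lt_of_le two_pos h0)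
      exact ⟨_, _, hw.ne⟩
    obtain ⟨u, hu⟩ := ht.exists_vert_degree_one_of_nontrivial
    have := hv2 u
    omega
  unfold SimpleGraph.IsAcyclic at hna
  push Not at hna
  obtain ⟨v, c, hc⟩ := hna
  refine ⟨v.1, c.map (SimpleGraph.Embedding.induce (S : Set V)).toHom, ?_, ?_⟩
  · exact hc.map (f := (SimpleGraph.Embedding.induce (S : Set V)).toHom) Subtype.val_injective
  · intro u hu
    obtain ⟨w, _, rfl⟩ := List.mem_map.1
      ((SimpleGraph.Walk.support_map (SimpleGraph.Embedding.induce (S : Set V)).toHom c) ▸ hu)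
    exact w.2

lemma exists_walks {G : SimpleGraph V} {k : ℕ} {X : Finset V} (h : Has (Cyc G) X k) :
    ∃ c : Fin k → (v : V) × G.Walk v v, (∀ i, (c i).2.IsCycle) ∧
      (∀ i, ∀ u ∈ (c i).2.support, u ∈ X) ∧
      ∀ i j, i ≠ j → List.Disjoint (c i).2.support (c j).2.support := by
  induction k generalizing X with
  | zero => exact ⟨Fin.elim0, fun i => i.elim0, fun i => i.elim0, fun i => i.elim0⟩
  | succ k ih =>
    obtain ⟨C, hC, h1, hr⟩ := h
    obtain ⟨c, hc1, hc2, hc3⟩ := ih hr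
    obtain ⟨v, w, hw, hws⟩ := exists_isCycle h1
    refine ⟨Fin.cons (α := fun _ => (v : V) × G.Walk v v) ⟨v, w⟩ c, ?_, ?_, ?_⟩
    · intro i; induction i using Fin.cases
      · exact hw
      · exact hc1 _
    · intro i; induction i using Fin.cases
      · intro u hu; exact hC (hws u hu)
      · intro u hu; exact (mem_sdiff.1 (hc2 _ u hu)).1
    · intro i j
      induction i using Fin.cases <;> induction j using Fin.cases
      · exact fun h => absurd rfl h
      · intro _ u hu hu'
        exact (mem_sdiff.1 (hc2 _ u hu')).2 (hws u hu)
      · intro _ u hu hu'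
        exact (mem_sdiff.1 (hc2 _ u hu)).2 (hws u hu')
      · exact fun hne => hc3 _ _ fun h => hne (congrArg _ h)

end walks

/-! ### Accessible triangles -/

section accessible

/-- `v` is adjacent to every vertex of `C`. -/
def Full (G : SimpleGraph V) (v : V) (C : Finset V) : Prop := ∀ z ∈ C, G.Adj v z

/-- `S` is the vertex set of an edge. -/
def Edge (G : SimpleGraph V) (S : Finset V) : Prop :=
  S.card = 2 ∧ ∀ x ∈ S, ∀ y ∈ S, x ≠ y → G.Adj x y

/-- The classes of `S` from which a vertex can be moved, along a chain of classes, to `W`. -/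
inductive Reach (G : SimpleGraph V) (W : Finset V) (S : Finset (Finset V)) : Finset V → Prop
  | base : Reach G W S W
  | step {C D : Finset V} {w : V} : Reach G W S C → D ∈ S → w ∈ D → Full G w C → Reach G W S D

/-- `w` is completely joined to some class reachable in `S`. -/
def Mov (G : SimpleGraph V) (W : Finset V) (S : Finset (Finset V)) (w : V) : Prop :=
  ∃ C, Reach G W S C ∧ Full G w C

variable {G : SimpleGraph V} {W X : Finset V} {S S' : Finset (Finset V)} {k : ℕ}

lemma Edge.dg (h : Edge G W) {v : V} (hv : v ∈ W) : dg G W v = 1 := by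
  rw [← dg_erase_self, dg_full.2, card_erase_of_mem hv, h.1]
  intro u hu
  exact h.2 v hv u (mem_of_mem_erase hu) (ne_of_mem_erase hu).symm

lemma edge_pair {x y : V} (h : G.Adj x y) : Edge G {x, y} := by
  refine ⟨card_pair h.ne, ?_⟩
  intro a ha b hb hab
  simp only [mem_insert, mem_singleton] at ha hb
  rcases ha with rfl | rfl <;> rcases hb with rfl | rfl
  · exact absurd rfl hab
  · exact h
  · exact h.symm
  · exact absurd rfl hab

lemma Tri.erase_edge {D : Finset V} {w : V} (h : Tri G D) (hw : w ∈ D) : Edge G (D.erase w) :=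
  ⟨by rw [card_erase_of_mem hw, h.1], fun x hx y hy =>
    h.2 x (mem_of_mem_erase hx) y (mem_of_mem_erase hy)⟩

lemma Edge.insert_tri {D : Finset V} {w : V} (h : Edge G D) (hw : w ∉ D) (hf : Full G w D) :
    Tri G (insert w D) := by
  refine ⟨by rw [card_insert_of_notMem hw, h.1], ?_⟩
  intro x hx y hy hne
  rcases mem_insert.1 hx with rfl | hx' <;> rcases mem_insert.1 hy with rfl | hy'
  · exact absurd rfl hne
  · exact hf y hy'
  · exact (hf x hx').symm
  · exact h.2 x hx' y hy' hne

lemma Full.notMem {v : V} {C : Finset V} (h : Full G v C) : v ∉ C := fun hv => (h v hv).ne rfl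

lemma Full.mono {v : V} {C D : Finset V} (h : Full G v C) (hD : D ⊆ C) : Full G v D :=
  fun z hz => h z (hD hz)

lemma dg_succ_le_of_not_full {v : V} {C : Finset V} (h : ¬ Full G v C) : dg G C v + 1 ≤ C.card := by
  unfold Full at h; push Not at h
  obtain ⟨z, hz, hn⟩ := h
  exact dg_lt_card hz hn

lemma full_of_card_le {v : V} {C : Finset V} (h : C.card ≤ dg G C v) : Full G v C :=
  dg_full.1 (le_antisymm (dg_le_card _ _) h)

lemma Reach.mem {C : Finset V} (h : Reach G W S C) : C = W ∨ C ∈ S := by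
  cases h with
  | base => exact Or.inl rfl
  | step _ h => exact Or.inr h

lemma Reach.mono {C : Finset V} (hS : S ⊆ S') (h : Reach G W S C) : Reach G W S' C := by
  induction h with
  | base => exact .base
  | step _ hD hw hf ih => exact ih.step (hS hD) hw hf

lemma Reach.filter {C : Finset V} (h : Reach G W S C) :
    Reach G W (S.filter (Reach G W S)) C := by
  induction h with
  | base => exact .base
  | step hr hD hw hf ih => exact ih.step (mem_filter.2 ⟨hD, hr.step hD hw hf⟩) hw hf

lemma Reach.erase_or {X : Finset V} (C : Finset V) (h : Reach G W S X) :
    Reach G W (S.erase C) X ∨ ∃ w ∈ C, Mov G W (S.erase C) w := by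
  induction h with
  | base => exact Or.inl .base
  | @step C' D w hr hD hw hf ih =>
    rcases ih with ih | ih
    · by_cases hDC : D = C
      · subst hDC; exact Or.inr ⟨w, hw, C', ih, hf⟩
      · exact Or.inl (ih.step (mem_erase.2 ⟨hDC, hD⟩) hw hf)
    · exact Or.inr ih

lemma Reach.exists_mov {C : Finset V} (h : Reach G W S C) (hC : C ≠ W) :
    ∃ w ∈ C, Mov G W (S.erase C) w := by
  cases h with
  | base => exact absurd rfl hC
  | @step C' _ w hr hD hw hf =>
    rcases hr.erase_or C with h' | h'
    · exact ⟨w, hw, C', h', hf⟩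
    · exact h'

lemma Reach.exists_full_base {C : Finset V} (h : Reach G W S C) :
    C = W ∨ ∃ D ∈ S, ∃ w ∈ D, Full G w W := by
  induction h with
  | base => exact Or.inl rfl
  | @step C' D w hr hD hw hf ih =>
    right
    rcases ih with rfl | ih
    · exact ⟨D, hD, w, hw, hf⟩
    · exact ih

/-- Moving `y` into a chain of classes ending at `W`. -/
lemma has_tri_of_mov (hW : Edge G W) {y : V} (hS : Fam (Tri G) X S) (hd : Disjoint W (un S))
    (hy : y ∉ W ∪ un S) (hm : Mov G W S y) : Has (Tri G) (insert y (W ∪ un S)) (S.card + 1) := by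
  induction hn : S.card generalizing S y with
  | zero =>
    obtain ⟨C, hr, hf⟩ := hm
    rw [card_eq_zero] at hn
    subst hn
    rcases hr.mem with rfl | h
    · exact has_one (hW.insert_tri hf.notMem hf) (by simp)
    · simp at h
  | succ n ih =>
    obtain ⟨C, hr, hf⟩ := hm
    by_cases hCW : C = W
    · subst hCW
      rw [← hn, add_comm, ← insert_union]
      exact (has_one (hW.insert_tri hf.notMem hf) Subset.rfl).add hS.has
        (disjoint_insert_left.2 ⟨fun h => hy (mem_union_right _ h), hd⟩)
    · have hC : C ∈ S := hr.mem.resolve_left hCW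
      obtain ⟨w, hw, hm⟩ := hr.exists_mov hCW
      have hsub : un (S.erase C) ⊆ un S := un_mono (erase_subset _ _)
      have hCd : Disjoint C (un (S.erase C)) :=
        hS.disjoint_un hC (erase_subset _ _) (notMem_erase _ _)
      have hWC : Disjoint W C := hd.mono_right (subset_un hC)
      have hwn : w ∉ W ∪ un (S.erase C) := by
        rw [mem_union, not_or]
        exact ⟨fun h => disjoint_left.1 hWC h hw, disjoint_left.1 hCd hw⟩
      have h1 := ih (hS.mono (erase_subset _ _) (hsub.trans hS.un_sub)) (hd.mono_right hsub) hwn hm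
        (by rw [card_erase_of_mem hC, hn]; rfl)
      have hye : y ∉ C.erase w := fun h => hf.notMem (mem_of_mem_erase h)
      have h2 : Tri G (insert y (C.erase w)) :=
        ((hS.prop C hC).erase_edge hw).insert_tri hye (hf.mono (erase_subset _ _))
      refine (h1.add (has_one h2 Subset.rfl) ?_).mono ?_
      · rw [disjoint_left]
        intro v hv hv'
        have hvC : v ∈ C.erase w → False := fun h => by
          rcases mem_insert.1 hv with rfl | h'
          · exact ne_of_mem_erase h rfl
          · rcases mem_union.1 h' with h' | h'
            · exact disjoint_left.1 hWC h' (mem_of_mem_erase h)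
            · exact disjoint_left.1 hCd (mem_of_mem_erase h) h'
        rcases mem_insert.1 hv' with rfl | h'
        · rcases mem_insert.1 hv with rfl | h
          · exact hf.notMem hw
          · exact hy (union_subset_union_right hsub h)
        · exact hvC h'
      · intro v hv
        have := subset_un hC
        simp only [mem_union, mem_insert, mem_erase] at hv ⊢
        rcases hv with (rfl | h | h) | rfl | h
        · exact Or.inr (Or.inr (this hw))
        · exact Or.inr (Or.inl h)
        · exact Or.inr (Or.inr (hsub h))
        · exact Or.inl rfl
        · exact Or.inr (Or.inr (this h.2))

/-- An edge `W` together with disjoint triangles, all reachable, such that no further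
vertex is completely joined to a class. -/
structure Acc (G : SimpleGraph V) (k : ℕ) (X W : Finset V) (A : Finset (Finset V)) : Prop where
  fam : Fam (Tri G) X A
  Wsub : W ⊆ X
  edge : Edge G W
  disj : Disjoint W (un A)
  reach : ∀ D ∈ A, Reach G W A D
  nf : ∀ b ∈ X, b ∉ W ∪ un A → ∀ C, (C = W ∨ C ∈ A) → ¬ Full G b C
  card : A.card + 1 ≤ k

lemma acc_of_packing {T : Finset (Finset V)} (hT : Fam (Tri G) X T)
    (hmax : ¬ Has (Tri G) X (T.card + 1)) (hk : T.card + 1 ≤ k) (hW : Edge G W) (hWX : W ⊆ X)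
    (hd : Disjoint W (un T)) : Acc G k X W (T.filter (Reach G W T)) := by
  have hsub : T.filter (Reach G W T) ⊆ T := filter_subset _ _
  have hfam : Fam (Tri G) X (T.filter (Reach G W T)) :=
    hT.mono hsub ((un_mono hsub).trans hT.un_sub)
  refine ⟨hfam, hWX, hW, hd.mono_right (un_mono hsub), fun D hD => (mem_filter.1 hD).2.filter, ?_,
    (Nat.succ_le_succ (card_le_card hsub)).trans hk⟩
  intro b hb hbn C hC hf
  have hrC : Reach G W T C := by
    rcases hC with rfl | hC
    · exact .base
    · exact (mem_filter.1 hC).2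
  have hbT : b ∉ un T := by
    intro h
    obtain ⟨D, hD, hbD⟩ := mem_un.1 h
    exact hbn (mem_union_right _ (mem_un.2 ⟨D, mem_filter.2 ⟨hD, hrC.step hD hbD hf⟩, hbD⟩))
  have h1 := has_tri_of_mov hW hfam (hd.mono_right (un_mono hsub)) hbn ⟨C, hrC.filter, hf⟩
  have h2 : Has (Tri G) (un (T \ T.filter (Reach G W T))) (T \ T.filter (Reach G W T)).card :=
    (hT.mono sdiff_subset ((un_mono sdiff_subset).trans hT.un_sub)).has
  have h3 := h1.add h2 ?_
  · apply hmax
    rw [add_right_comm, add_comm _ (card (T \ _)), card_sdiff_add_card_eq_card hsub] at h3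
    refine h3.mono ?_
    intro v hv
    have := hT.un_sub
    simp only [mem_union, mem_insert] at hv
    rcases hv with (rfl | h | h) | h
    · exact hb
    · exact hWX h
    · exact this (un_mono hsub h)
    · exact this (un_mono sdiff_subset h)
  · rw [disjoint_left]
    intro v hv hv'
    simp only [mem_union, mem_insert] at hv
    rcases hv with rfl | h | h
    · exact hbT (un_mono sdiff_subset hv')
    · exact disjoint_left.1 hd h (un_mono sdiff_subset hv')
    · obtain ⟨D, hD, hvD⟩ := mem_un.1 h
      obtain ⟨E, hE, hvE⟩ := mem_un.1 hv'
      have := hT.eq_of_mem (hsub hD) (mem_sdiff.1 hE).1 hvD hvE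
      subst this
      exact (mem_sdiff.1 hE).2 hD

namespace Acc
variable {A : Finset (Finset V)}

lemma ne_base (h : Acc G k X W A) {D : Finset V} (hD : D ∈ A) : D ≠ W := by
  rintro rfl
  have := (h.fam.prop D hD).1
  have := h.edge.1
  omega

lemma sub (h : Acc G k X W A) : W ∪ un A ⊆ X := union_subset h.Wsub h.fam.un_sub

lemma dg_eq (h : Acc G k X W A) (v : V) :
    dg G (W ∪ un A) v = dg G W v + ∑ C ∈ A, dg G C v := by
  rw [dg_union h.disj, dg_un h.fam]

lemma card_un (h : Acc G k X W A) : (un A).card = 3 * A.card := by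
  rw [un, card_biUnion (t := id) fun C hC D hD hne => h.fam.disj C hC D hD hne]
  simp only [id]
  rw [sum_congr rfl fun C hC => (h.fam.prop C hC).1]
  simp [mul_comm]

lemma dg_base_le (h : Acc G k X W A) {b : V} (hb : b ∈ X) (hb' : b ∉ W ∪ un A) : dg G W b ≤ 1 := by
  have := dg_succ_le_of_not_full (h.nf b hb hb' W (Or.inl rfl))
  rw [h.edge.1] at this
  omega

lemma dg_class_le (h : Acc G k X W A) {b : V} (hb : b ∈ X) (hb' : b ∉ W ∪ un A) {C : Finset V}
    (hC : C ∈ A) : dg G C b ≤ 2 := by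
  have := dg_succ_le_of_not_full (h.nf b hb hb' C (Or.inr hC))
  rw [(h.fam.prop C hC).1] at this
  omega

lemma sum_le {f : Finset V → ℕ} {B : Finset (Finset V)} (h : ∀ C ∈ B, f C ≤ 2) :
    ∑ C ∈ B, f C ≤ 2 * B.card := by
  have := sum_le_card_nsmul B f 2 h
  rw [smul_eq_mul, mul_comm] at this
  exact this

lemma dg_le (h : Acc G k X W A) {b : V} (hb : b ∈ X) (hb' : b ∉ W ∪ un A) :
    dg G (W ∪ un A) b ≤ 2 * A.card + 1 := by
  rw [h.dg_eq]
  have := h.dg_base_le hb hb'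
  have := sum_le (f := fun C => dg G C b) (B := A) (fun C hC => h.dg_class_le hb hb' hC)
  omega

/-- Every class other than `D` is reachable without using `D`. -/
def Term (G : SimpleGraph V) (W : Finset V) (A : Finset (Finset V)) (D : Finset V) : Prop :=
  ∀ C ∈ A.erase D, Reach G W (A.erase D) C

lemma exists_terminal (h : Acc G k X W A) (hA : A.Nonempty) :
    ∃ A' ⊆ A, A'.Nonempty ∧ ∃ U, ∀ D ∈ A', Term G W A D ∧
      ∀ w ∈ D, ∀ C, (C = W ∨ C ∈ A) → Full G w C → C ∈ A' ∨ C = U := by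
  by_cases hall : ∀ D ∈ A, Term G W A D
  · exact ⟨A, Subset.rfl, hA, W, fun D hD => ⟨hall D hD, fun w _ C hC _ => hC.symm⟩⟩
  let T : Finset V → Finset (Finset V) := fun D =>
    (A.erase D).filter fun C => ¬ Reach G W (A.erase D) C
  have hT : ∀ D, (T D).Nonempty ↔ ¬ Term G W A D := by
    intro D
    rw [← not_iff_not, not_not, not_nonempty_iff_eq_empty, filter_eq_empty_iff]
    simp only [not_not]; rfl
  push Not at hall
  obtain ⟨D0, hD0, hD0'⟩ := hall
  obtain ⟨D, hD, hmin⟩ := exists_min_image (A.filter fun D => ¬ Term G W A D) (fun D => (T D).card)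
    ⟨D0, mem_filter.2 ⟨hD0, hD0'⟩⟩
  rw [mem_filter] at hD
  refine ⟨T D, (filter_subset _ _).trans (erase_subset _ _), (hT D).2 hD.2, D, fun D' hD' => ?_⟩
  have hD'r := (mem_filter.1 hD').2
  have hD'A := mem_of_mem_erase (mem_filter.1 hD').1
  have hD'D := ne_of_mem_erase (mem_filter.1 hD').1
  constructor
  · by_contra hnt
    have hle := hmin D' (mem_filter.2 ⟨hD'A, hnt⟩)
    have key : ∀ C, Reach G W (A.erase D) C → Reach G W (A.erase D') C := by
      intro C hC
      induction hC with
      | base => exact .base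
      | @step C' E w hr hE hw hf ih =>
        refine ih.step (mem_erase.2 ⟨?_, mem_of_mem_erase hE⟩) hw hf
        rintro rfl
        exact hD'r (hr.step hE hw hf)
    have hDr : Reach G W (A.erase D') D := by
      obtain ⟨w, hw, C', hr, hf⟩ := (h.reach D hD.1).exists_mov (h.ne_base hD.1)
      exact (key _ hr).step (mem_erase.2 ⟨hD'D.symm, hD.1⟩) hw hf
    have hss : T D' ⊆ (T D).erase D' := by
      intro C hC
      obtain ⟨hC1, hC2⟩ := mem_filter.1 hC
      refine mem_erase.2 ⟨ne_of_mem_erase hC1,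
        mem_filter.2 ⟨mem_erase.2 ⟨?_, mem_of_mem_erase hC1⟩, ?_⟩⟩
      · rintro rfl; exact hC2 hDr
      · exact fun hr => hC2 (key _ hr)
    have := card_le_card hss
    have := card_erase_add_one hD'
    omega
  · intro w hw C hC hf
    by_contra hcon
    rw [not_or] at hcon
    have hr : Reach G W (A.erase D) C := by
      rcases hC with rfl | hC
      · exact .base
      · by_contra hr
        exact hcon.1 (mem_filter.2 ⟨mem_erase.2 ⟨hcon.2, hC⟩, hr⟩)
    exact hD'r (hr.step (mem_filter.1 hD').1 hw hf)

lemma dg_le_of_terminal (h : Acc G k X W A) {A' : Finset (Finset V)} (hA' : A' ⊆ A) {U D : Finset V}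
    (hD : D ∈ A') {w : V} (hw : w ∈ D)
    (hf : ∀ C, (C = W ∨ C ∈ A) → Full G w C → C ∈ A' ∨ C = U) :
    dg G (W ∪ un A) w ≤ 2 * A.card + 1 + A'.card := by
  rw [h.dg_eq]
  have hWA : W ∉ A := fun hWA => h.ne_base hWA rfl
  have h1 : dg G W w ≤ 1 + if W = U then 1 else 0 := by
    split_ifs with hU
    · exact (dg_le_card _ _).trans h.edge.1.le
    · have : ¬ Full G w W := fun hfull => by
        rcases hf W (Or.inl rfl) hfull with h1 | h1
        · exact hWA (hA' h1)
        · exact hU h1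
      have := dg_succ_le_of_not_full this
      rw [h.edge.1] at this; omega
  have h2 : ∀ C ∈ A, dg G C w ≤ 2 + (if C ∈ A'.erase D then 1 else 0) + if C = U then 1 else 0 := by
    intro C hC
    by_cases hfull : Full G w C
    · have hne : C ≠ D := by rintro rfl; exact hfull.notMem hw
      have := dg_le_card (G := G) C w
      rw [(h.fam.prop C hC).1] at this
      rcases hf C (Or.inr hC) hfull with h1 | h1
      · rw [if_pos (mem_erase.2 ⟨hne, h1⟩)]; omega
      · rw [if_pos h1]; omega
    · have := dg_succ_le_of_not_full hfull
      rw [(h.fam.prop C hC).1] at this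
      omega
  have h3 := sum_le_sum h2
  rw [sum_add_distrib, sum_add_distrib, sum_const, smul_eq_mul, ← card_filter,
    filter_mem_eq_inter, inter_eq_right.2 ((erase_subset _ _).trans hA'), sum_ite_eq' A U] at h3
  have h4 := card_erase_add_one hD
  split_ifs at h1 h3 with h5 h6
  · subst h5; exact absurd h6 hWA
  all_goals omega

lemma exists_mov (h : Acc G k X W A) {D : Finset V} (hD : D ∈ A) :
    ∃ w ∈ D, Mov G W (A.erase D) w := (h.reach D hD).exists_mov (h.ne_base hD)

lemma has_of_mov (h : Acc G k X W A) {D : Finset V} (hD : D ∈ A) {w : V} (hw : w ∈ D)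
    (hm : Mov G W (A.erase D) w) : Has (Tri G) (insert w (W ∪ un (A.erase D))) A.card := by
  have hsub : un (A.erase D) ⊆ un A := un_mono (erase_subset _ _)
  have := has_tri_of_mov h.edge (h.fam.mono (erase_subset _ _) (hsub.trans h.fam.un_sub))
    (h.disj.mono_right hsub) (y := w) ?_ hm
  · rwa [card_erase_add_one hD] at this
  · rw [mem_union, not_or]
    exact ⟨fun h' => disjoint_left.1 h.disj h' (subset_un hD hw), fun h' =>
      disjoint_left.1 (h.fam.disjoint_un hD (erase_subset _ _) (notMem_erase _ _)) hw h'⟩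

lemma not_full_of_not_mov {D C : Finset V} {u : V} (ht : Term G W A D)
    (hm : ¬ Mov G W (A.erase D) u) (hC : C = W ∨ C ∈ A.erase D) : ¬ Full G u C := by
  intro hf
  rcases hC with rfl | hC
  · exact hm ⟨_, .base, hf⟩
  · exact hm ⟨C, ht C hC, hf⟩

/-- A vertex of a terminal class that cannot be moved. -/
lemma dg_le_of_not_mov (h : Acc G k X W A) {D : Finset V} (hD : D ∈ A) (ht : Term G W A D) {u : V}
    (hu : u ∈ D) (hm : ¬ Mov G W (A.erase D) u) : dg G (W ∪ un A) u ≤ 2 * A.card + 1 := by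
  rw [h.dg_eq]
  have h1 := dg_succ_le_of_not_full (not_full_of_not_mov ht hm (Or.inl rfl))
  rw [h.edge.1] at h1
  have := sum_le (f := fun C => dg G C u) (B := A) (fun C hC => ?_)
  · omega
  · by_cases hCD : C = D
    · subst hCD; exact ((h.fam.prop C hC).dg hu).le
    · have := dg_succ_le_of_not_full (not_full_of_not_mov ht hm (Or.inr (mem_erase.2 ⟨hCD, hC⟩)))
      rw [(h.fam.prop C hC).1] at this
      omega

end Acc

lemma Bad.del (h : Bad G k X) {Y Z : Finset V} (hY : Y ⊆ X) (hZ : Z ⊆ X) (hd : Disjoint Y Z)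
    (hne : Y.Nonempty) {m q : ℕ} (hm : Has (Cyc G) Y m) (hmq : m + q = k) (hq : 2 ≤ q)
    (hw : 3 * (q : ℤ) ≤ Wt G q Z) : False := by
  have hZX : Z ⊂ X := by
    refine ⟨hZ, fun hXZ => ?_⟩
    obtain ⟨v, hv⟩ := hne
    exact disjoint_left.1 hd hv (hXZ (hY hv))
  have := hm.add (h.ih Z hZX q hq hw) hd
  rw [hmq] at this
  exact h.no (this.mono (union_subset hY hZ))

lemma Bad.not_has (h : Bad G k X) {Y Z : Finset V} (hY : Y ⊆ X) (hZ : Z ⊆ X) (hd : Disjoint Y Z)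
    {m n : ℕ} (hm : Has (Cyc G) Y m) (hn : Has (Cyc G) Z n) (hmn : k ≤ m + n) : False :=
  h.no (((hm.add hn hd).mono (union_subset hY hZ)).le hmn)

lemma Has.cyc {n : ℕ} (h : Has (Tri G) X n) : Has (Cyc G) X n := h.imp fun _ h => h.cyc

lemma Acyc.sum_edge_le {J P : Finset V} (h : Acyc G (J ∪ P)) (hP : Edge G P) (hd : Disjoint J P) :
    ∑ v ∈ J, dg G J v + 2 * ∑ v ∈ J, dg G P v ≤ 2 * J.card := by
  have hne : (J ∪ P).Nonempty := by
    obtain ⟨v, hv⟩ := card_pos.1 (by rw [hP.1]; norm_num : 0 < P.card)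
    exact ⟨v, mem_union_right _ hv⟩
  have h1 := h.sum_le hne
  rw [sum_union hd, card_union_of_disjoint hd, hP.1] at h1
  simp only [dg_union hd, sum_add_distrib] at h1
  rw [sum_dg_comm P J, sum_congr rfl fun v hv => hP.dg hv (v := v)] at h1
  simp [hP.1] at h1
  omega

lemma Acc.wt_split {A : Finset (Finset V)} (h : Acc G k X W A) (f : V → ℤ) :
    ∑ v ∈ X, f v = ∑ v ∈ X \ (W ∪ un A), f v + ∑ v ∈ W, f v + ∑ v ∈ un A, f v := by
  rw [← sum_sdiff h.sub, sum_union h.disj, add_assoc]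

lemma Acc.sum_un_le {A : Finset (Finset V)} (h : Acc G k X W A) (f : V → ℕ) :
    ∑ v ∈ un A, phi k (f v) ≤ 3 * A.card := by
  have := sum_phi_le (S := un A) k f
  rw [h.card_un] at this
  exact_mod_cast this

lemma Acc.card_lt {A : Finset (Finset V)} (h : Acc G k X W A) (hb : Bad G k X) :
    A.card + 1 < k := by
  refine lt_of_le_of_ne h.card fun hk => ?_
  set J := X \ (W ∪ un A) with hJ
  have hJW : Disjoint J W := disjoint_sdiff.symm.mono_right subset_union_left
  have hJA : Disjoint J (un A) := disjoint_sdiff.symm.mono_right subset_union_right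
  obtain ⟨D0, hD0⟩ := card_pos.1 (by have := hb.hk; omega : 0 < A.card)
  obtain ⟨D, hD, w, hw, hf⟩ := ((h.reach D0 hD0).exists_full_base).resolve_left (h.ne_base hD0)
  have hDt := h.fam.prop D hD
  set P := D.erase w with hP
  have hPe : Edge G P := hDt.erase_edge hw
  have hPA : P ⊆ un A := (erase_subset _ _).trans (subset_un hD)
  have hJP : Disjoint J P := hJA.mono_right hPA
  have hDe : Disjoint D (un (A.erase D)) :=
    h.fam.disjoint_un hD (erase_subset _ _) (notMem_erase _ _)
  have hfe : Fam (Tri G) X (A.erase D) :=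
    h.fam.mono (erase_subset _ _) ((un_mono (erase_subset _ _)).trans h.fam.un_sub)
  have hue : un (A.erase D) ⊆ un A := un_mono (erase_subset _ _)
  have hac1 : Acyc G (J ∪ P) := by
    by_contra hc
    have h1 : Has (Cyc G) (insert w W ∪ un (A.erase D)) (1 + (A.erase D).card) :=
      Has.add (has_one (h.edge.insert_tri hf.notMem hf).cyc Subset.rfl) hfe.has.cyc
        (disjoint_insert_left.2 ⟨disjoint_left.1 hDe hw, h.disj.mono_right hue⟩)
    refine hb.not_has (union_subset sdiff_subset (hPA.trans h.fam.un_sub))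
      (union_subset (insert_subset (h.fam.un_sub (subset_un hD hw)) h.Wsub) hfe.un_sub) ?_
      (has_cyc_one.2 hc) h1 (by have := card_erase_add_one hD; omega)
    rw [disjoint_union_left, disjoint_union_right, disjoint_union_right, disjoint_insert_right,
      disjoint_insert_right]
    refine ⟨⟨⟨fun hwJ => disjoint_left.1 hJA hwJ (subset_un hD hw), hJW⟩, hJA.mono_right hue⟩,
      ⟨by simp [hP], h.disj.symm.mono_left hPA⟩, hDe.mono_left (erase_subset _ _)⟩
  have hac2 : Acyc G (J ∪ W) := by
    by_contra hc
    refine hb.not_has (union_subset sdiff_subset h.Wsub) h.fam.un_sub ?_ (has_cyc_one.2 hc)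
      h.fam.has.cyc (by omega)
    rw [disjoint_union_left]
    exact ⟨hJA, h.disj⟩
  set J1 := J.filter fun j => 1 ≤ dg G J j + dg G W j with hJ1
  have hJ1J : J1 ⊆ J := filter_subset _ _
  have e1 := (hac1.mono (union_subset_union_left hJ1J)).sum_edge_le hPe (hJP.mono_left hJ1J)
  have e2 := (hac2.mono (union_subset_union_left hJ1J)).sum_edge_le h.edge (hJW.mono_left hJ1J)
  have hdeg : ∀ j ∈ J, dg G X j ≤ dg G J j + dg G W j + dg G P j + 1 + 2 * (k - 2) ∧
      dg G X j ≤ dg G J j + dg G W j + 2 * (k - 1) := by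
    intro j hj
    obtain ⟨hjX, hjn⟩ := mem_sdiff.1 hj
    have a1 : dg G X j = dg G (W ∪ un A) j + dg G J j := dg_sdiff h.sub j
    rw [h.dg_eq, ← add_sum_erase A _ hD] at a1
    have a2 := Acc.sum_le (f := fun C => dg G C j) (B := A.erase D)
      (fun C hC => h.dg_class_le hjX hjn (mem_of_mem_erase hC))
    have a3 : dg G D j ≤ dg G P j + 1 := by
      rw [dg_erase hw, ← hP]; split_ifs <;> omega
    have a4 := h.dg_class_le hjX hjn hD
    have := card_erase_add_one hD
    constructor <;> omega
  have hk2 := hb.hk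
  have hJ1phi : ∑ j ∈ J1, phi k (dg G X j) ≤
      ∑ j ∈ J1, ((dg G J1 j : ℤ) + dg G W j + dg G P j - 2) := by
    refine sum_le_sum fun j hj => ?_
    obtain ⟨hjJ, hj1⟩ := mem_filter.1 hj
    obtain ⟨b1, b2⟩ := hdeg j hjJ
    have : dg G J1 j = dg G J j := by
      refine le_antisymm (dg_mono hJ1J _) (card_le_card fun u hu => ?_)
      rw [mem_filter] at hu ⊢
      refine ⟨mem_filter.2 ⟨hu.1, ?_⟩, hu.2⟩
      have : 0 < dg G J u := dg_pos.2 ⟨j, hjJ, hu.2.symm⟩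
      omega
    rw [this]
    unfold phi
    split_ifs <;> omega
  have hJ2phi : ∑ j ∈ J \ J1, phi k (dg G X j) ≤ 0 := by
    refine sum_nonpos fun j hj => ?_
    obtain ⟨hjJ, hj1⟩ := mem_sdiff.1 hj
    obtain ⟨b1, b2⟩ := hdeg j hjJ
    have : ¬ 1 ≤ dg G J j + dg G W j := fun h => hj1 (mem_filter.2 ⟨hjJ, h⟩)
    unfold phi
    split_ifs <;> omega
  have hwt := hb.wt
  rw [Wt, h.wt_split, ← hJ, ← sum_sdiff hJ1J] at hwt
  have c1 := sum_phi_le (S := W) k (dg G X)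
  have c2 := h.sum_un_le (dg G X)
  rw [h.edge.1] at c1
  rw [sum_sub_distrib, sum_add_distrib, sum_add_distrib] at hJ1phi
  simp only [sum_const, nsmul_eq_mul] at hJ1phi
  have e1' : ((∑ v ∈ J1, dg G J1 v : ℕ) : ℤ) + 2 * (∑ v ∈ J1, dg G P v : ℕ) ≤
      2 * (J1.card : ℤ) := by
    exact_mod_cast e1
  have e2' : ((∑ v ∈ J1, dg G J1 v : ℕ) : ℤ) + 2 * (∑ v ∈ J1, dg G W v : ℕ) ≤
      2 * (J1.card : ℤ) := by
    exact_mod_cast e2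
  push_cast at e1' e2' c1
  have hk' : (A.card : ℤ) + 1 = k := by exact_mod_cast hk
  linarith

end accessible

/-! ### The weight of an edge together with its accessible triangles -/

section weightbound

variable {G : SimpleGraph V} {W X : Finset V} {A : Finset (Finset V)} {k : ℕ}

lemma exists_full_erase {D : Finset V} (hD : D.card = 3) {b : V} (hn : ¬ Full G b D)
    (h : 2 ≤ dg G D b) : ∃ w ∈ D, Full G b (D.erase w) := by
  unfold Full at hn; push Not at hn
  obtain ⟨w, hw, hbw⟩ := hn
  refine ⟨w, hw, full_of_card_le ?_⟩
  rw [card_erase_of_mem hw, hD]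
  rw [dg_erase hw, if_neg hbw] at h
  omega

lemma Acyc.sum_filter_le {Z : Finset V} (h : Acyc G Z) (p : V → Prop) [DecidablePred p]
    (hp : ∀ v ∈ Z, p v → ∀ u ∈ Z, G.Adj v u → p u) (hne : (Z.filter p).Nonempty) :
    ∑ v ∈ Z.filter p, dg G Z v + 2 ≤ 2 * (Z.filter p).card := by
  rw [sum_congr rfl fun v hv => (?_ : dg G Z v = dg G (Z.filter p) v)]
  · exact (h.mono (filter_subset _ _)).sum_le hne
  · obtain ⟨h1, h2⟩ := mem_filter.1 hv
    refine le_antisymm (card_le_card fun u hu => ?_) (dg_mono (filter_subset _ _) _)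
    rw [mem_filter] at hu ⊢
    exact ⟨mem_filter.2 ⟨hu.1, hp v h1 h2 u hu.1 hu.2⟩, hu.2⟩

lemma Acc.wt_outside (h : Acc G k X W A) (hb : Bad G k X) :
    3 * (k : ℤ) - 3 * A.card - ∑ v ∈ W, phi k (dg G X v) ≤
      ∑ v ∈ X \ (W ∪ un A), phi k (dg G X v) := by
  have h1 := hb.wt
  rw [Wt, h.wt_split] at h1
  have := h.sum_un_le (dg G X)
  linarith

lemma Acc.has_of_mov_of_full (h : Acc G k X W A) {D : Finset V} (hD : D ∈ A) {w y : V} (hw : w ∈ D)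
    (hm : Mov G W (A.erase D) w) (hy : y ∉ W ∪ un A) (hf : Full G y (D.erase w)) :
    Has (Tri G) (insert y (W ∪ un A)) (A.card + 1) := by
  have hye : y ∉ D.erase w := hf.notMem
  have hDe : Disjoint D (un (A.erase D)) :=
    h.fam.disjoint_un hD (erase_subset _ _) (notMem_erase _ _)
  have hsub : un (A.erase D) ⊆ un A := un_mono (erase_subset _ _)
  have hDA := subset_un hD
  have hWD : Disjoint W D := h.disj.mono_right hDA
  refine ((h.has_of_mov hD hw hm).add
    (has_one (((h.fam.prop D hD).erase_edge hw).insert_tri hye hf) Subset.rfl) ?_).mono ?_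
  · rw [disjoint_insert_left, disjoint_insert_right, disjoint_union_left]
    refine ⟨?_, fun h' => hy (union_subset_union_right hsub h'),
      hWD.mono_right (erase_subset _ _), hDe.symm.mono_right (erase_subset _ _)⟩
    rw [mem_insert, not_or]
    exact ⟨fun e => hy (mem_union_right _ (e ▸ hDA hw)), notMem_erase _ _⟩
  · intro v hv
    simp only [mem_union, mem_insert] at hv ⊢
    rcases hv with (rfl | hv | hv) | rfl | hv
    · exact Or.inr (Or.inr (hDA hw))
    · exact Or.inr (Or.inl hv)
    · exact Or.inr (Or.inr (hsub hv))
    · exact Or.inl rfl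
    · exact Or.inr (Or.inr (hDA (mem_of_mem_erase hv)))

lemma Acc.solo (h : Acc G k X W A) (hb : Bad G k X) {D : Finset V} (hD : D ∈ A) {w y : V}
    (hw : w ∈ D) (hm : Mov G W (A.erase D) w) (hyX : y ∈ X) (hy : y ∉ W ∪ un A)
    (hf : Full G y (D.erase w)) : A.card + 2 = k ∧ 4 ≤ dg G (X \ (W ∪ un A)) y := by
  have hcy := (h.has_of_mov_of_full hD hw hm hy hf).cyc
  set B := X \ (W ∪ un A) with hB
  have hyB : y ∈ B := mem_sdiff.2 ⟨hyX, hy⟩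
  have hlt := h.card_lt hb
  have hYX : insert y (W ∪ un A) ⊆ X := insert_subset hyX h.sub
  have hZX : B.erase y ⊆ X := (erase_subset _ _).trans sdiff_subset
  have hdis : Disjoint (insert y (W ∪ un A)) (B.erase y) := by
    rw [disjoint_insert_left]
    exact ⟨notMem_erase _ _, disjoint_sdiff.mono_right (erase_subset _ _)⟩
  have hdeg : ∀ v ∈ B, dg G X v ≤ dg G B v + 2 * A.card + 1 := by
    intro v hv
    have h1 := mem_sdiff.1 hv
    have := h.dg_le h1.1 h1.2
    have := dg_sdiff (G := G) h.sub v
    rw [← hB] at this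
    omega
  have hwB := h.wt_outside hb
  have c1 := sum_phi_le (S := W) k (dg G X)
  rw [h.edge.1] at c1
  rw [← hB, ← add_sum_erase B _ hyB] at hwB
  have c2 := phi_le_one k (dg G X y)
  by_cases hq : A.card + 2 = k
  · refine ⟨hq, ?_⟩
    by_contra! hlt4
    have hac : Acyc G (B.erase y) := by
      by_contra hc
      exact hb.not_has hYX hZX hdis hcy (has_cyc_one.2 hc) (by omega)
    set Z := B.erase y with hZ
    set F := Z.filter fun v => 1 ≤ dg G Z v with hF
    have hphi : ∀ v ∈ Z, phi k (dg G X v) ≤ (if 1 ≤ dg G Z v then (dg G Z v : ℤ) - 2 else -1)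
        + (if G.Adj v y then 1 else 0) := by
      intro v hv
      have h1 := hdeg v (mem_of_mem_erase hv)
      rw [dg_erase hyB, ← hZ] at h1
      unfold phi
      split_ifs at h1 ⊢ <;> omega
    have hs := sum_le_sum hphi
    rw [sum_add_distrib, sum_ite, sum_sub_distrib] at hs
    have hadj : ∑ v ∈ Z, (if G.Adj v y then (1 : ℤ) else 0) = dg G B y := by
      rw [← dg_erase_self, dg, card_filter]
      push_cast
      simp only [G.adj_comm, hZ]
    rw [hadj] at hs
    simp only [sum_const, nsmul_eq_mul] at hs
    have hF2 : (∑ v ∈ F, (dg G Z v : ℤ)) - (F.card : ℤ) * 2 ≤ if F.Nonempty then -2 else 0 := by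
      split_ifs with hne
      · have := hac.sum_filter_le (fun v => 1 ≤ dg G Z v)
          (fun v hv _ u hu huv => dg_pos.2 ⟨v, hv, huv.symm⟩) hne
        have h3 : ((∑ v ∈ F, dg G Z v : ℕ) : ℤ) + 2 ≤ 2 * (F.card : ℤ) := by exact_mod_cast this
        push_cast at h3
        linarith
      · rw [not_nonempty_iff_eq_empty.1 hne]; simp
    have hk' : (A.card : ℤ) + 2 = k := by exact_mod_cast hq
    have hB3 : (dg G B y : ℤ) ≤ 3 := by exact_mod_cast (by omega : dg G B y ≤ 3)
    push_cast at c1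
    split_ifs at hF2 with hne
    · have hnn : (0 : ℤ) ≤ (Z.filter fun v => ¬ 1 ≤ dg G Z v).card := Int.natCast_nonneg _
      rw [← hF] at hs
      linarith
    · have hempty : ∀ v ∈ Z, ¬ 1 ≤ dg G Z v := fun v hv h1 => hne ⟨v, mem_filter.2 ⟨hv, h1⟩⟩
      have hN : (Z.filter fun v => ¬ 1 ≤ dg G Z v) = Z := filter_true_of_mem hempty
      have hle : dg G B y ≤ Z.card := by rw [← dg_erase_self]; exact dg_le_card _ _
      rw [hN] at hs
      have hle' : (dg G B y : ℤ) ≤ Z.card := by exact_mod_cast hle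
      linarith
  · exfalso
    refine hb.del hYX hZX hdis ⟨y, mem_insert_self _ _⟩ hcy (q := k - (A.card + 1)) (by omega)
      (by omega) ?_
    rw [Wt]
    have : ∑ v ∈ B.erase y, phi k (dg G X v) ≤
        ∑ v ∈ B.erase y, phi (k - (A.card + 1)) (dg G (B.erase y) v) := by
      refine sum_le_sum fun v hv => phi_le_of_le (m := A.card + 1) (by omega) ?_
      have h1 := hdeg v (mem_of_mem_erase hv)
      rw [dg_erase hyB] at h1
      split_ifs at h1 <;> omega
    push_cast [hlt.le] at c1 ⊢
    linarith

lemma Acc.nonempty (h : Acc G k X W A) (hb : Bad G k X)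
    (hW : ∑ v ∈ W, phi k (dg G X v) ≤ 1) : A.Nonempty := by
  by_contra hA
  rw [not_nonempty_iff_eq_empty] at hA
  subst hA
  obtain ⟨x, y, hxy, rfl⟩ := card_eq_two.1 h.edge.1
  have hadj := h.edge.2 x (by simp) y (by simp) hxy
  have hh := hb.ctr x (h.Wsub (by simp)) y (h.Wsub (by simp)) hadj (by
    rintro z hz ⟨h1, h2⟩
    refine h.nf z hz ?_ _ (Or.inl rfl) ?_
    · simp [h1.ne', h2.ne']
    · simp [Full, h1.symm, h2.symm])
  rw [sum_pair hxy, phi_eq_one.2 hh.1, phi_eq_one.2 hh.2] at hW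
  norm_num at hW

/-- If `W` is not the edge of two high vertices, it has positive weight, and more so if there are
medium vertices nonadjacent to it. -/
lemma Acc.weight (h : Acc G k X W A) (hb : Bad G k X) (hW : ∑ v ∈ W, phi k (dg G X v) ≤ 1)
    {Y : Finset V} (hY : ∀ y ∈ Y, y ∈ X ∧ y ∉ W ∪ un A ∧ phi k (dg G X y) = 0 ∧ dg G W y = 0) :
    1 + (Y.card : ℤ) ≤ ∑ v ∈ W, phi k (dg G X v) := by
  by_contra! hcon
  have hlt := h.card_lt hb
  obtain ⟨A', hA', ⟨D, hDA'⟩, U, hT⟩ := h.exists_terminal (h.nonempty hb hW)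
  have hD := hA' hDA'
  have ht := (hT D hDA').1
  have hDt := h.fam.prop D hD
  have hcE := card_erase_add_one hD
  set B := X \ (W ∪ un A) with hB
  have hYB : Y ⊆ B := fun y hy => mem_sdiff.2 ⟨(hY y hy).1, (hY y hy).2.1⟩
  set q := k - A.card with hq
  have hsumY : ∀ f : V → ℤ, (∀ b ∈ B, phi k (dg G X b) + (if b ∈ Y then 1 else 0) ≤ f b) →
      ∑ b ∈ B, phi k (dg G X b) + Y.card ≤ ∑ b ∈ B, f b := by
    intro f hf
    have := sum_le_sum hf
    rw [sum_add_distrib, sum_ite_mem, inter_eq_right.2 hYB] at this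
    simpa using this
  have hwB := h.wt_outside hb
  rw [← hB] at hwB
  set M := D.filter (Mov G W (A.erase D)) with hM
  obtain ⟨w, hwD, hwm⟩ := h.exists_mov hD
  have hqk : (q : ℤ) = k - A.card := by omega
  by_cases hMc : M.card ≤ 2
  · set Z := B ∪ D.erase w with hZ
    set Y' := insert w (W ∪ un (A.erase D)) with hY'
    have hDe : Disjoint D (un (A.erase D)) :=
      h.fam.disjoint_un hD (erase_subset _ _) (notMem_erase _ _)
    have hue : un (A.erase D) ⊆ un A := un_mono (erase_subset _ _)
    have hDA := subset_un hD
    have hWD : Disjoint W D := h.disj.mono_right hDA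
    have hBD : Disjoint B D := disjoint_sdiff.symm.mono_right (hDA.trans subset_union_right)
    have hY'X : Y' ⊆ X := insert_subset (h.fam.un_sub (hDA hwD))
      ((union_subset_union_right hue).trans h.sub)
    have hZX : Z ⊆ X := union_subset sdiff_subset
      ((erase_subset _ _).trans (hDA.trans h.fam.un_sub))
    have hwn : w ∉ W ∪ un (A.erase D) := by
      rw [mem_union, not_or]
      exact ⟨fun h' => disjoint_left.1 hWD h' hwD, disjoint_left.1 hDe hwD⟩
    have hdis : Disjoint Y' Z := by
      rw [disjoint_union_right, disjoint_insert_left, disjoint_insert_left]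
      exact ⟨⟨fun h' => disjoint_left.1 hBD h' hwD,
        disjoint_sdiff.mono_left (union_subset_union_right hue)⟩, notMem_erase _ _,
        disjoint_union_left.2 ⟨hWD.mono_right (erase_subset _ _),
          hDe.symm.mono_right (erase_subset _ _)⟩⟩
    have hcov : X = Z ∪ Y' := by
      have h1 : un A = D ∪ un (A.erase D) := by rw [← un_insert, insert_erase hD]
      refine Subset.antisymm (fun v hv => ?_) (union_subset hZX hY'X)
      simp only [hZ, hY', hB, h1, mem_union, mem_insert, mem_sdiff, mem_erase]
      tauto
    have hdegX : ∀ v, dg G X v = dg G Z v + (dg G W v + ∑ C ∈ A.erase D, dg G C v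
        + if G.Adj v w then 1 else 0) := by
      intro v
      rw [hcov, dg_union hdis.symm, hY', dg_insert hwn, dg_union (h.disj.mono_right hue),
        dg_un (h.fam.mono (erase_subset _ _) (hue.trans h.fam.un_sub))]
    refine hb.del hY'X hZX hdis ⟨w, mem_insert_self _ _⟩ (h.has_of_mov hD hwD hwm).cyc (q := q)
      (by omega) (by omega) ?_
    have hBsum := hsumY (fun b => phi q (dg G Z b)) (fun b hb' => by
      obtain ⟨hbX, hbn⟩ := mem_sdiff.1 hb'
      have e1 := hdegX b
      have e2 := h.dg_base_le hbX hbn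
      have e3 := Acc.sum_le (f := fun C => dg G C b) (B := A.erase D)
        (fun C hC => h.dg_class_le hbX hbn (mem_of_mem_erase hC))
      have e4 : dg G X b ≤ dg G Z b + 2 * A.card := by split_ifs at e1 <;> omega
      split_ifs with hbY
      · obtain ⟨-, -, e5, e6⟩ := hY b hbY
        rw [e5, phi_eq_one.2]
        · norm_num
        · rw [phi_eq_zero] at e5
          split_ifs at e1 <;> omega
      · rw [add_zero]; exact phi_le_of_le (m := A.card) (by omega) e4)
    have hDsum : ∑ u ∈ D.erase w, (phi k (dg G X u) - (if Mov G W (A.erase D) u then 2 else 0)) ≤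
        ∑ u ∈ D.erase w, phi q (dg G Z u) := by
      refine sum_le_sum fun u hu => ?_
      have huD := mem_of_mem_erase hu
      split_ifs with hmu
      · have := phi_le_one k (dg G X u)
        have := neg_one_le_phi q (dg G Z u)
        omega
      · rw [sub_zero]
        refine phi_le_of_le (m := A.card) (by omega) ?_
        have e1 := hdegX u
        have e2 := dg_succ_le_of_not_full (Acc.not_full_of_not_mov ht hmu (Or.inl rfl))
        rw [h.edge.1] at e2
        have e3 := Acc.sum_le (f := fun C => dg G C u) (B := A.erase D) (fun C hC => by
          have := dg_succ_le_of_not_full (Acc.not_full_of_not_mov ht hmu (Or.inr hC))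
          rw [(h.fam.prop C (mem_of_mem_erase hC)).1] at this
          omega)
        split_ifs at e1 <;> omega
    rw [sum_sub_distrib] at hDsum
    have hMe : ∑ u ∈ D.erase w, (if Mov G W (A.erase D) u then (2 : ℤ) else 0) ≤ 2 := by
      rw [sum_ite, sum_const, sum_const_zero, filter_erase, nsmul_eq_mul, ← hM]
      have hwM : w ∈ M := mem_filter.2 ⟨hwD, hwm⟩
      have h1 := card_erase_add_one hwM
      have h2 : (M.erase w).card ≤ 1 := by omega
      have h3 : ((M.erase w).card : ℤ) ≤ 1 := by exact_mod_cast h2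
      linarith
    have hwX := hb.wt
    rw [Wt, h.wt_split, ← hB, ← insert_erase hD, un_insert, sum_union hDe,
      ← add_sum_erase D _ hwD] at hwX
    rw [Wt, hZ, sum_union (hBD.mono_right (erase_subset _ _)), ← hZ]
    have c1 := phi_le_one k (dg G X w)
    have c2 : ∑ v ∈ un (A.erase D), phi k (dg G X v) ≤ 3 * ((A.card : ℤ) - 1) := by
      have := sum_phi_le (S := un (A.erase D)) k (dg G X)
      have h1 := h.card_un
      rw [← insert_erase hD, un_insert, card_union_of_disjoint hDe, insert_erase hD, hDt.1] at h1
      have h2 : ((un (A.erase D)).card : ℤ) = 3 * A.card - 3 := by omega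
      linarith
    rw [hqk]
    linarith
  · have hMD : ∀ u ∈ D, Mov G W (A.erase D) u := by
      have : M = D := eq_of_subset_of_card_le (filter_subset _ _) (by rw [hDt.1]; omega)
      intro u hu
      rw [← this] at hu
      exact (mem_filter.1 hu).2
    have hBX : B ⊆ X := sdiff_subset
    refine hb.del h.sub hBX disjoint_sdiff ⟨w, mem_union_right _ (subset_un hD hwD)⟩
      (h.fam.has.cyc.mono subset_union_right) (q := q) (by omega) (by omega) ?_
    have hBsum := hsumY (fun b => phi q (dg G B b)) (fun b hb' => by
      obtain ⟨hbX, hbn⟩ := mem_sdiff.1 hb'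
      have e1 := dg_sdiff (G := G) h.sub b
      rw [h.dg_eq, ← hB, ← add_sum_erase A _ hD] at e1
      have e2 := h.dg_base_le hbX hbn
      have e3 := Acc.sum_le (f := fun C => dg G C b) (B := A.erase D)
        (fun C hC => h.dg_class_le hbX hbn (mem_of_mem_erase hC))
      by_cases hbD : 2 ≤ dg G D b
      · obtain ⟨u, hu, hf⟩ := exists_full_erase hDt.1 (h.nf b hbX hbn D (Or.inr hD)) hbD
        obtain ⟨f1, f2⟩ := h.solo hb hD hu (hMD u hu) hbX hbn hf
        rw [← hB] at f2
        rw [phi_eq_one.2 (by omega : 2 * q ≤ dg G B b)]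
        split_ifs with hbY
        · rw [(hY b hbY).2.2.1]; norm_num
        · have := phi_le_one k (dg G X b); omega
      · split_ifs with hbY
        · obtain ⟨-, -, e5, e6⟩ := hY b hbY
          rw [e5, phi_eq_one.2]
          · norm_num
          · rw [phi_eq_zero] at e5
            omega
        · rw [add_zero]; exact phi_le_of_le (m := A.card) (by omega) (by omega))
    rw [Wt, hqk]
    linarith

end weightbound

/-! ### Counterexamples with `3 * k` vertices, all high -/

section tiling

variable {G : SimpleGraph V} {W X : Finset V} {A : Finset (Finset V)} {k q : ℕ}

lemma Cyc.three_le {C : Finset V} (h : Cyc G C) : 3 ≤ C.card := by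
  obtain ⟨v, hv⟩ := h.1
  have := h.2 v hv
  have := dg_lt_card_self (G := G) hv
  omega

lemma Cyc.tri {C : Finset V} (h : Cyc G C) (hC : C.card ≤ 3) : Tri G C := by
  have h3 := h.three_le
  refine ⟨by omega, fun x hx y hy hxy => ?_⟩
  by_contra hn
  have h1 := h.2 x hx
  have h2 := dg_lt_card (G := G) (S := C.erase x) (mem_erase.2 ⟨hxy.symm, hy⟩) hn
  rw [dg_erase_self, card_erase_of_mem hx] at h2
  omega

lemma Has.three_mul_le {n : ℕ} (h : Has (Cyc G) X n) : 3 * n ≤ X.card := by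
  induction n generalizing X with
  | zero => omega
  | succ n ih =>
    obtain ⟨C, hC, hp, hr⟩ := h
    have := ih hr
    have := hp.three_le
    have := card_sdiff_add_card_eq_card hC
    omega

lemma Has.tri {n : ℕ} (h : Has (Cyc G) X n) (hX : X.card ≤ 3 * n) : Has (Tri G) X n := by
  induction n generalizing X with
  | zero => trivial
  | succ n ih =>
    obtain ⟨C, hC, hp, hr⟩ := h
    have := hr.three_mul_le
    have := hp.three_le
    have := card_sdiff_add_card_eq_card hC
    exact ⟨C, hC, hp.tri (by omega), ih hr (by omega)⟩

lemma sum_le_card {S : Finset V} {f : V → ℕ} (h : ∀ v ∈ S, f v ≤ 1) : ∑ v ∈ S, f v ≤ S.card := by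
  simpa using sum_le_card_nsmul S f 1 h

lemma Fam.card_un_tri {T : Finset (Finset V)} (h : Fam (Tri G) X T) : (un T).card = 3 * T.card := by
  rw [un, card_biUnion (t := id) fun C hC D hD hne => h.disj C hC D hD hne, mul_comm]
  exact sum_const_nat fun C hC => (h.prop C hC).1

/-- The extremal situation: all vertices are high, and the number of accessible triangles is
maximum. -/
structure Ext (G : SimpleGraph V) (k q : ℕ) (X W : Finset V) (A : Finset (Finset V)) : Prop where
  acc : Acc G k X W A
  bad : Bad G k X
  hq : A.card + 1 + q = k
  card : X.card = 3 * k
  high : ∀ v ∈ X, 2 * k ≤ dg G X v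
  max : ∀ T, Fam (Tri G) X T → T.card + 1 = k → Disjoint W (un T) →
    (T.filter (Reach G W T)).card ≤ A.card

namespace Ext

lemma q_pos (h : Ext G k q X W A) : 1 ≤ q := by
  have := h.acc.card_lt h.bad
  have := h.hq
  omega

lemma card_base (h : Ext G k q X W A) : (W ∪ un A).card = 3 * A.card + 2 := by
  rw [card_union_of_disjoint h.acc.disj, h.acc.edge.1, h.acc.card_un]; ring

lemma card_out (h : Ext G k q X W A) : (X \ (W ∪ un A)).card = 3 * q + 1 := by
  have := card_sdiff_add_card_eq_card h.acc.sub
  have := h.card_base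
  have := h.card
  have := h.hq
  omega

lemma le_dg (h : Ext G k q X W A) {b : V} (hb : b ∈ X \ (W ∪ un A)) :
    2 * q + 1 ≤ dg G (X \ (W ∪ un A)) b := by
  obtain ⟨h1, h2⟩ := mem_sdiff.1 hb
  have := h.acc.dg_le h1 h2
  have := h.high b h1
  have := dg_sdiff (G := G) h.acc.sub b
  have := h.hq
  omega

lemma exists_fam (h : Ext G k q X W A) {b : V} (hb : b ∈ X \ (W ∪ un A)) :
    ∃ P, Fam (Tri G) ((X \ (W ∪ un A)).erase b) P ∧ P.card = q ∧
      un P = (X \ (W ∪ un A)).erase b := by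
  have hq := h.q_pos
  have hc := card_erase_add_one hb
  rw [h.card_out] at hc
  set Z := (X \ (W ∪ un A)).erase b with hZ
  have hdeg : ∀ v ∈ Z, 2 * q ≤ dg G Z v := by
    intro v hv
    have := h.le_dg (mem_of_mem_erase hv)
    rw [dg_erase hb, ← hZ] at this
    split_ifs at this <;> omega
  have hcyc : Has (Cyc G) Z q := by
    rcases hq.eq_or_lt with rfl | hq
    · exact has_one ⟨card_pos.1 (by omega), fun v hv => by have := hdeg v hv; omega⟩ Subset.rfl
    · refine h.bad.ih Z ?_ q hq ?_
      · exact (erase_ssubset hb).trans_subset sdiff_subset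
      · rw [Wt, sum_congr rfl fun v hv => phi_eq_one.2 (hdeg v hv)]
        simp only [sum_const, nsmul_eq_mul]
        omega
  obtain ⟨P, hP, hPc⟩ := (hcyc.tri (by omega)).exists_fam fun C hC => hC.nonempty
  refine ⟨P, hP, hPc, eq_of_subset_of_card_le hP.un_sub ?_⟩
  rw [hP.card_un_tri]; omega

lemma not_full (h : Ext G k q X W A) {D : Finset V} (hD : D ∈ A) {w b : V} (hw : w ∈ D)
    (hm : Mov G W (A.erase D) w) (hb : b ∈ X \ (W ∪ un A)) : ¬ Full G b (D.erase w) := by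
  intro hf
  obtain ⟨h1, h2⟩ := mem_sdiff.1 hb
  obtain ⟨P, hP, hPc, hPu⟩ := h.exists_fam hb
  have := hP.has
  rw [hPu, hPc] at this
  refine h.bad.not_has (insert_subset h1 h.acc.sub) ((erase_subset _ _).trans sdiff_subset) ?_
    (h.acc.has_of_mov_of_full hD hw hm h2 hf).cyc this.cyc h.hq.ge
  rw [disjoint_insert_left]
  exact ⟨notMem_erase _ _, disjoint_sdiff.mono_right (erase_subset _ _)⟩

lemma nonempty (h : Ext G k q X W A) : A.Nonempty := by
  by_contra hA
  rw [not_nonempty_iff_eq_empty] at hA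
  subst hA
  have h1 : ∑ b ∈ X \ (W ∪ un ∅), dg G W b ≤ (X \ (W ∪ un ∅)).card :=
    sum_le_card fun b hb => h.acc.dg_base_le (mem_sdiff.1 hb).1 (mem_sdiff.1 hb).2
  rw [h.card_out, sum_dg_comm] at h1
  have h2 : ∀ w ∈ W, 2 * k - 1 ≤ dg G (X \ (W ∪ un ∅)) w := by
    intro w hw
    have := h.high w (h.acc.Wsub hw)
    have h3 := dg_sdiff (G := G) h.acc.sub w
    rw [h.acc.dg_eq, h.acc.edge.dg hw] at h3
    simp only [sum_empty] at h3
    omega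
  have h3 : W.card • (2 * k - 1) ≤ ∑ w ∈ W, dg G (X \ (W ∪ un ∅)) w :=
    card_nsmul_le_sum _ _ _ h2
  rw [h.acc.edge.1, smul_eq_mul] at h3
  have := h.hq
  have := h.q_pos
  have := h.bad.hk
  have := h.hq
  simp only [card_empty] at this
  omega

lemma sum_erase_le (h : Ext G k q X W A) {D : Finset V} (hD : D ∈ A) {w : V} (hw : w ∈ D)
    (hm : Mov G W (A.erase D) w) : ∑ v ∈ D.erase w, dg G (X \ (W ∪ un A)) v ≤ 3 * q + 1 := by
  rw [sum_dg_comm, ← h.card_out]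
  refine sum_le_card fun b hb => ?_
  · have := dg_succ_le_of_not_full (h.not_full hD hw hm hb)
    rw [card_erase_of_mem hw, (h.acc.fam.prop D hD).1] at this
    omega

lemma exists_full (h : Ext G k q X W A) {D : Finset V} (hD : D ∈ A) {b : V}
    (hb : b ∈ X \ (W ∪ un A)) (h2 : 2 ≤ dg G D b) :
    ∃ u ∈ D, ¬ Mov G W (A.erase D) u ∧ Full G b (D.erase u) := by
  obtain ⟨h3, h4⟩ := mem_sdiff.1 hb
  obtain ⟨u, hu, hf⟩ := exists_full_erase (h.acc.fam.prop D hD).1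
    (h.acc.nf b h3 h4 D (Or.inr hD)) h2
  exact ⟨u, hu, fun hm => h.not_full hD hu hm hb hf, hf⟩

lemma class_bound (h : Ext G k q X W A) {A' : Finset (Finset V)} (hA' : A' ⊆ A) {U D : Finset V}
    (hDA' : D ∈ A') (ht : Acc.Term G W A D)
    (hf : ∀ w ∈ D, ∀ C, (C = W ∨ C ∈ A) → Full G w C → C ∈ A' ∨ C = U) :
    ((X \ (W ∪ un A)).filter fun b => 2 ≤ dg G D b).card ≤ q ∧ q + 1 ≤ A'.card ∧
      ∃ u ∈ D, ∃ w ∈ D.erase u, Mov G W (A.erase D) w ∧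
        ∀ b ∈ X \ (W ∪ un A), 2 ≤ dg G D b → Full G b (D.erase u) := by
  have hD := hA' hDA'
  have hDt := h.acc.fam.prop D hD
  have hDX := h.acc.fam.sub D hD
  obtain ⟨w, hw, hm⟩ := h.acc.exists_mov hD
  have hwe := card_erase_add_one hw
  have hin : ∀ v ∈ D, 2 * q + 1 ≤ dg G (X \ (W ∪ un A)) v + A'.card := by
    intro v hv
    have := h.acc.dg_le_of_terminal hA' hDA' hv (hf v hv)
    have := h.high v (hDX hv)
    have := dg_sdiff (G := G) h.acc.sub v
    have := h.hq
    omega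
  have hnon : ∀ v ∈ D, ¬ Mov G W (A.erase D) v → 2 * q + 1 ≤ dg G (X \ (W ∪ un A)) v := by
    intro v hv hvm
    have := h.acc.dg_le_of_not_mov hD ht hv hvm
    have := h.high v (hDX hv)
    have := dg_sdiff (G := G) h.acc.sub v
    have := h.hq
    omega
  by_cases hall : ∀ v ∈ D, Mov G W (A.erase D) v
  · have hS : ∀ b ∈ X \ (W ∪ un A), ¬ 2 ≤ dg G D b := fun b hb h2 => by
      obtain ⟨u, hu, hum, -⟩ := h.exists_full hD hb h2
      exact hum (hall u hu)
    refine ⟨?_, ?_, ?_⟩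
    · rw [filter_false_of_mem hS]; simp
    · have h1 : ∑ b ∈ X \ (W ∪ un A), dg G D b ≤ 3 * q + 1 := by
        rw [← h.card_out]
        exact sum_le_card fun b hb => by have := hS b hb; omega
      rw [sum_dg_comm] at h1
      have h2 : ∑ v ∈ D, (2 * q + 1) ≤ ∑ v ∈ D, (dg G (X \ (W ∪ un A)) v + A'.card) :=
        sum_le_sum hin
      rw [sum_const, sum_add_distrib, sum_const, hDt.1, smul_eq_mul, smul_eq_mul] at h2
      omega
    · obtain ⟨u, hu⟩ := card_pos.1 (by have := hDt.1; omega : 0 < (D.erase w).card)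
      exact ⟨w, hw, u, hu, hall u (mem_of_mem_erase hu), fun b hb h2 => absurd h2 (hS b hb)⟩
  push Not at hall
  obtain ⟨u, hu, hum⟩ := hall
  have huw : u ≠ w := fun e => hum (e ▸ hm)
  have hc2 : ((D.erase w).erase u).card = 1 := by
    rw [card_erase_of_mem (mem_erase.2 ⟨huw, hu⟩)]; have := hDt.1; omega
  obtain ⟨z, hz⟩ := card_eq_one.1 hc2
  have hDw : D.erase w = {u, z} := by
    rw [← insert_erase (mem_erase.2 ⟨huw, hu⟩), hz]
  have hzD : z ∈ (D.erase w).erase u := by rw [hz]; simp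
  simp only [mem_erase] at hzD
  obtain ⟨hzu, hzw, hzD⟩ := hzD
  have hs1 := h.sum_erase_le hD hw hm
  rw [hDw, sum_pair hzu.symm] at hs1
  have hu1 := hnon u hu hum
  have hzm : Mov G W (A.erase D) z := by
    by_contra hzm
    have := hnon z hzD hzm
    omega
  have hunique : ∀ v ∈ D, ¬ Mov G W (A.erase D) v → v = u := by
    intro v hv hvm
    have : v ∈ D.erase w := mem_erase.2 ⟨fun e => hvm (e ▸ hm), hv⟩
    rw [hDw] at this
    simp only [mem_insert, mem_singleton] at this
    rcases this with rfl | rfl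
    · rfl
    · exact absurd hzm hvm
  have hfull : ∀ b ∈ X \ (W ∪ un A), 2 ≤ dg G D b → Full G b (D.erase u) := by
    intro b hb h2
    obtain ⟨v, hv, hvm, hvf⟩ := h.exists_full hD hb h2
    rwa [hunique v hv hvm] at hvf
  refine ⟨?_, ?_, u, hu, w, mem_erase.2 ⟨huw.symm, hw⟩, hm, hfull⟩
  · have : ((X \ (W ∪ un A)).filter fun b => 2 ≤ dg G D b).card ≤ dg G (X \ (W ∪ un A)) z := by
      refine card_le_card fun b hb => ?_
      obtain ⟨h1, h2⟩ := mem_filter.1 hb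
      exact mem_filter.2 ⟨h1, (hfull b h1 h2 z (mem_erase.2 ⟨hzu, hzD⟩)).symm⟩
    omega
  · have := hin z hzD
    omega

lemma not_adj (h : Ext G k q X W A) {D : Finset V} (hD : D ∈ A) (ht : Acc.Term G W A D) {u w : V}
    (hu : u ∈ D) (hw : w ∈ D.erase u) (hm : Mov G W (A.erase D) w) {b c : V}
    (hb : b ∈ X \ (W ∪ un A)) (hc : c ∈ X \ (W ∪ un A)) (hbf : Full G b (D.erase u))
    (hcf : Full G c (D.erase u)) : ¬ G.Adj c b := by
  intro hcb
  obtain ⟨P, hP, hPc, hPu⟩ := h.exists_fam hb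
  obtain ⟨hbX, hbn⟩ := mem_sdiff.1 hb
  set E := insert b (D.erase u) with hE
  have hEt : Tri G E := ((h.acc.fam.prop D hD).erase_edge hu).insert_tri hbf.notMem hbf
  have hAe : Fam (Tri G) X (A.erase D) :=
    h.acc.fam.mono (erase_subset _ _) ((un_mono (erase_subset _ _)).trans h.acc.fam.un_sub)
  have hDe : Disjoint D (un (A.erase D)) :=
    h.acc.fam.disjoint_un hD (erase_subset _ _) (notMem_erase _ _)
  have hue : un (A.erase D) ⊆ un A := un_mono (erase_subset _ _)
  have hDA := subset_un hD
  have hWD : Disjoint W D := h.acc.disj.mono_right hDA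
  have hBA : Disjoint (W ∪ un A) (un P) := by
    rw [hPu]; exact disjoint_sdiff.mono_right (erase_subset _ _)
  rw [disjoint_union_left] at hBA
  have hEX : E ⊆ X := insert_subset hbX ((erase_subset _ _).trans (hDA.trans h.acc.fam.un_sub))
  have hEd : Disjoint E (un (A.erase D)) := by
    rw [disjoint_insert_left]
    exact ⟨fun h' => hbn (mem_union_right _ (hue h')), hDe.mono_left (erase_subset _ _)⟩
  have hEP : Disjoint E (un P) := by
    rw [disjoint_insert_left]
    exact ⟨by rw [hPu]; exact notMem_erase _ _,
      hBA.2.mono_left ((erase_subset _ _).trans hDA)⟩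
  have hEW : Disjoint W E := by
    rw [disjoint_insert_right]
    exact ⟨fun h' => hbn (mem_union_left _ h'), hWD.mono_right (erase_subset _ _)⟩
  have hEA : E ∉ A.erase D := fun h' => by
    have := hEd.mono_right (subset_un h')
    rw [disjoint_self_iff_empty] at this
    exact hEt.nonempty.ne_empty this
  have hF1 := hAe.insert_fam hEt hEX hEd
  set T := insert E (A.erase D) ∪ P with hT
  have hdisj : Disjoint (un (insert E (A.erase D))) (un P) := by
    rw [un_insert, disjoint_union_left]
    exact ⟨hEP, hBA.2.mono_left hue⟩
  have hcross : ∀ C ∈ insert E (A.erase D), ∀ C' ∈ P, Disjoint C C' := fun C hC C' hC' =>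
    hdisj.mono (subset_un hC) (subset_un hC')
  have hTf : Fam (Tri G) X T := by
    refine ⟨?_, ?_, ?_⟩
    · intro C hC
      rcases mem_union.1 hC with hC | hC
      · exact hF1.prop C hC
      · exact hP.prop C hC
    · intro C hC
      rcases mem_union.1 hC with hC | hC
      · exact hF1.sub C hC
      · exact (hP.sub C hC).trans ((erase_subset _ _).trans sdiff_subset)
    · intro C hC C' hC' hne
      rcases mem_union.1 hC with hC | hC <;> rcases mem_union.1 hC' with hC' | hC'
      · exact hF1.disj C hC C' hC' hne
      · exact hcross C hC C' hC'
      · exact (hcross C' hC' C hC).symm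
      · exact hP.disj C hC C' hC' hne
  have hTP : Disjoint (insert E (A.erase D)) P := by
    rw [disjoint_left]
    intro C hC hC'
    have := hcross C hC C hC'
    rw [disjoint_self_iff_empty] at this
    exact (hP.prop C hC').nonempty.ne_empty this
  have hce := card_erase_add_one hD
  have hTc : T.card + 1 = k := by
    rw [hT, card_union_of_disjoint hTP, card_insert_of_notMem hEA, hPc]
    have := h.hq
    omega
  have hWT : Disjoint W (un T) := by
    rw [hT, un_union, un_insert, disjoint_union_right, disjoint_union_right]
    exact ⟨⟨hEW, h.acc.disj.mono_right hue⟩, hBA.1⟩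
  have hsub : A.erase D ⊆ T := (subset_insert _ _).trans subset_union_left
  have hET : E ∈ T := mem_union_left _ (mem_insert_self _ _)
  have hER : Reach G W T E := by
    obtain ⟨C, hC, hfC⟩ := hm
    exact (hC.mono hsub).step hET (mem_insert_of_mem hw) hfC
  have hcP : c ∈ un P := by
    rw [hPu]; exact mem_erase.2 ⟨hcb.ne, hc⟩
  obtain ⟨Q, hQ, hcQ⟩ := mem_un.1 hcP
  have hQT : Q ∈ T := mem_union_right _ hQ
  have hcE : Full G c E := by
    intro z hz
    rcases mem_insert.1 hz with rfl | hz
    · exact hcb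
    · exact hcf z hz
  have hQR : Reach G W T Q := hER.step hQT hcQ hcE
  have := h.max T hTf hTc hWT
  have hbig : insert Q (insert E (A.erase D)) ⊆ T.filter (Reach G W T) := by
    intro C hC
    rw [mem_filter]
    rcases mem_insert.1 hC with rfl | hC
    · exact ⟨hQT, hQR⟩
    rcases mem_insert.1 hC with rfl | hC
    · exact ⟨hET, hER⟩
    · exact ⟨hsub hC, (ht C hC).mono hsub⟩
  have h5 := card_le_card hbig
  rw [card_insert_of_notMem (fun h' => disjoint_left.1 hTP h' hQ), card_insert_of_notMem hEA] at h5
  omega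

theorem false (h : Ext G k q X W A) : False := by
  obtain ⟨A', hA', ⟨D₀, hD₀⟩, U, hT⟩ := h.acc.exists_terminal h.nonempty
  have hcl := fun D hD => h.class_bound hA' hD (hT D hD).1 (hT D hD).2
  have ht' := (hcl D₀ hD₀).2.1
  set B := X \ (W ∪ un A) with hB
  set t := A'.card with htdef
  let s : Finset V → Finset V := fun D => B.filter fun b => 2 ≤ dg G D b
  let a : V → ℕ := fun b => (A'.filter fun D => 2 ≤ dg G D b).card
  have hat : ∀ b, a b ≤ t := fun b => card_filter_le _ _
  have hlow : ∀ b ∈ B, 2 * q + 1 + t ≤ dg G B b + a b := by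
    intro b hb
    obtain ⟨h1, h2⟩ := mem_sdiff.1 hb
    have e1 := dg_sdiff (G := G) h.acc.sub b
    rw [h.acc.dg_eq, ← hB, ← sum_sdiff hA'] at e1
    have e2 := h.acc.dg_base_le h1 h2
    have e3 := Acc.sum_le (f := fun C => dg G C b) (B := A \ A')
      (fun C hC => h.acc.dg_class_le h1 h2 (mem_sdiff.1 hC).1)
    have e4 : ∑ D ∈ A', dg G D b ≤ ∑ D ∈ A', (1 + if 2 ≤ dg G D b then 1 else 0) := by
      refine sum_le_sum fun D hD => ?_
      have := h.acc.dg_class_le h1 h2 (hA' hD)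
      split_ifs <;> omega
    rw [sum_add_distrib, ← card_filter, sum_const, smul_eq_mul, mul_one] at e4
    have e5 := h.high b h1
    have e6 := card_sdiff_add_card_eq_card hA'
    have e7 := h.hq
    have e8 : (A'.filter fun D => 2 ≤ dg G D b).card = a b := rfl
    omega
  have hpos : ∀ b ∈ B, 1 ≤ a b := by
    intro b hb
    have e1 := hlow b hb
    have e2 := dg_lt_card_self (G := G) hb
    rw [h.card_out] at e2
    omega
  have hkey : ∀ D ∈ A', ∀ b ∈ s D, (s D).card * t ≤ q * a b := by
    intro D hD b hb
    obtain ⟨hbB, hb2⟩ := mem_filter.1 hb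
    obtain ⟨-, -, u, hu, w, hw, hm, hf⟩ := hcl D hD
    have e1 : dg G B b + (s D).card ≤ 3 * q + 1 := by
      rw [← h.card_out, ← hB, dg, ← card_union_of_disjoint]
      · exact card_le_card (union_subset (filter_subset _ _) (filter_subset _ _))
      · rw [disjoint_left]
        intro c hc hc'
        obtain ⟨h1, h2⟩ := mem_filter.1 hc
        obtain ⟨-, h3⟩ := mem_filter.1 hc'
        exact h.not_adj (hA' hD) (hT D hD).1 hu hw hm h1 hbB (hf c h1 h3) (hf b hbB hb2) h2
    have e2 := hlow b hbB
    have e3 := hat b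
    have e4 : (s D).card + t ≤ a b + q := by omega
    zify at e4 e3 ht' ⊢
    nlinarith
  have hsum : ∑ b ∈ B, ∑ D ∈ A'.filter (fun D => 2 ≤ dg G D b), (1 / (a b : ℚ)) = B.card := by
    rw [card_eq_sum_ones, Nat.cast_sum]
    refine sum_congr rfl fun b hb => ?_
    have e1 : (A'.filter fun D => 2 ≤ dg G D b).card = a b := rfl
    have e2 : (a b : ℚ) ≠ 0 := by have := hpos b hb; positivity
    rw [sum_const, e1, nsmul_eq_mul]
    field_simp
    simp
  have hcomm : ∑ b ∈ B, ∑ D ∈ A'.filter (fun D => 2 ≤ dg G D b), (1 / (a b : ℚ)) =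
      ∑ D ∈ A', ∑ b ∈ s D, (1 / (a b : ℚ)) := by
    simp only [s, sum_filter]
    exact sum_comm
  have htpos : (0 : ℚ) < t := by have : 0 < t := by omega
                                 exact_mod_cast this
  have hle : ∑ D ∈ A', ∑ b ∈ s D, (1 / (a b : ℚ)) ≤ ∑ D ∈ A', (q / t : ℚ) := by
    refine sum_le_sum fun D hD => ?_
    rcases (s D).eq_empty_or_nonempty with he | hne
    · rw [he, sum_empty]; positivity
    have hsp : (0 : ℚ) < (s D).card := by exact_mod_cast card_pos.2 hne
    have := sum_le_card_nsmul (s D) (fun b => (1 / (a b : ℚ))) (q / t / (s D).card : ℚ) (by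
      intro b hb
      have h1 : (0 : ℚ) < a b := by exact_mod_cast hpos b (mem_filter.1 hb).1
      have h2 : ((s D).card : ℚ) * t ≤ q * a b := by exact_mod_cast hkey D hD b hb
      rw [div_div, div_le_div_iff₀ h1 (by positivity)]
      linarith)
    refine this.trans_eq ?_
    rw [nsmul_eq_mul]
    field_simp
  rw [← hcomm, hsum, h.card_out, sum_const, nsmul_eq_mul, ← htdef,
    mul_div_cancel₀ _ htpos.ne'] at hle
  have : 3 * q + 1 ≤ q := by exact_mod_cast hle
  omega

end Ext

/-- A counterexample has no edge and `k - 1` triangles covering all but one vertex if all its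
vertices are high. -/
theorem Bad.false_of_tiling (hb : Bad G k X) (hcard : X.card = 3 * k)
    (hhigh : ∀ v ∈ X, 2 * k ≤ dg G X v) {T : Finset (Finset V)} (hT : Fam (Tri G) X T)
    (hTk : T.card + 1 = k) (hW : Edge G W) (hWX : W ⊆ X) (hd : Disjoint W (un T)) : False := by
  let f : Finset (Finset V) → ℕ := fun T => (T.filter (Reach G W T)).card
  let P : ℕ → Prop := fun n => ∃ T, Fam (Tri G) X T ∧ T.card + 1 = k ∧ Disjoint W (un T) ∧ f T = n
  have hP : P (f T) := ⟨T, hT, hTk, hd, rfl⟩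
  have hbd : ∀ n, P n → n ≤ k := by
    rintro n ⟨T', -, h2, -, rfl⟩
    have : f T' ≤ T'.card := card_filter_le _ _
    omega
  obtain ⟨T', h1, h2, h3, h4⟩ := Nat.findGreatest_spec (hbd _ hP) hP
  have hmax : ¬ Has (Tri G) X (T'.card + 1) := fun h => hb.no (by rw [h2] at h; exact h.cyc)
  have hacc := acc_of_packing h1 hmax h2.le hW hWX h3
  have hlt : (T'.filter (Reach G W T')).card ≤ T'.card := card_filter_le _ _
  refine Ext.false (q := k - ((T'.filter (Reach G W T')).card + 1))
    ⟨hacc, hb, by omega, hcard, hhigh, fun T'' g1 g2 g3 => ?_⟩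
  have : P (f T'') := ⟨T'', g1, g2, g3, rfl⟩
  have := Nat.le_findGreatest (hbd _ this) this
  rw [← h4] at this
  exact this

end tiling

/-! ### Disjoint triangles and shortest cycles -/

section layers

variable {G : SimpleGraph V} {W X : Finset V} {T L : Finset (Finset V)} {k t : ℕ}

section shortest
variable {C : Finset V}

lemma Cyc.dg_eq_two_of_min (h : Cyc G C) (hmin : ∀ C' ⊆ C, Cyc G C' → C.card ≤ C'.card) {y : V}
    (hy : y ∈ C) : dg G C y = 2 := by
  have hac : ∀ v ∈ C, Acyc G (C.erase v) := fun v hv D hD hc => by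
    have h1 := hmin D (hD.trans (erase_subset _ _)) hc
    have h2 := card_le_card hD
    have := card_erase_add_one hv
    omega
  obtain ⟨v, hv, hv2⟩ : ∃ v ∈ C, dg G C v ≤ 2 := by
    by_contra! hcon
    obtain ⟨v, hv⟩ := h.1
    have h1 := card_erase_add_one hv
    have h3 := h.three_le
    refine hac v hv _ Subset.rfl ⟨card_pos.1 (by omega), fun u hu => ?_⟩
    have h2 := hcon u (mem_of_mem_erase hu)
    rw [dg_erase hv] at h2
    split_ifs at h2 <;> omega
  have h1 := card_erase_add_one hv
  have h3 := h.three_le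
  have h2 := (hac v hv).sum_le (card_pos.1 (by omega))
  have h4 := sum_dg_erase (G := G) hv
  have h5 : ∑ u ∈ C, 2 ≤ ∑ u ∈ C, dg G C u := sum_le_sum fun u hu => h.2 u hu
  have h6 : ∑ u ∈ C, 2 = ∑ u ∈ C, dg G C u := by
    refine le_antisymm h5 ?_
    rw [sum_const, smul_eq_mul]
    omega
  exact ((sum_eq_sum_iff_of_le fun u hu => h.2 u hu).1 h6 y hy).symm

lemma Cyc.dg_le_two_of_min (h : Cyc G C) (hC : 4 ≤ C.card) {v : V} (hv : v ∉ C)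
    (hmin : ∀ C' ⊆ insert v C, Cyc G C' → C.card ≤ C'.card) : dg G C v ≤ 2 := by
  by_contra! hd
  have h2 : ∀ y ∈ C, dg G C y = 2 := fun y hy =>
    h.dg_eq_two_of_min (fun C' hC' => hmin C' (hC'.trans (subset_insert _ _))) hy
  have hS : ∀ y ∈ C, dg G (insert v C) y = 2 + if G.Adj y v then 1 else 0 := fun y hy => by
    rw [dg_insert hv, h2 y hy]
  have hsum : ∑ y ∈ insert v C, dg G (insert v C) y = 2 * C.card + 2 * dg G C v := by
    rw [sum_dg_erase (mem_insert_self v C), erase_insert hv, dg_insert_self,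
      sum_congr rfl h2, sum_const, smul_eq_mul]
    ring
  have hpair : ∀ a ∈ C, ∀ b ∈ C, G.Adj a b → dg G C v ≤
      1 + (if G.Adj a v then 1 else 0) + (if G.Adj b v then 1 else 0) := by
    intro a ha b hb hab
    have ha' : a ∈ insert v C := mem_insert_of_mem ha
    have hb' : b ∈ (insert v C).erase a := mem_erase.2 ⟨hab.ne', mem_insert_of_mem hb⟩
    have c1 := card_erase_add_one ha'
    have c2 := card_erase_add_one hb'
    rw [card_insert_of_notMem hv] at c1
    have hac : Acyc G (((insert v C).erase a).erase b) := fun D hD hc => by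
      have e1 := hmin D (hD.trans ((erase_subset _ _).trans (erase_subset _ _))) hc
      have e2 := card_le_card hD
      omega
    have e1 := hac.sum_le (card_pos.1 (by omega))
    have e2 := sum_dg_erase (G := G) ha'
    have e3 := sum_dg_erase (G := G) hb'
    have e4 := dg_erase (G := G) ha' b
    rw [if_pos hab.symm, hS b hb] at e4
    rw [hsum, hS a ha] at e2
    omega
  have hall : ∀ a ∈ C, G.Adj v a := by
    intro a ha
    obtain ⟨b, hb, hab⟩ := dg_pos.1 (by rw [h2 a ha]; norm_num : 0 < dg G C a)
    have := hpair a ha b hb hab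
    by_contra hn
    rw [if_neg (fun h' => hn h'.symm)] at this
    split_ifs at this <;> omega
  have h3 := dg_full.2 hall
  obtain ⟨a, ha⟩ := h.1
  obtain ⟨b, hb, hab⟩ := dg_pos.1 (by rw [h2 a ha]; norm_num : 0 < dg G C a)
  have := hpair a ha b hb hab
  split_ifs at this <;> omega

end shortest

/-- A counterexample in which the maximum number of disjoint triangles is `t`. -/
structure Cfg (G : SimpleGraph V) (k t : ℕ) (X : Finset V) : Prop where
  bad : Bad G k X
  max : ¬ Has (Tri G) X (t + 1)

/-- `T` consists of `t` disjoint triangles in `X`. -/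
structure Pack (G : SimpleGraph V) (t : ℕ) (X : Finset V) (T : Finset (Finset V)) : Prop
    extends Fam (Tri G) X T where
  card : T.card = t

lemma Pack.mono {Y : Finset V} (h : Pack G t X T) (hY : X ⊆ Y) : Pack G t Y T :=
  ⟨h.toFam.mono Subset.rfl (h.un_sub.trans hY), h.card⟩

lemma Pack.of_un_sub {Y : Finset V} (h : Pack G t X T) (hY : un T ⊆ Y) : Pack G t Y T :=
  ⟨h.toFam.mono Subset.rfl hY, h.card⟩

namespace Cfg

lemma lt (h : Cfg G k t X) (hT : Pack G t X T) : t + 1 ≤ k := by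
  by_contra hlt
  have := hT.has
  rw [hT.card] at this
  exact h.bad.no ((this.le (by omega)).cyc.mono hT.un_sub)

lemma not_tri (h : Cfg G k t X) (hT : Pack G t X T) {S : Finset V} (hS : S ⊆ X)
    (hd : Disjoint S (un T)) : ¬ Tri G S := by
  intro hS'
  have := hT.has.add (has_one hS' Subset.rfl) hd.symm
  rw [hT.card] at this
  exact h.max (this.mono (union_subset hT.un_sub hS))

lemma acc (h : Cfg G k t X) (hT : Pack G t X T) (hW : Edge G W) (hWX : W ⊆ X)
    (hd : Disjoint W (un T)) : Acc G k X W (T.filter (Reach G W T)) :=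
  acc_of_packing hT.toFam (by rw [hT.card]; exact h.max) (by rw [hT.card]; exact h.lt hT) hW hWX hd

lemma weight (h : Cfg G k t X) (hT : Pack G t X T) {x y : V} (hx : x ∈ X \ un T)
    (hy : y ∈ X \ un T) (hxy : G.Adj x y) : 1 ≤ phi k (dg G X x) + phi k (dg G X y) := by
  rw [mem_sdiff] at hx hy
  have := h.acc hT (edge_pair hxy) (by intro v; simp; rintro (rfl | rfl); exacts [hx.1, hy.1])
    (by rw [disjoint_left]; intro v; simp; rintro (rfl | rfl); exacts [hx.2, hy.2])
  rw [← sum_pair (f := fun v => phi k (dg G X v)) hxy.ne]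
  by_contra! hcon
  have := this.weight h.bad (by omega) (Y := ∅) (by simp)
  simp at this
  omega

lemma phi_nonneg (h : Cfg G k t X) (hT : Pack G t X T) {x y : V} (hx : x ∈ X \ un T)
    (hy : y ∈ X \ un T) (hxy : G.Adj x y) : 0 ≤ phi k (dg G X x) := by
  have := h.weight hT hx hy hxy
  have := phi_le_one k (dg G X y)
  omega

lemma mid_adj (h : Cfg G k t X) (hT : Pack G t X T) {l c y : V} (hl : l ∈ X \ un T)
    (hc : c ∈ X \ un T) (hy : y ∈ X \ un T) (hlc : G.Adj l c) (hl0 : phi k (dg G X l) = 0)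
    (hy0 : phi k (dg G X y) = 0) (hyl : y ≠ l) : G.Adj y c := by
  by_contra hyc
  have hnl : ¬ G.Adj y l := fun h' => by
    have := h.weight hT hy hl h'
    omega
  have hw := h.weight hT hl hc hlc
  have hyne : y ≠ c := by rintro rfl; omega
  rw [mem_sdiff] at hl hc hy
  have ha := h.acc hT (edge_pair hlc) (by intro v; simp; rintro (rfl | rfl); exacts [hl.1, hc.1])
    (by rw [disjoint_left]; intro v; simp; rintro (rfl | rfl); exacts [hl.2, hc.2])
  have hsum := sum_pair (f := fun v => phi k (dg G X v)) hlc.ne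
  have hc1 := phi_le_one k (dg G X c)
  have := ha.weight h.bad (by omega) (Y := {y}) (by
    intro z hz
    rw [mem_singleton] at hz
    subst hz
    refine ⟨hy.1, ?_, hy0, ?_⟩
    · rw [mem_union, not_or]
      exact ⟨by simp [hyl, hyne], fun h' => hy.2 (un_mono (filter_subset _ _) h')⟩
    · rw [dg_eq_zero]; intro u hu; simp at hu; rcases hu with rfl | rfl <;> assumption)
  simp at this
  omega

end Cfg

/-- A family of disjoint cycles of length at least four, each of which was chosen as short as
possible, leaving room for `t` disjoint triangles. -/
structure Lay (G : SimpleGraph V) (t : ℕ) (X : Finset V) (L : Finset (Finset V)) : Prop where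
  fam : Fam (Cyc G) X L
  pack : ∃ T, Pack G t (X \ un L) T
  four : ∀ Q ∈ L, 4 ≤ Q.card
  two : ∀ Q ∈ L, ∀ y ∈ Q, dg G Q y = 2
  out : ∀ T, Pack G t (X \ un L) T → ∀ v ∈ X \ un L, v ∉ un T → ∀ Q ∈ L, dg G Q v ≤ 2
  head : L.Nonempty → ∃ H ∈ L, (∀ Q ∈ L, Q.card ≤ H.card) ∧
    (∀ Q ∈ L, Q ≠ H → ∀ y ∈ H, dg G Q y ≤ 2) ∧ ∀ T, Pack G t (X \ un L) T →
      ∀ C ⊆ X \ un L ∪ H, Disjoint C (un T) → Cyc G C → H.card ≤ C.card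

namespace Lay

lemma extend (h : Lay G t X L) (hc : Cfg G k t X) (hT : Pack G t (X \ un L) T) {C : Finset V}
    (hCX : C ⊆ X \ un L) (hCT : Disjoint C (un T)) (hC : Cyc G C) :
    ∃ L', L'.card = L.card + 1 ∧ Lay G t X L' := by
  let P : ℕ → Prop := fun n => ∃ T C, Pack G t (X \ un L) T ∧ C ⊆ X \ un L ∧ Disjoint C (un T) ∧
    Cyc G C ∧ C.card = n
  have hP : ∃ n, P n := ⟨_, T, C, hT, hCX, hCT, hC, rfl⟩
  obtain ⟨T₀, H, hT₀, hHX, hHT, hH, hHn⟩ := Nat.find_spec hP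
  have hmin : ∀ T, Pack G t (X \ un L) T → ∀ C ⊆ X \ un L, Disjoint C (un T) → Cyc G C →
      H.card ≤ C.card := fun T hT C h1 h2 h3 => by
    rw [hHn]; exact Nat.find_min' hP ⟨T, C, hT, h1, h2, h3, rfl⟩
  have hLX : X \ un L ⊆ X := sdiff_subset
  have hHL : Disjoint H (un L) := disjoint_sdiff.symm.mono_left hHX
  have hnot : H ∉ L := fun h' => by
    have := hHL.mono_right (subset_un h')
    rw [disjoint_self_iff_empty] at this
    exact hH.1.ne_empty this
  have hX' : X \ un (insert H L) = (X \ un L) \ H := by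
    rw [un_insert]
    ext v; simp only [mem_sdiff, mem_union]; tauto
  have hsub : X \ un (insert H L) ⊆ X \ un L := by rw [hX']; exact sdiff_subset
  have h4 : 4 ≤ H.card := by
    by_contra hlt
    exact hc.not_tri (hT₀.mono hLX) (hHX.trans hLX) hHT (hH.tri (by omega))
  refine ⟨insert H L, card_insert_of_notMem hnot, h.fam.insert_fam hH (hHX.trans hLX) hHL,
    ⟨T₀, hT₀.of_un_sub ?_⟩, ?_, ?_, ?_, fun _ => ⟨H, mem_insert_self _ _, ?_, ?_, ?_⟩⟩
  · rw [hX', subset_sdiff]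
    exact ⟨hT₀.un_sub, hHT.symm⟩
  · simp only [mem_insert, forall_eq_or_imp]
    exact ⟨h4, h.four⟩
  · simp only [mem_insert, forall_eq_or_imp]
    exact ⟨fun y hy => hH.dg_eq_two_of_min
      (fun C' hC' => hmin T₀ hT₀ C' (hC'.trans hHX) (hHT.mono_left hC')) hy, h.two⟩
  · intro T hT v hv hvT
    simp only [mem_insert, forall_eq_or_imp]
    refine ⟨?_, h.out T (hT.mono hsub) v (hsub hv) hvT⟩
    have hTH : Disjoint H (un T) := by
      have := hT.un_sub
      rw [hX', subset_sdiff] at this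
      exact this.2.symm
    have hvH : v ∉ H := by rw [hX'] at hv; exact (mem_sdiff.1 hv).2
    refine hH.dg_le_two_of_min h4 hvH fun C' hC' => hmin T (hT.mono hsub) C' ?_ ?_
    · exact hC'.trans (insert_subset (hsub hv) hHX)
    · exact Disjoint.mono_left hC' (disjoint_insert_left.2 ⟨hvT, hTH⟩)
  · simp only [mem_insert, forall_eq_or_imp]
    refine ⟨le_rfl, fun Q hQ => ?_⟩
    obtain ⟨H', hH', h1, -, h3⟩ := h.head ⟨Q, hQ⟩
    exact (h1 Q hQ).trans (h3 T₀ hT₀ H (hHX.trans subset_union_left) hHT hH)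
  · intro Q hQ hne y hy
    rcases mem_insert.1 hQ with rfl | hQ
    · exact absurd rfl hne
    · exact h.out T₀ hT₀ y (hHX hy) (disjoint_left.1 hHT hy) Q hQ
  · intro T hT C hC
    refine hmin T (hT.mono hsub) C (hC.trans ?_)
    exact union_subset hsub hHX

lemma has (h : Lay G t X L) {T : Finset (Finset V)} (hT : Pack G t (X \ un L) T) :
    Has (Cyc G) (un L ∪ un T) (L.card + t) := by
  have := h.fam.has.add hT.has.cyc (disjoint_sdiff.mono_right hT.un_sub)
  rwa [hT.card] at this

lemma card_lt (h : Lay G t X L) (hc : Cfg G k t X) : L.card + t + 1 ≤ k := by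
  obtain ⟨T, hT⟩ := h.pack
  by_contra hlt
  exact hc.bad.no (((h.has hT).le (by omega)).mono
    (union_subset h.fam.un_sub (hT.un_sub.trans sdiff_subset)))

lemma exists_max (hc : Cfg G k t X) (hT : Pack G t X T) :
    ∃ L, Lay G t X L ∧ ∀ T, Pack G t (X \ un L) T → Acyc G ((X \ un L) \ un T) := by
  by_contra! hcon
  have : ∀ n, ∃ L, L.card = n ∧ Lay G t X L := by
    intro n
    induction n with
    | zero => exact ⟨∅, rfl, ⟨by simp, by simp, by simp⟩, ⟨T, by simpa using hT⟩, by simp, by simp,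
        by simp, by simp⟩
    | succ n ih =>
      obtain ⟨L, rfl, hL⟩ := ih
      obtain ⟨T, hT, hac⟩ := hcon L hL
      obtain ⟨C, hC, hcy⟩ := not_acyc.1 hac
      rw [subset_sdiff] at hC
      exact hL.extend hc hT hC.1 hC.2 hcy
  obtain ⟨L, hL, hL'⟩ := this k
  have := hL'.card_lt hc
  omega

end Lay

end layers

/-! ### Optimal families of cycles -/

section optimal

variable {G : SimpleGraph V} {W X Y : Finset V} {T L : Finset (Finset V)} {k t : ℕ}

lemma tri_of_adj {a b c : V} (hab : G.Adj a b) (hbc : G.Adj b c) (hac : G.Adj a c) :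
    Tri G {a, b, c} :=
  (edge_pair hbc).insert_tri (by simp [hab.ne, hac.ne]) (by simp [Full, hab, hac])

lemma cyc_four {a b c d : V} (hab : G.Adj a b) (hbc : G.Adj b c) (hcd : G.Adj c d)
    (hda : G.Adj d a) (hac : a ≠ c) (hbd : b ≠ d) : Cyc G {a, b, c, d} := by
  refine ⟨⟨a, by simp⟩, fun v hv => ?_⟩
  simp only [mem_insert, mem_singleton] at hv
  rcases hv with rfl | rfl | rfl | rfl
  · exact dg_two_of_adj (by simp) (by simp) hbd hab hda.symm
  · exact dg_two_of_adj (by simp) (by simp) hac hab.symm hbc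
  · exact dg_two_of_adj (by simp) (by simp) hbd hbc.symm hcd
  · exact dg_two_of_adj (by simp) (by simp) hac hda hcd.symm

lemma eq_of_dg_le_one {S : Finset V} {v a b : V} (h : dg G S v ≤ 1) (ha : a ∈ S) (hb : b ∈ S)
    (hva : G.Adj v a) (hvb : G.Adj v b) : a = b := by
  by_contra hne
  have := dg_two_of_adj ha hb hne hva hvb
  omega

lemma Pack.un_swap (hT : Pack G t Y T) {D : Finset V} (hD : D ∈ T) {z v : V} (hz : z ∈ D)
    (hv : v ∉ un T) :
    un (insert (insert v (D.erase z)) (T.erase D)) = insert v ((un T).erase z) := by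
  have hd : Disjoint D (un (T.erase D)) :=
    hT.disjoint_un hD (erase_subset _ _) (notMem_erase _ _)
  have h1 : un T = D ∪ un (T.erase D) := by rw [← un_insert, insert_erase hD]
  rw [un_insert, h1]
  ext u
  have hn : u ∈ D → u ∉ un (T.erase D) := fun h => disjoint_left.1 hd h
  have hzv : z ≠ v := fun e => hv (e ▸ subset_un hD hz)
  simp only [mem_union, mem_insert, mem_erase]
  by_cases hu : u = z
  · subst hu; tauto
  · tauto

lemma Pack.swap (hT : Pack G t Y T) {D : Finset V} (hD : D ∈ T) {z v : V} (hz : z ∈ D)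
    (hvY : v ∈ Y) (hv : v ∉ un T) (hf : Full G v (D.erase z)) :
    Pack G t Y (insert (insert v (D.erase z)) (T.erase D)) := by
  have hd : Disjoint D (un (T.erase D)) :=
    hT.disjoint_un hD (erase_subset _ _) (notMem_erase _ _)
  have hsub : un (T.erase D) ⊆ un T := un_mono (erase_subset _ _)
  have hdis : Disjoint (insert v (D.erase z)) (un (T.erase D)) := by
    rw [disjoint_insert_left]
    exact ⟨fun h => hv (hsub h), hd.mono_left (erase_subset _ _)⟩
  have hnot : insert v (D.erase z) ∉ T.erase D := fun h => hv (hsub (mem_un.2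
    ⟨_, h, mem_insert_self _ _⟩))
  refine ⟨(hT.toFam.mono (erase_subset _ _) (hsub.trans hT.un_sub)).insert_fam
    (((hT.prop D hD).erase_edge hz).insert_tri hf.notMem hf) ?_ hdis, ?_⟩
  · exact insert_subset hvY ((erase_subset _ _).trans (hT.sub D hD))
  · rw [card_insert_of_notMem hnot, card_erase_add_one hD, hT.card]

/-- An optimal choice of disjoint triangles and longer cycles, such that the remaining vertices
always induce a forest. -/
structure Opt (G : SimpleGraph V) (k t : ℕ) (X : Finset V) (L T : Finset (Finset V)) : Prop where
  cfg : Cfg G k t X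
  lay : Lay G t X L
  pack : Pack G t (X \ un L) T
  acyc : ∀ T', Pack G t (X \ un L) T' → Acyc G ((X \ un L) \ un T')
  max : ∀ T', Pack G t (X \ un L) T' → ∑ v ∈ (X \ un L) \ un T', dg G ((X \ un L) \ un T') v ≤
    ∑ v ∈ (X \ un L) \ un T, dg G ((X \ un L) \ un T) v

/-- The vertices outside the chosen cycles. -/
noncomputable def rest (X : Finset V) (L T : Finset (Finset V)) : Finset V := (X \ un L) \ un T

namespace Opt

lemma rest_sub (X : Finset V) (L T : Finset (Finset V)) : rest X L T ⊆ X :=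
  sdiff_subset.trans sdiff_subset

lemma pack' (h : Opt G k t X L T) : Pack G t X T := h.pack.mono sdiff_subset

lemma rest_sub' : rest X L T ⊆ X \ un T := sdiff_subset_sdiff sdiff_subset Subset.rfl

lemma mem_rest {v : V} : v ∈ rest X L T ↔ (v ∈ X ∧ v ∉ un L) ∧ v ∉ un T := by
  rw [rest, mem_sdiff, mem_sdiff]

lemma dg_eq (h : Opt G k t X L T) (v : V) :
    dg G X v = dg G (rest X L T) v + ∑ D ∈ T, dg G D v + ∑ Q ∈ L, dg G Q v := by
  rw [dg_sdiff h.lay.fam.un_sub, dg_un h.lay.fam, dg_sdiff h.pack.un_sub, dg_un h.pack.toFam, rest]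
  ring

lemma budget (h : Opt G k t X L T) {v : V} (hv : 0 ≤ phi k (dg G X v)) :
    phi k (dg G X v) + 1 + 2 * ((k : ℤ) - 1 - t - L.card) ≤ dg G (rest X L T) v +
      ∑ D ∈ T, ((dg G D v : ℤ) - 2) + ∑ Q ∈ L, ((dg G Q v : ℤ) - 2) := by
  have h1 : phi k (dg G X v) + 2 * k ≤ dg G X v + 1 := by
    revert hv
    unfold phi
    split_ifs <;> omega
  have h2 : (dg G X v : ℤ) = dg G (rest X L T) v + ∑ D ∈ T, (dg G D v : ℤ) +
      ∑ Q ∈ L, (dg G Q v : ℤ) := by exact_mod_cast h.dg_eq v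
  rw [sum_sub_distrib, sum_sub_distrib, sum_const, sum_const, h.pack.card]
  simp only [nsmul_eq_mul]
  linarith

lemma acyc_rest (h : Opt G k t X L T) : Acyc G (rest X L T) := h.acyc T h.pack

lemma weight (h : Opt G k t X L T) {x y : V} (hx : x ∈ rest X L T) (hy : y ∈ rest X L T)
    (hxy : G.Adj x y) : 1 ≤ phi k (dg G X x) + phi k (dg G X y) :=
  h.cfg.weight h.pack' (rest_sub' hx) (rest_sub' hy) hxy

lemma phi_nonneg (h : Opt G k t X L T) {x : V} (hx : x ∈ rest X L T)
    (hd : 1 ≤ dg G (rest X L T) x) : 0 ≤ phi k (dg G X x) := by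
  obtain ⟨y, hy, hxy⟩ := dg_pos.1 hd
  exact h.cfg.phi_nonneg h.pack' (rest_sub' hx) (rest_sub' hy) hxy

lemma mid_adj (h : Opt G k t X L T) {l c y : V} (hl : l ∈ rest X L T) (hc : c ∈ rest X L T)
    (hy : y ∈ rest X L T) (hlc : G.Adj l c) (hl0 : phi k (dg G X l) = 0)
    (hy0 : phi k (dg G X y) = 0) (hyl : y ≠ l) : G.Adj y c :=
  h.cfg.mid_adj h.pack' (rest_sub' hl) (rest_sub' hc) (rest_sub' hy) hlc hl0 hy0 hyl

lemma swap (h : Opt G k t X L T) {D : Finset V} (hD : D ∈ T) {v z : V} (hv : v ∈ rest X L T)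
    (hf : Full G v D) (hz : z ∈ D) : z ∉ rest X L T ∧
      Acyc G (insert z ((rest X L T).erase v)) ∧
      dg G ((rest X L T).erase v) z ≤ dg G (rest X L T) v := by
  obtain ⟨hvY, hvT⟩ := mem_sdiff.1 hv
  have hzT := subset_un hD hz
  have hp := h.pack.swap hD hz hvY hvT (hf.mono (erase_subset _ _))
  have heq : (X \ un L) \ un (insert (insert v (D.erase z)) (T.erase D)) =
      insert z ((rest X L T).erase v) := by
    rw [h.pack.un_swap hD hz hvT]
    have hzY := h.pack.un_sub hzT
    have hzv : z ≠ v := fun e => hvT (e ▸ hzT)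
    ext u
    simp only [rest, mem_sdiff, mem_insert, mem_erase] at hzY ⊢
    by_cases hu : u = z
    · subst hu; tauto
    · tauto
  have hzF : z ∉ rest X L T := fun h' => (mem_sdiff.1 h').2 hzT
  have hzn : z ∉ (rest X L T).erase v := fun h' => hzF (mem_of_mem_erase h')
  have h1 := h.acyc _ hp
  have h2 := h.max _ hp
  rw [heq] at h1 h2
  refine ⟨hzF, h1, ?_⟩
  have e1 : (X \ un L) \ un T = rest X L T := rfl
  rw [e1, sum_dg_erase (mem_insert_self z _), erase_insert hzn, dg_insert_self,
    sum_dg_erase hv] at h2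
  omega

lemma sum_le_of_full (h : Opt G k t X L T) {D : Finset V} (hD : D ∈ T) {v : V}
    (hv : v ∈ rest X L T) (hf : Full G v D) {U : Finset V} (hU : U ⊆ rest X L T) :
    ∑ u ∈ U, dg G D u ≤ 3 + 3 * dg G (rest X L T) v := by
  have hDc := (h.pack.prop D hD).1
  have h1 : ∑ u ∈ U, dg G D u ≤ ∑ u ∈ rest X L T, dg G D u := sum_le_sum_of_subset hU
  rw [← add_sum_erase _ _ hv, sum_dg_comm ((rest X L T).erase v) D] at h1
  have h2 := dg_le_card (G := G) D v
  have h3 : ∑ z ∈ D, dg G ((rest X L T).erase v) z ≤ D.card • dg G (rest X L T) v :=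
    sum_le_card_nsmul _ _ _ fun z hz => (h.swap hD hv hf hz).2.2
  rw [hDc, smul_eq_mul] at h3
  omega

lemma dg_class_le (h : Opt G k t X L T) {D : Finset V} (hD : D ∈ T) {v : V} (hn : ¬ Full G v D) :
    dg G D v ≤ 2 := by
  have := dg_succ_le_of_not_full hn
  rw [(h.pack.prop D hD).1] at this
  omega

lemma dg_cycle_le (h : Opt G k t X L T) {Q : Finset V} (hQ : Q ∈ L) {v : V}
    (hv : v ∈ rest X L T) : dg G Q v ≤ 2 :=
  h.lay.out T h.pack v (mem_sdiff.1 hv).1 (mem_sdiff.1 hv).2 Q hQ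

lemma sum_excess (U : Finset V) (D : Finset V) :
    ∑ u ∈ U, ((dg G D u : ℤ) - 2) = (∑ u ∈ U, dg G D u : ℕ) - 2 * (U.card : ℤ) := by
  rw [sum_sub_distrib, sum_const, nsmul_eq_mul]
  push_cast
  ring

lemma sum_budget (h : Opt G k t X L T) {U : Finset V} (hU : ∀ u ∈ U, 0 ≤ phi k (dg G X u)) :
    ∑ u ∈ U, phi k (dg G X u) + U.card * (1 + 2 * ((k : ℤ) - 1 - t - L.card)) ≤
      (∑ u ∈ U, dg G (rest X L T) u : ℕ) + ∑ D ∈ T, ((∑ u ∈ U, dg G D u : ℕ) - 2 * (U.card : ℤ)) +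
        ∑ Q ∈ L, ((∑ u ∈ U, dg G Q u : ℕ) - 2 * (U.card : ℤ)) := by
  have h1 := sum_le_sum fun u hu => h.budget (hU u hu)
  rw [sum_add_distrib, sum_add_distrib, sum_add_distrib, sum_add_distrib, sum_comm (t := T),
    sum_comm (t := L)] at h1
  simp only [sum_excess, sum_const, nsmul_eq_mul] at h1
  push_cast at h1 ⊢
  linarith

lemma star (h : Opt G k t X L T) {U : Finset V} (hne : U.Nonempty) (hU : U ⊆ rest X L T)
    (hmid : ∀ u ∈ U, phi k (dg G X u) = 0 ∧ dg G (rest X L T) u = 1)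
    (hall : ∀ v ∈ rest X L T, 1 ≤ dg G (rest X L T) v → v ∉ U → 2 ≤ dg G (rest X L T) v) :
    ∃ c ∈ rest X L T, c ∉ U ∧ (∀ u ∈ U, G.Adj u c) ∧
      (rest X L T).filter (fun v => 1 ≤ dg G (rest X L T) v) = insert c U := by
  obtain ⟨l, hl⟩ := hne
  obtain ⟨c, hc, hlc⟩ := dg_pos.1 (by rw [(hmid l hl).2]; norm_num : 0 < dg G (rest X L T) l)
  have hcU : c ∉ U := fun hcU => by
    have := h.weight (hU hl) hc hlc
    rw [(hmid l hl).1, (hmid c hcU).1] at this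
    omega
  have hadj : ∀ u ∈ U, G.Adj u c := by
    intro u hu
    by_cases hul : u = l
    · exact hul ▸ hlc
    · exact h.mid_adj (hU hl) hc (hU hu) hlc (hmid l hl).1 (hmid u hu).1 hul
  refine ⟨c, hc, hcU, hadj, ?_⟩
  set F := rest X L T with hF
  have hcF : 1 ≤ dg G F c := dg_pos.2 ⟨l, hU hl, hlc.symm⟩
  set F₂ := (F.filter fun v => 1 ≤ dg G F v ∧ v ∉ U).erase c with hF₂
  have hF₂F : F₂ ⊆ F := (erase_subset _ _).trans (filter_subset _ _)
  have hcF₂ : c ∉ F₂ := notMem_erase _ _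
  have hnb : ∀ v ∈ F₂, 2 ≤ dg G (insert c F₂) v := by
    intro v hv
    obtain ⟨hvc, hv⟩ := mem_erase.1 hv
    obtain ⟨hvF, hv1, hvU⟩ := mem_filter.1 hv
    refine (hall v hvF hv1 hvU).trans (card_le_card fun u hu => ?_)
    obtain ⟨huF, hvu⟩ := mem_filter.1 hu
    refine mem_filter.2 ⟨?_, hvu⟩
    by_cases huc : u = c
    · exact huc ▸ mem_insert_self _ _
    refine mem_insert_of_mem (mem_erase.2 ⟨huc, mem_filter.2 ⟨huF, dg_pos.2 ⟨v, hvF, hvu.symm⟩,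
      fun huU => hvc ?_⟩⟩)
    exact eq_of_dg_le_one (hmid u huU).2.le hvF hc hvu.symm (hadj u huU)
  have hemp : F₂ = ∅ := by
    by_contra hne
    have hne := nonempty_iff_ne_empty.2 hne
    have hac : Acyc G (insert c F₂) := h.acyc_rest.mono (insert_subset hc hF₂F)
    have e1 := hac.sum_le ⟨c, mem_insert_self _ _⟩
    rw [sum_insert hcF₂, card_insert_of_notMem hcF₂, dg_insert_self] at e1
    have e2 : F₂.card • 2 ≤ ∑ v ∈ F₂, dg G (insert c F₂) v := card_nsmul_le_sum _ _ _ hnb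
    rw [smul_eq_mul] at e2
    have e3 : dg G F₂ c = 0 := by omega
    refine h.acyc_rest F₂ hF₂F ⟨hne, fun v hv => ?_⟩
    have e4 := hnb v hv
    rw [dg_insert hcF₂, if_neg (fun h' => dg_eq_zero.1 e3 v hv h'.symm)] at e4
    exact e4
  ext v
  simp only [mem_filter, mem_insert]
  constructor
  · rintro ⟨h1, h2⟩
    by_contra! hcon
    have : v ∈ F₂ := mem_erase.2 ⟨hcon.1, mem_filter.2 ⟨h1, h2, hcon.2⟩⟩
    simp [hemp] at this
  · rintro (rfl | hv)
    · exact ⟨hc, hcF⟩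
    · exact ⟨hU hv, (hmid v hv).2.ge⟩

end Opt

end optimal

/-! ### Stars among the remaining vertices -/

section stars

variable {G : SimpleGraph V} {W X Y : Finset V} {T L : Finset (Finset V)} {k t : ℕ}

/-- The remaining vertices that are not of low degree. -/
noncomputable def pos (G : SimpleGraph V) (k : ℕ) (X : Finset V) (L T : Finset (Finset V)) :
    Finset V :=
  (rest X L T).filter fun v => 0 ≤ phi k (dg G X v)

/-- The remaining vertices that are not of low degree and have at most one remaining neighbour. -/
noncomputable def leaves (G : SimpleGraph V) (k : ℕ) (X : Finset V) (L T : Finset (Finset V)) :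
    Finset V :=
  (rest X L T).filter fun v => 0 ≤ phi k (dg G X v) ∧ dg G (rest X L T) v ≤ 1

/-- The remaining vertices that are not of low degree form a star with at least three leaves. -/
structure Star (G : SimpleGraph V) (k t : ℕ) (X : Finset V) (L T : Finset (Finset V))
    (U : Finset V) (c : V) : Prop where
  sub : U ⊆ rest X L T
  three : 3 ≤ U.card
  center : c ∈ rest X L T
  notMem : c ∉ U
  pos_eq : pos G k X L T = insert c U
  mid : ∀ u ∈ U, phi k (dg G X u) = 0
  adj : ∀ u ∈ U, G.Adj u c
  tot : t + L.card + 1 = k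
  cycle : ∀ Q ∈ L, ∀ u ∈ U, dg G Q u = 2
  sum_tri : ∀ D ∈ T, ∑ u ∈ U, dg G D u = 2 * U.card
  tri : 4 ≤ U.card → ∀ D ∈ T, ∀ u ∈ U, dg G D u = 2

namespace Opt

lemma sum_cycle_le (h : Opt G k t X L T) {Q : Finset V} (hQ : Q ∈ L) {U : Finset V}
    (hU : U ⊆ rest X L T) : ∑ u ∈ U, dg G Q u ≤ 2 * U.card := by
  have := sum_le_card_nsmul U (dg G Q) 2 fun u hu => h.dg_cycle_le hQ (hU hu)
  rwa [smul_eq_mul, mul_comm] at this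

lemma sum_class_le (h : Opt G k t X L T) {D : Finset V} (hD : D ∈ T) {U : Finset V}
    (hU : U ⊆ rest X L T) (h3 : 3 ≤ U.card)
    (h1 : ∀ u ∈ U, Full G u D → ∃ v ∈ rest X L T, dg G (rest X L T) v ≤ 1 ∧ Full G v D) :
    ∑ u ∈ U, dg G D u ≤ 2 * U.card := by
  by_cases hf : ∃ v ∈ rest X L T, dg G (rest X L T) v ≤ 1 ∧ Full G v D
  · obtain ⟨v, hv, hv1, hvf⟩ := hf
    have := h.sum_le_of_full hD hv hvf hU
    omega
  · have := sum_le_card_nsmul U (dg G D) 2 fun u hu =>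
      h.dg_class_le hD fun hfu => hf (h1 u hu hfu)
    rwa [smul_eq_mul, mul_comm] at this

lemma exists_star (h : Opt G k t X L T) (h3 : 3 ≤ (leaves G k X L T).card) :
    ∃ c, Star G k t X L T (leaves G k X L T) c := by
  set U := leaves G k X L T with hUdef
  have hmem : ∀ u, u ∈ U ↔ u ∈ rest X L T ∧ 0 ≤ phi k (dg G X u) ∧ dg G (rest X L T) u ≤ 1 :=
    fun u => mem_filter
  have hU : U ⊆ rest X L T := filter_subset _ _
  have hD : ∀ D ∈ T, ((∑ u ∈ U, dg G D u : ℕ) - 2 * (U.card : ℤ)) ≤ 0 := fun D hD => by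
    have := h.sum_class_le hD hU h3 fun u hu hf => ⟨u, hU hu, ((hmem u).1 hu).2.2, hf⟩
    omega
  have hQ : ∀ Q ∈ L, ((∑ u ∈ U, dg G Q u : ℕ) - 2 * (U.card : ℤ)) ≤ 0 := fun Q hQ => by
    have := h.sum_cycle_le hQ hU
    omega
  have hb := h.sum_budget fun u hu => ((hmem u).1 hu).2.1
  have hs := h.lay.card_lt h.cfg
  have p1 : 0 ≤ ∑ u ∈ U, phi k (dg G X u) := sum_nonneg fun u hu => ((hmem u).1 hu).2.1
  have p2 : ∑ u ∈ U, dg G (rest X L T) u ≤ U.card := sum_le_card fun u hu => ((hmem u).1 hu).2.2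
  have p3 := sum_nonpos hD
  have p4 := sum_nonpos hQ
  have p5 : (0 : ℤ) ≤ U.card * ((k : ℤ) - 1 - t - L.card) :=
    mul_nonneg (by positivity) (by omega)
  have e : (U.card : ℤ) * (1 + 2 * ((k : ℤ) - 1 - t - L.card)) =
      U.card + 2 * (U.card * ((k : ℤ) - 1 - t - L.card)) := by ring
  rw [e] at hb
  generalize hS : (U.card : ℤ) * ((k : ℤ) - 1 - t - L.card) = S at hb p5
  have q1 : ∑ u ∈ U, phi k (dg G X u) = 0 := by omega
  have q2 : ∑ u ∈ U, dg G (rest X L T) u = U.card := by omega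
  have q3 := le_antisymm p3 (by omega)
  have q4 := le_antisymm p4 (by omega)
  have q5 : (U.card : ℤ) * ((k : ℤ) - 1 - t - L.card) = 0 := by omega
  have r1 := (sum_eq_zero_iff_of_nonneg fun u hu => ((hmem u).1 hu).2.1).1 q1
  have r2 : ∀ u ∈ U, dg G (rest X L T) u = 1 := by
    refine (sum_eq_sum_iff_of_le fun u hu => ((hmem u).1 hu).2.2).1 ?_
    rw [q2, sum_const, smul_eq_mul, mul_one]
  have r3 := (sum_eq_zero_iff_of_nonpos hD).1 q3
  have r4 := (sum_eq_zero_iff_of_nonpos hQ).1 q4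
  obtain ⟨c, hc, hcU, hadj, heq⟩ := h.star (card_pos.1 (by omega)) hU
    (fun u hu => ⟨r1 u hu, r2 u hu⟩) fun v hv hv1 hvU => by
      by_contra! hlt
      exact hvU ((hmem v).2 ⟨hv, h.phi_nonneg hv hv1, by omega⟩)
  refine ⟨c, hU, h3, hc, hcU, ?_, r1, hadj, ?_, ?_, ?_, ?_⟩
  · rw [← heq, pos]
    refine filter_congr fun v hv => ⟨fun h0 => ?_, h.phi_nonneg hv⟩
    by_contra! hlt
    have := r2 v ((hmem v).2 ⟨hv, h0, by omega⟩)
    omega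
  · rcases mul_eq_zero.1 q5 with h' | h' <;> omega
  · intro Q hQL
    have := r4 Q hQL
    refine (sum_eq_sum_iff_of_le fun u hu => h.dg_cycle_le hQL (hU hu)).1 ?_
    rw [sum_const, smul_eq_mul]
    omega
  · intro D hDT
    have := r3 D hDT
    omega
  · intro h4 D hDT
    have hsum := r3 D hDT
    refine (sum_eq_sum_iff_of_le fun u hu => h.dg_class_le hDT fun hf => ?_).1 ?_
    · have e1 := h.sum_le_of_full hDT (hU hu) hf hU
      rw [r2 u hu] at e1
      omega
    · rw [sum_const, smul_eq_mul]
      omega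

/-- The remaining vertices that have a remaining neighbour. -/
noncomputable def core (G : SimpleGraph V) (F : Finset V) : Finset V :=
  F.filter fun v => 1 ≤ dg G F v

lemma dg_core {F : Finset V} {v : V} (hv : v ∈ F) : dg G (core G F) v = dg G F v := by
  refine le_antisymm (dg_mono (filter_subset _ _) v) (card_le_card fun u hu => ?_)
  obtain ⟨huF, hvu⟩ := mem_filter.1 hu
  exact mem_filter.2 ⟨mem_filter.2 ⟨huF, dg_pos.2 ⟨v, hv, hvu.symm⟩⟩, hvu⟩

lemma mids_eq (h : Opt G k t X L T) {x y : V} (hx : x ∈ rest X L T) (hy : y ∈ rest X L T)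
    (hx0 : phi k (dg G X x) = 0) (hy0 : phi k (dg G X y) = 0)
    (hx2 : 2 ≤ dg G (rest X L T) x) : x = y := by
  by_contra hne
  obtain ⟨c, hc, c', hc', hcc⟩ :=
    one_lt_card.1 (show 1 < ((rest X L T).filter (G.Adj x)).card from hx2)
  obtain ⟨hc, hxc⟩ := mem_filter.1 hc
  obtain ⟨hc', hxc'⟩ := mem_filter.1 hc'
  have hyc := h.mid_adj hx hc hy hxc hx0 hy0 (Ne.symm hne)
  have hyc' := h.mid_adj hx hc' hy hxc' hx0 hy0 (Ne.symm hne)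
  refine h.acyc_rest {x, c, y, c'} ?_ (cyc_four hxc hyc.symm hyc' hxc'.symm hne hcc)
  simp [insert_subset_iff, hx, hy, hc, hc']

lemma sum_class_le_of_path (h : Opt G k t X L T) {D : Finset V} (hD : D ∈ T)
    (h4 : 4 ≤ (core G (rest X L T)).card)
    (hsum : ∑ v ∈ core G (rest X L T), dg G (rest X L T) v + 2 = 2 * (core G (rest X L T)).card)
    (h2 : ∀ v ∈ rest X L T, dg G (rest X L T) v ≤ 2) :
    ∑ u ∈ core G (rest X L T), dg G D u ≤ 2 * (core G (rest X L T)).card := by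
  have hsub : core G (rest X L T) ⊆ rest X L T := filter_subset _ _
  set F := rest X L T with hF
  set C := core G F with hC
  have hDc := (h.pack.prop D hD).1
  by_cases hf : ∃ p ∈ C, Full G p D ∧ ∀ v ∈ F, Full G v D → 2 ≤ dg G F v
  swap
  · refine h.sum_class_le hD hsub (by omega) fun u hu hfu => ?_
    by_contra! hcon
    refine hf ⟨u, hu, hfu, fun v hv hvf => ?_⟩
    by_contra! hlt
    exact hcon v hv (show dg G F v ≤ 1 by omega) hvf
  obtain ⟨p, hp, hpf, hfull⟩ := hf
  have hpF := hsub hp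
  have hp2 : dg G F p = 2 := le_antisymm (h2 p hpF) (hfull p hpF hpf)
  have e9 := h.sum_le_of_full hD hpF hpf hsub
  rw [← hF, hp2] at e9
  by_cases h5 : 5 ≤ C.card
  · omega
  have hc4 : C.card = 4 := by omega
  have e1 : ∑ v ∈ C, dg G C v = 6 := by
    rw [sum_congr rfl fun v hv => dg_core (hsub hv)]
    omega
  rw [sum_dg_erase hp, dg_core hpF, hp2] at e1
  have hc3 : (C.erase p).card = 3 := by rw [card_erase_of_mem hp, hc4]
  obtain ⟨x, hx, hx1⟩ : ∃ x ∈ C.erase p, 0 < dg G (C.erase p) x := by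
    by_contra! hcon
    have := sum_nonpos hcon
    omega
  obtain ⟨y, hy, hxy⟩ := dg_pos.1 hx1
  have hyx : y ∈ (C.erase p).erase x := mem_erase.2 ⟨hxy.ne', hy⟩
  obtain ⟨s, hs⟩ := card_eq_one.1 (show (((C.erase p).erase x).erase y).card = 1 by
    rw [card_erase_of_mem hyx, card_erase_of_mem hx, hc3])
  have hsm : s ∈ ((C.erase p).erase x).erase y := hs ▸ mem_singleton_self s
  have hsC : s ∈ C := mem_of_mem_erase (mem_of_mem_erase (mem_of_mem_erase hsm))
  have hy1 : 0 < dg G (C.erase p) y := dg_pos.2 ⟨x, hx, hxy.symm⟩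
  have split : ∀ f : V → ℕ, ∑ v ∈ C.erase p, f v = f x + (f y + f s) := fun f => by
    rw [← add_sum_erase _ _ hx, ← add_sum_erase _ _ hyx, hs, sum_singleton]
  rw [split] at e1
  have hs1 : dg G F s ≤ 1 := by
    rw [← dg_core (hsub hsC), ← hC, dg_erase hp]
    split_ifs <;> omega
  have hs2 : dg G D s ≤ 2 := h.dg_class_le hD fun hf => by
    have := hfull s (hsub hsC) hf
    omega
  have hxy3 : dg G D x + dg G D y ≤ 3 := by
    have : ∑ z ∈ D, dg G {x, y} z ≤ D.card := sum_le_card fun z hz => by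
      obtain ⟨hzF, hac, -⟩ := h.swap hD hpF hpf hz
      rw [← hF] at hac hzF
      rw [dg_insert (by simpa using hxy.ne), dg_singleton]
      by_contra! hlt
      have hzx : G.Adj z x ∧ G.Adj z y := by
        constructor <;> by_contra hn <;> simp only [hn, if_false] at hlt <;> split_ifs at hlt <;>
          omega
      refine hac {z, x, y} ?_ (tri_of_adj hzx.1 hxy hzx.2).cyc
      have hx' := mem_erase.1 hx
      have hy' := mem_erase.1 hy
      simp [insert_subset_iff, hx'.1, hy'.1, hsub hx'.2, hsub hy'.2]
    rw [sum_dg_comm, sum_pair hxy.ne, hDc] at this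
    exact this
  have hp3 := dg_le_card (G := G) D p
  rw [← add_sum_erase _ _ hp, split]
  omega

lemma pos_card_le (h : Opt G k t X L T) (h2 : (leaves G k X L T).card ≤ 2) :
    (pos G k X L T).card ≤ 3 ∧
      ((pos G k X L T).card = 3 → ∀ v ∈ pos G k X L T, 1 ≤ dg G (rest X L T) v) := by
  set F := rest X L T with hF
  set U := leaves G k X L T with hUdef
  have hmem : ∀ u, u ∈ U ↔ u ∈ F ∧ 0 ≤ phi k (dg G X u) ∧ dg G F u ≤ 1 := fun u => mem_filter
  have hsub : core G F ⊆ F := filter_subset _ _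
  have hcore : ∀ v, v ∈ core G F ↔ v ∈ F ∧ 1 ≤ dg G F v := fun u => mem_filter
  rcases (core G F).eq_empty_or_nonempty with hemp | hne
  · have : pos G k X L T ⊆ U := fun v hv => by
      obtain ⟨hvF, hv0⟩ := mem_filter.1 hv
      refine (hmem v).2 ⟨hvF, hv0, ?_⟩
      by_contra! hlt
      have := (hcore v).2 ⟨hvF, hlt.le⟩
      simp [hemp] at this
    have := card_le_card this
    exact ⟨by omega, by omega⟩
  have e1 : ∑ v ∈ core G F, dg G F v + 2 ≤ 2 * (core G F).card :=
    h.acyc_rest.sum_filter_le _ (fun v hv _ u hu hvu => dg_pos.2 ⟨v, hv, hvu.symm⟩) hne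
  set U' := (core G F).filter fun v => dg G F v ≤ 1 with hU'
  have hUU : U' ⊆ U := fun v hv => by
    obtain ⟨hv, hv1⟩ := mem_filter.1 hv
    obtain ⟨hvF, hv0⟩ := (hcore v).1 hv
    exact (hmem v).2 ⟨hvF, h.phi_nonneg hvF hv0, hv1⟩
  have hU'c := card_le_card hUU
  have e2 : ∀ v ∈ core G F, 2 ≤ dg G F v + if v ∈ U' then 1 else 0 := fun v hv => by
    have := ((hcore v).1 hv).2
    split_ifs with hvU
    · omega
    · by_contra! hlt
      exact hvU (mem_filter.2 ⟨hv, by omega⟩)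
  have e3 : ∑ v ∈ core G F, (if v ∈ U' then 1 else 0) = U'.card := by
    rw [← card_filter, filter_mem_eq_inter, inter_eq_right.2 (filter_subset _ _)]
  have e4 := sum_le_sum e2
  rw [sum_add_distrib, e3, sum_const, smul_eq_mul, mul_comm] at e4
  have hUeq : U' = U := eq_of_subset_of_card_le hUU (by omega)
  have hUc : U.card = 2 := by omega
  have hsum : ∑ v ∈ core G F, dg G F v + 2 = 2 * (core G F).card := by rw [hUeq] at e4; omega
  have heq := (sum_eq_sum_iff_of_le e2).1 (by
    rw [sum_add_distrib, e3, hUeq, sum_const, smul_eq_mul, hUc]; omega)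
  have hpos : pos G k X L T = core G F := by
    refine filter_congr fun v hv => ⟨fun h0 => ?_, h.phi_nonneg hv⟩
    by_contra! hlt
    have : v ∈ U' := hUeq ▸ (hmem v).2 ⟨hv, h0, by omega⟩
    exact absurd ((hcore v).1 (mem_of_mem_filter v this)).2 (by omega)
  rw [hpos]
  refine ⟨?_, fun _ v hv => ((hcore v).1 hv).2⟩
  by_contra! h4
  have hUone : ∀ u ∈ U, dg G F u = 1 := fun u hu => by
    rw [← hUeq] at hu
    have a := (mem_filter.1 hu).2
    have b := ((hcore u).1 (mem_filter.1 hu).1).2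
    omega
  have hout : ∀ v ∈ F, 1 ≤ dg G F v → v ∉ U → 2 ≤ dg G F v := fun v hv hv1 hvU => by
    by_contra! hlt
    exact hvU ((hmem v).2 ⟨hv, h.phi_nonneg hv hv1, by omega⟩)
  have hmids : ((core G F).filter fun v => phi k (dg G X v) = 0).card ≤ 1 := by
    rw [card_le_one]
    by_contra! hcon
    obtain ⟨x, hx, y, hy, hxy⟩ := hcon
    obtain ⟨hx, hx0⟩ := mem_filter.1 hx
    obtain ⟨hy, hy0⟩ := mem_filter.1 hy
    have hxU : x ∈ U := by
      by_contra hxU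
      exact hxy (h.mids_eq (hsub hx) (hsub hy) hx0 hy0
        (hout x (hsub hx) ((hcore x).1 hx).2 hxU))
    have hyU : y ∈ U := by
      by_contra hyU
      exact hxy (h.mids_eq (hsub hy) (hsub hx) hy0 hx0
        (hout y (hsub hy) ((hcore y).1 hy).2 hyU)).symm
    have hUxy : {x, y} = U := eq_of_subset_of_card_le (by simp [insert_subset_iff, hxU, hyU])
      (by rw [card_pair hxy, hUc])
    obtain ⟨c, -, hcU, -, hceq⟩ := h.star ⟨x, hxU⟩ (filter_subset _ _) (fun u hu => ⟨by
      rw [← hUxy] at hu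
      simp only [mem_insert, mem_singleton] at hu
      rcases hu with rfl | rfl <;> assumption, hUone u hu⟩) hout
    have : (core G F).card = 3 := by
      rw [core, hceq, card_insert_of_notMem hcU, hUc]
    omega
  have hphi : ((core G F).card : ℤ) - 1 ≤ ∑ v ∈ core G F, phi k (dg G X v) := by
    have e : ∀ v ∈ core G F, (1 : ℤ) ≤ phi k (dg G X v) +
        if phi k (dg G X v) = 0 then 1 else 0 := fun v hv => by
      have := h.phi_nonneg (hsub hv) ((hcore v).1 hv).2
      split_ifs <;> omega
    have e' := sum_le_sum e
    rw [sum_add_distrib, ← sum_filter, sum_const, sum_const] at e'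
    simp only [nsmul_eq_mul, mul_one] at e'
    omega
  have hb := h.sum_budget fun u hu => h.phi_nonneg (hsub hu) ((hcore u).1 hu).2
  have hs := h.lay.card_lt h.cfg
  have p5 : (0 : ℤ) ≤ (core G F).card * ((k : ℤ) - 1 - t - L.card) :=
    mul_nonneg (by positivity) (by omega)
  have hD : ∀ D ∈ T, ((∑ u ∈ core G F, dg G D u : ℕ) - 2 * ((core G F).card : ℤ)) ≤ 0 :=
    fun D hD => by
      have := h.sum_class_le_of_path hD h4 hsum fun v hv => by
        by_cases hv1 : 1 ≤ dg G F v
        · have := heq v ((hcore v).2 ⟨hv, hv1⟩)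
          change dg G F v ≤ 2
          omega
        · change dg G F v ≤ 2
          omega
      rw [← hF] at this
      omega
  have hQ : ∀ Q ∈ L, ((∑ u ∈ core G F, dg G Q u : ℕ) - 2 * ((core G F).card : ℤ)) ≤ 0 :=
    fun Q hQ => by
      have := h.sum_cycle_le hQ hsub
      omega
  have p3 := sum_nonpos hD
  have p4 := sum_nonpos hQ
  rw [← hF] at hb
  zify at hsum
  push_cast at hb p3 p4
  nlinarith

end Opt

end stars

/-! ### Existence of optimal families -/

section existence

variable {G : SimpleGraph V} {W X Y : Finset V} {T L : Finset (Finset V)} {k t : ℕ}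

lemma Bad.exists_opt (hb : Bad G k X) : ∃ t L T, Opt G k t X L T := by
  have hex : ∃ n, ¬ Has (Tri G) X (n + 1) := ⟨X.card, fun h => by
    have := h.cyc.three_mul_le
    omega⟩
  set t := Nat.find hex with ht
  have hc : Cfg G k t X := ⟨hb, Nat.find_spec hex⟩
  have hhas : Has (Tri G) X t := by
    rcases Nat.eq_zero_or_pos t with h0 | h0
    · rw [h0]; trivial
    · have := Nat.find_min hex (m := t - 1) (by omega)
      rwa [not_not, Nat.sub_add_cancel h0] at this
  obtain ⟨T₀, hT₀, hT₀c⟩ := hhas.exists_fam fun C hC => hC.nonempty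
  obtain ⟨L, hL, hac⟩ := Lay.exists_max hc ⟨hT₀, hT₀c⟩
  obtain ⟨T₁, hT₁⟩ := hL.pack
  obtain ⟨T, hT, hmax⟩ :=
    ((X \ un L).powerset.powerset.filter (Pack G t (X \ un L))).exists_max_image
    (fun T' => ∑ v ∈ (X \ un L) \ un T', dg G ((X \ un L) \ un T') v)
    ⟨T₁, mem_filter.2 ⟨mem_powerset.2 fun C hC => mem_powerset.2 (hT₁.sub C hC), hT₁⟩⟩
  exact ⟨t, L, T, hc, hL, (mem_filter.1 hT).2, hac, fun T' hT' => hmax T' (mem_filter.2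
    ⟨mem_powerset.2 fun C hC => mem_powerset.2 (hT'.sub C hC), hT'⟩)⟩

lemma exists_lt_of_mul_card_lt_sum {ι : Type*} {s : Finset ι} {f : ι → ℤ} {m : ℤ}
    (h : m * s.card < ∑ i ∈ s, f i) :
    ∃ i ∈ s, m + 1 ≤ f i := by
  by_contra! hcon
  have := sum_le_card_nsmul s f m fun i hi => by have := hcon i hi; omega
  rw [nsmul_eq_mul, mul_comm] at this
  exact this.not_gt h

lemma Star.sum_pos_le {U : Finset V} {c : V} (hs : Star G k t X L T U c) :
    ∑ v ∈ pos G k X L T, phi k (dg G X v) ≤ 1 := by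
  rw [hs.pos_eq, sum_insert hs.notMem, sum_eq_zero hs.mid, add_zero]
  exact phi_le_one _ _

namespace Opt

lemma sum_split (h : Opt G k t X L T) (f : V → ℤ) :
    ∑ v ∈ X, f v = ∑ Q ∈ L, ∑ v ∈ Q, f v + ∑ v ∈ un T, f v + ∑ v ∈ rest X L T, f v := by
  have e : ∑ v ∈ un L, f v = ∑ Q ∈ L, ∑ v ∈ Q, f v :=
    sum_biUnion fun C hC D hD hne => h.lay.fam.disj C hC D hD hne
  rw [← sum_sdiff h.lay.fam.un_sub, ← sum_sdiff h.pack.un_sub, e,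
    show (X \ un L) \ un T = rest X L T from rfl]
  ring

lemma sum_rest_add (G : SimpleGraph V) (k : ℕ) (X : Finset V) (L T : Finset (Finset V)) :
    ∑ v ∈ rest X L T, phi k (dg G X v) + ((rest X L T).card : ℤ) ≤
      ∑ v ∈ pos G k X L T, phi k (dg G X v) + ((pos G k X L T).card : ℤ) := by
  rw [← sum_filter_add_sum_filter_not (rest X L T) fun v => 0 ≤ phi k (dg G X v),
    ← card_filter_add_card_filter_not (s := rest X L T) fun v => 0 ≤ phi k (dg G X v)]
  have := sum_le_card_nsmul ((rest X L T).filter fun v => ¬ 0 ≤ phi k (dg G X v))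
    (fun v => phi k (dg G X v)) (-1) fun v hv => by
      have := (mem_filter.1 hv).2
      omega
  rw [nsmul_eq_mul] at this
  rw [pos]
  push_cast
  linarith

lemma weight_le (h : Opt G k t X L T) :
    3 * ((k : ℤ) - t) ≤
      ∑ Q ∈ L, ∑ v ∈ Q, phi k (dg G X v) + ∑ v ∈ rest X L T, phi k (dg G X v) := by
  have h1 := h.cfg.bad.wt
  rw [Wt, h.sum_split] at h1
  have h2 := sum_phi_le (S := un T) k (dg G X)
  rw [h.pack.card_un_tri, h.pack.card] at h2
  push_cast at h2
  linarith

lemma not_empty (h : Opt G k t X ∅ T) : False := by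
  have hlt := h.lay.card_lt h.cfg
  have hw := h.weight_le
  rw [sum_empty, zero_add] at hw
  rw [card_empty] at hlt
  have h1 := sum_rest_add G k X ∅ T
  have hsub : (pos G k X ∅ T) ⊆ rest X ∅ T := filter_subset _ _
  have h2 := card_le_card hsub
  rcases le_or_gt 3 (leaves G k X ∅ T).card with h3 | h3
  · obtain ⟨c, hc⟩ := h.exists_star h3
    have := hc.sum_pos_le
    omega
  obtain ⟨h4, h5⟩ := h.pos_card_le (by omega)
  have h6 := sum_phi_le (S := pos G k X ∅ T) k (dg G X)
  have hpc : (pos G k X ∅ T).card = 3 := by omega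
  have hrc : (rest X ∅ T).card = 3 := by omega
  have heq := eq_of_subset_of_card_le hsub (by omega)
  have hcard : X.card = 3 * k := by
    have e1 := card_sdiff_add_card_eq_card (h.pack.un_sub.trans sdiff_subset)
    have e2 : X \ un T = rest X ∅ T := by simp [rest]
    rw [e2, hrc, h.pack.card_un_tri, h.pack.card] at e1
    omega
  have hhigh : ∀ v ∈ X, 2 * k ≤ dg G X v := by
    have e := h.cfg.bad.wt
    have e1 : ∑ v ∈ X, phi k (dg G X v) = ∑ v ∈ X, 1 := by
      rw [Wt] at e
      refine le_antisymm (sum_le_sum fun v _ => phi_le_one _ _) ?_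
      rw [sum_const, nsmul_eq_mul, hcard]
      push_cast
      linarith
    intro v hv
    exact phi_eq_one.1 ((sum_eq_sum_iff_of_le fun v _ => phi_le_one _ _).1 e1 v hv)
  obtain ⟨v, hv⟩ := card_pos.1 (show 0 < (pos G k X ∅ T).card by omega)
  obtain ⟨u, hu, hvu⟩ := dg_pos.1 (h5 hpc v hv)
  have hv' := mem_rest.1 (hsub hv)
  have hu' := mem_rest.1 hu
  refine h.cfg.bad.false_of_tiling hcard hhigh h.pack'.toFam (by rw [h.pack.card]; omega)
    (edge_pair hvu) ?_ ?_
  · simp [insert_subset_iff, hv'.1.1, hu'.1.1]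
  · simp [disjoint_insert_left, hv'.2, hu'.2]

variable {C : Finset V}

lemma cycle_sub (h : Opt G k t X L T) (hC : C ∈ L) : C ⊆ X \ un T := fun _ hv =>
  mem_sdiff.2 ⟨h.lay.fam.sub C hC hv, fun hvT =>
    (mem_sdiff.1 (h.pack.un_sub hvT)).2 (subset_un hC hv)⟩

lemma disjoint_cycle_rest (hC : C ∈ L) : Disjoint C (rest X L T) :=
  disjoint_left.2 fun _ hv hvF => (mem_rest.1 hvF).1.2 (subset_un hC hv)

lemma cycle_phi_nonneg (h : Opt G k t X L T) (hC : C ∈ L) {v : V} (hv : v ∈ C) :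
    0 ≤ phi k (dg G X v) := by
  obtain ⟨u, hu, hvu⟩ := dg_pos.1 (show 0 < dg G C v by rw [h.lay.two C hC v hv]; norm_num)
  exact h.cfg.phi_nonneg h.pack' (h.cycle_sub hC hv) (h.cycle_sub hC hu) hvu

lemma cross_phi_nonneg (h : Opt G k t X L T) (hC : C ∈ L) {v u : V} (hv : v ∈ rest X L T)
    (hu : u ∈ C) (hvu : G.Adj v u) : v ∈ pos G k X L T :=
  mem_filter.2 ⟨hv, h.cfg.phi_nonneg h.pack' (rest_sub' hv) (h.cycle_sub hC hu) hvu⟩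

lemma sum_cross_eq (h : Opt G k t X L T) (hC : C ∈ L) :
    ∑ y ∈ C, dg G (rest X L T) y = ∑ v ∈ pos G k X L T, dg G C v := by
  rw [sum_dg_comm]
  refine (sum_subset (filter_subset _ _) fun v hv hvp => ?_).symm
  by_contra hne
  obtain ⟨u, hu, hvu⟩ := dg_pos.1 (Nat.pos_of_ne_zero hne)
  exact hvp (h.cross_phi_nonneg hC hv hu hvu)

lemma sum_cross_le (h : Opt G k t X L T) (hC : C ∈ L) :
    ∑ y ∈ C, dg G (rest X L T) y ≤ 2 * (pos G k X L T).card := by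
  rw [h.sum_cross_eq hC]
  exact h.sum_cycle_le hC (filter_subset _ _)

/-- Swapping a cycle vertex into a triangle shows that the replaced vertex does not span a triangle
with an edge of the cycle. -/
lemma add_le_of_full (h : Opt G k t X L T) (hC : C ∈ L) {D : Finset V} (hD : D ∈ T) {y : V}
    (hy : y ∈ C) (hf : Full G y D) {x x' : V} (hx : x ∈ C) (hx' : x' ∈ C) (hxy : x ≠ y)
    (hxy' : x' ≠ y) (hadj : G.Adj x x') : dg G D x + dg G D x' ≤ 3 := by
  have hyX := mem_sdiff.1 (h.cycle_sub hC hy)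
  have hxX := mem_sdiff.1 (h.cycle_sub hC hx)
  have hxX' := mem_sdiff.1 (h.cycle_sub hC hx')
  have : ∑ z ∈ D, dg G {x, x'} z ≤ D.card := sum_le_card fun z hz => by
    rw [dg_insert (by simpa using hadj.ne), dg_singleton]
    by_contra! hlt
    have hz2 : G.Adj z x ∧ G.Adj z x' := by
      constructor <;> by_contra hn <;> simp only [hn, if_false] at hlt <;> split_ifs at hlt <;>
        omega
    have hzT := subset_un hD hz
    have hp := h.pack'.swap hD hz hyX.1 hyX.2 (hf.mono (erase_subset _ _))
    refine h.cfg.not_tri hp (S := {z, x, x'}) ?_ ?_ (tri_of_adj hz2.1 hadj hz2.2)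
    · simp [insert_subset_iff, h.pack'.un_sub hzT, hxX.1, hxX'.1]
    · rw [h.pack'.un_swap hD hz hyX.2]
      have : z ≠ y := fun e => hyX.2 (e ▸ hzT)
      simp [disjoint_insert_left, this.symm, hxy.symm, hxy'.symm, hxX.2, hxX'.2]
  rwa [sum_dg_comm, sum_pair hadj.ne, (h.pack.prop D hD).1] at this

end Opt

lemma sum_adj_pairs {C : Finset V} {d : V → ℕ} (h2 : ∀ y ∈ C, dg G C y = 2) (g : V → V → ℕ)
    (hg : ∀ x ∈ C, ∀ y ∈ C, G.Adj x y → d x + d y ≤ 3 + g x y) :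
    4 * ∑ x ∈ C, d x ≤ 6 * C.card + ∑ x ∈ C, ∑ y ∈ C.filter (G.Adj x), g x y := by
  have e1 : ∑ x ∈ C, ∑ y ∈ C.filter (G.Adj x), d x = 2 * ∑ x ∈ C, d x := by
    rw [mul_sum]
    refine sum_congr rfl fun x hx => ?_
    rw [sum_const, smul_eq_mul, ← h2 x hx]
    rfl
  have e2 : ∑ x ∈ C, ∑ y ∈ C.filter (G.Adj x), d y = 2 * ∑ x ∈ C, d x := by
    rw [← e1]
    refine sum_comm' fun x y => ?_
    simp only [mem_filter, G.adj_comm]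
    tauto
  have e3 : ∑ x ∈ C, ∑ y ∈ C.filter (G.Adj x), 3 = 6 * C.card := by
    rw [mul_comm, ← smul_eq_mul, ← sum_const]
    refine sum_congr rfl fun x hx => ?_
    rw [sum_const, smul_eq_mul, show (C.filter (G.Adj x)).card = 2 from h2 x hx]
  have e4 : ∑ x ∈ C, ∑ y ∈ C.filter (G.Adj x), (d x + d y) ≤
      ∑ x ∈ C, ∑ y ∈ C.filter (G.Adj x), (3 + g x y) :=
    sum_le_sum fun x hx => sum_le_sum fun y hy =>
      hg x hx y (mem_filter.1 hy).1 (mem_filter.1 hy).2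
  simp only [sum_add_distrib] at e4
  omega

namespace Opt
variable {C : Finset V}

lemma sum_class_cycle_le (h : Opt G k t X L T) (hC : C ∈ L) {D : Finset V} (hD : D ∈ T) :
    ∑ y ∈ C, dg G D y ≤ 2 * C.card := by
  have h4 := h.lay.four C hC
  have h2 := h.lay.two C hC
  have h3 : ∀ v, dg G D v ≤ 3 := fun v => (h.pack.prop D hD).1 ▸ dg_le_card D v
  by_cases hf : ∃ y ∈ C, Full G y D
  swap
  · push Not at hf
    have := sum_le_card_nsmul C (dg G D) 2 fun y hy => h.dg_class_le hD (hf y hy)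
    rwa [smul_eq_mul, mul_comm] at this
  obtain ⟨y, hy, hyf⟩ := hf
  by_cases hf' : ∃ y' ∈ C, y' ≠ y ∧ Full G y' D
  · obtain ⟨y', hy', hne, hyf'⟩ := hf'
    have := sum_adj_pairs h2 (d := dg G D)
      (fun a b => (if a = y ∧ b = y' then 3 else 0) + if a = y' ∧ b = y then 3 else 0)
      fun a ha b hb hab => by
        by_cases h1 : a ≠ y ∧ b ≠ y
        · have := h.add_le_of_full hC hD hy hyf ha hb h1.1 h1.2 hab
          omega
        by_cases h1' : a ≠ y' ∧ b ≠ y'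
        · have := h.add_le_of_full hC hD hy' hyf' ha hb h1'.1 h1'.2 hab
          omega
        have ea := h3 a
        have eb := h3 b
        have : a = y ∧ b = y' ∨ a = y' ∧ b = y := by
          by_cases e1 : a = y <;> by_cases e2 : b = y' <;> by_cases e3 : a = y' <;>
            by_cases e4 : b = y <;> simp_all
        rcases this with ⟨rfl, rfl⟩ | ⟨rfl, rfl⟩ <;> simp only [and_self, if_true] <;> omega
    have hb : ∀ p q : V, ∑ a ∈ C, ∑ b ∈ C.filter (G.Adj a),
        (if a = p ∧ b = q then 3 else 0) ≤ 3 := by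
      intro p q
      calc _ ≤ ∑ a ∈ C, if a = p then 3 else 0 := sum_le_sum fun a _ => by
            by_cases hap : a = p
            · simp only [hap, true_and, if_true, sum_ite_eq']
              split_ifs <;> omega
            · simp [hap]
        _ ≤ 3 := by rw [sum_ite_eq']; split_ifs <;> omega
    have b1 := hb y y'
    have b2 := hb y' y
    simp only [sum_add_distrib] at this
    omega
  · push Not at hf'
    have := sum_adj_pairs h2 (d := dg G D)
      (fun a b => (if a = y then 2 else 0) + if b = y then 2 else 0)
      fun a ha b hb hab => by
        by_cases e1 : a = y
        · have := h.dg_class_le hD (hf' b hb (e1 ▸ hab.ne'))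
          have := h3 a
          simp only [e1, if_true] at this ⊢
          omega
        by_cases e2 : b = y
        · have := h.dg_class_le hD (hf' a ha e1)
          have := h3 b
          simp only [e2, if_true] at this ⊢
          omega
        have := h.add_le_of_full hC hD hy hyf ha hb e1 e2 hab
        omega
    have b1 : ∑ a ∈ C, ∑ b ∈ C.filter (G.Adj a), (if a = y then 2 else 0) = 4 := by
      rw [sum_eq_single_of_mem y hy fun a _ hay => by simp [hay]]
      simp only [if_true, sum_const, smul_eq_mul]
      rw [show (C.filter (G.Adj y)).card = 2 from h2 y hy]
    have b2 : ∑ a ∈ C, ∑ b ∈ C.filter (G.Adj a), (if b = y then 2 else 0) = 4 := by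
      rw [← b1]
      refine sum_comm' fun x y => ?_
      simp only [mem_filter, G.adj_comm]
      tauto
    simp only [sum_add_distrib] at this
    omega

lemma le_sum_cross (h : Opt G k t X L T) (hC : C ∈ L)
    (hout : ∀ Q ∈ L, Q ≠ C → ∀ y ∈ C, dg G Q y ≤ 2) :
    ∑ y ∈ C, phi k (dg G X y) + (C.card : ℤ) ≤ (∑ y ∈ C, dg G (rest X L T) y : ℕ) := by
  have hb := h.sum_budget fun u hu => h.cycle_phi_nonneg hC hu
  have hs := h.lay.card_lt h.cfg
  have p5 : (0 : ℤ) ≤ C.card * ((k : ℤ) - 1 - t - L.card) :=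
    mul_nonneg (by positivity) (by omega)
  have p3 : ∑ D ∈ T, ((∑ u ∈ C, dg G D u : ℕ) - 2 * (C.card : ℤ)) ≤ 0 := sum_nonpos fun D hD => by
    have := h.sum_class_cycle_le hC hD
    omega
  have p4 : ∑ Q ∈ L, ((∑ u ∈ C, dg G Q u : ℕ) - 2 * (C.card : ℤ)) ≤ 0 := sum_nonpos fun Q hQ => by
    have : ∑ y ∈ C, dg G Q y ≤ C.card • 2 := sum_le_card_nsmul _ _ _ fun y hy => by
      by_cases hQC : Q = C
      · exact hQC ▸ (h.lay.two C hC y hy).le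
      · exact hout Q hQ hQC y hy
    rw [smul_eq_mul] at this
    omega
  have e : (C.card : ℤ) * (1 + 2 * ((k : ℤ) - 1 - t - L.card)) =
      C.card + 2 * (C.card * ((k : ℤ) - 1 - t - L.card)) := by ring
  rw [e] at hb
  generalize (C.card : ℤ) * ((k : ℤ) - 1 - t - L.card) = S at hb p5
  omega

end Opt

end existence

/-! ### The longest cycle -/

section longest

variable {G : SimpleGraph V} {X : Finset V} {T L : Finset (Finset V)} {k t : ℕ} {U C : Finset V}
  {c : V}

namespace Opt

lemma false_of_swap (h : Opt G k t X L T) (htot : t + L.card + 1 = k) (hC : C ∈ L) {D : Finset V}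
    (hD : D ∈ T) {a z : V} (ha : a ∈ C) (hf : Full G a D) (hz : z ∈ D) {S₁ S₂ : Finset V}
    (h1 : Cyc G S₁) (h2 : Cyc G S₂) (hd : Disjoint S₁ S₂)
    (hS : S₁ ∪ S₂ ⊆ insert z (rest X L T ∪ C.erase a)) : False := by
  have haX := mem_sdiff.1 (h.cycle_sub hC ha)
  have hp := h.pack'.swap hD hz haX.1 haX.2 (hf.mono (erase_subset _ _))
  have hun := h.pack'.un_swap hD hz haX.2
  have hzT := subset_un hD hz
  have hza : z ≠ a := fun e => haX.2 (e ▸ hzT)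
  have hTL : ∀ v ∈ un T, v ∉ un L := fun v hv => (mem_sdiff.1 (h.pack.un_sub hv)).2
  have hL := h.lay.fam.mono (erase_subset C L) Subset.rfl
  have hsub : un (L.erase C) ⊆ un L := un_mono (erase_subset _ _)
  have hCd : Disjoint C (un (L.erase C)) :=
    h.lay.fam.disjoint_un hC (erase_subset _ _) (notMem_erase _ _)
  have hY := hL.has.add hp.has.cyc (by
    rw [hun, disjoint_insert_right]
    exact ⟨disjoint_left.1 hCd ha, disjoint_left.2 fun v hv hvT =>
      hTL v (mem_of_mem_erase hvT) (hsub hv)⟩)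
  have hZ := (has_one h1 Subset.rfl).add (has_one h2 Subset.rfl) hd
  rw [card_erase_of_mem hC, hp.card] at hY
  have hpos := card_pos.2 ⟨C, hC⟩
  refine h.cfg.bad.not_has (union_subset (hsub.trans h.lay.fam.un_sub) hp.un_sub)
    (hS.trans (insert_subset (h.pack'.un_sub hzT) (union_subset (rest_sub X L T)
      ((erase_subset _ _).trans (h.lay.fam.sub C hC))))) ?_ hY hZ (by omega)
  refine disjoint_right.2 fun v hv => ?_
  rw [hun]
  simp only [mem_union, mem_insert, mem_erase, not_or, not_and]
  rcases mem_insert.1 (hS hv) with rfl | hv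
  · exact ⟨fun h' => hTL v hzT (hsub h'), hza, fun h' => absurd rfl h'⟩
  rcases mem_union.1 hv with hv | hv
  · obtain ⟨⟨-, hvL⟩, hvT⟩ := mem_rest.1 hv
    exact ⟨fun h' => hvL (hsub h'), fun e => hvL (e ▸ subset_un hC ha), fun _ => hvT⟩
  · obtain ⟨hva, hvC⟩ := mem_erase.1 hv
    exact ⟨disjoint_left.1 hCd hvC, hva, fun _ => (mem_sdiff.1 (h.cycle_sub hC hvC)).2⟩

/-- Two vertices of intermediate degree outside the triangles have the same neighbours there, hence
lie on a cycle of length four. -/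
lemma mid_cyc (h : Opt G k t X L T) {x y a b : V} (hx : x ∈ X \ un T) (hy : y ∈ X \ un T)
    (ha : a ∈ X \ un T) (hb : b ∈ X \ un T) (hx0 : phi k (dg G X x) = 0)
    (hy0 : phi k (dg G X y) = 0) (hxy : x ≠ y) (hab : a ≠ b) (hxa : G.Adj x a) (hxb : G.Adj x b) :
    Cyc G {x, a, y, b} := by
  have hya := h.cfg.mid_adj h.pack' hx ha hy hxa hx0 hy0 hxy.symm
  have hyb := h.cfg.mid_adj h.pack' hx hb hy hxb hx0 hy0 hxy.symm
  exact cyc_four hxa hya.symm hyb hxb.symm hxy hab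

lemma exists_star_of_card (h : Opt G k t X L T) (hp : 4 ≤ (pos G k X L T).card) :
    ∃ U c, Star G k t X L T U c := by
  rcases le_or_gt 3 (leaves G k X L T).card with h3 | h3
  · exact ⟨_, h.exists_star h3⟩
  · have := (h.pos_card_le (by omega)).1
    omega

lemma exists_two {S : Finset V} {v : V} (h : dg G S v = 2) :
    ∃ a ∈ S, ∃ b ∈ S, a ≠ b ∧ G.Adj v a ∧ G.Adj v b := by
  obtain ⟨a, ha, b, hb, hab⟩ := one_lt_card.1 (show 1 < (S.filter (G.Adj v)).card by
    rw [show (S.filter (G.Adj v)).card = 2 from h]; norm_num)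
  exact ⟨a, (mem_filter.1 ha).1, b, (mem_filter.1 hb).1, hab, (mem_filter.1 ha).2,
    (mem_filter.1 hb).2⟩

lemma head_card_le (h : Opt G k t X L T) (hC : C ∈ L)
    (hout : ∀ Q ∈ L, Q ≠ C → ∀ y ∈ C, dg G Q y ≤ 2)
    (hmin : ∀ C' ⊆ X \ un L ∪ C, Disjoint C' (un T) → Cyc G C' → C.card ≤ C'.card) :
    C.card ≤ 4 := by
  by_contra! h5
  have hFC : ∀ S ⊆ rest X L T ∪ C, S ⊆ X \ un L ∪ C ∧ Disjoint S (un T) ∧ S ⊆ X \ un T := by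
    intro S hS
    have : S ⊆ X \ un T := hS.trans (union_subset rest_sub' (h.cycle_sub hC))
    exact ⟨hS.trans (union_subset_union_left sdiff_subset),
      disjoint_sdiff_self_left.mono_left this, this⟩
  have hfour : ∀ x ∈ rest X L T ∪ C, ∀ y ∈ rest X L T ∪ C, x ≠ y → phi k (dg G X x) = 0 →
      phi k (dg G X y) = 0 → dg G C x = 2 → False := by
    intro x hx y hy hxy hx0 hy0 hx2
    obtain ⟨a, ha, b, hb, hab, hxa, hxb⟩ := exists_two hx2
    have ha' := mem_union_right (rest X L T) ha
    have hb' := mem_union_right (rest X L T) hb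
    have hS : ({x, a, y, b} : Finset V) ⊆ rest X L T ∪ C := by
      simp only [insert_subset_iff, singleton_subset_iff]
      exact ⟨hx, ha', hy, hb'⟩
    obtain ⟨e1, e2, -⟩ := hFC _ hS
    have hm : ∀ v ∈ rest X L T ∪ C, v ∈ X \ un T := fun v hv => (hFC _ Subset.rfl).2.2 hv
    have := hmin _ e1 e2 (h.mid_cyc (hm x hx) (hm y hy) (hm a ha') (hm b hb') hx0 hy0 hxy hab
      hxa hxb)
    have := card_le_four (a := x) (b := a) (c := y) (d := b)
    omega
  have hmids : (C.filter fun v => phi k (dg G X v) = 0).card ≤ 1 := by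
    rw [card_le_one]
    by_contra! hcon
    obtain ⟨x, hx, y, hy, hxy⟩ := hcon
    obtain ⟨hx, hx0⟩ := mem_filter.1 hx
    obtain ⟨hy, hy0⟩ := mem_filter.1 hy
    exact hfour x (mem_union_right _ hx) y (mem_union_right _ hy) hxy hx0 hy0
      (h.lay.two C hC x hx)
  have hphi : (C.card : ℤ) ≤ ∑ v ∈ C, phi k (dg G X v) + 1 := by
    have e : ∀ v ∈ C, (1 : ℤ) ≤ phi k (dg G X v) +
        if phi k (dg G X v) = 0 then 1 else 0 := fun v hv => by
      have := h.cycle_phi_nonneg hC hv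
      split_ifs <;> omega
    have e' := sum_le_sum e
    rw [sum_add_distrib, ← sum_filter, sum_const, sum_const] at e'
    simp only [nsmul_eq_mul, mul_one] at e'
    omega
  have e1 := h.le_sum_cross hC hout
  have e2 := h.sum_cross_le hC
  obtain ⟨U, c, hs⟩ := h.exists_star_of_card (by omega)
  obtain ⟨x, hx, y, hy, hxy⟩ := one_lt_card.1 (show 1 < U.card from by have := hs.three; omega)
  exact hfour x (mem_union_left _ (hs.sub hx)) y (mem_union_left _ (hs.sub hy)) hxy (hs.mid x hx)
    (hs.mid y hy) (hs.cycle C hC x hx)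

lemma not_tri_of_sub (h : Opt G k t X L T) {S : Finset V} (hS : S ⊆ X \ un T) : ¬ Tri G S :=
  h.cfg.not_tri h.pack' (hS.trans sdiff_subset) (disjoint_sdiff_self_left.mono_left hS)

lemma not_adj (h : Opt G k t X L T) {x y z : V} (hx : x ∈ X \ un T) (hy : y ∈ X \ un T)
    (hz : z ∈ X \ un T) (hxy : G.Adj x y) (hxz : G.Adj x z) : ¬ G.Adj y z := fun hyz =>
  h.not_tri_of_sub (by
    simp only [insert_subset_iff, singleton_subset_iff]
    exact ⟨hx, hy, hz⟩) (tri_of_adj hxy hyz hxz)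

lemma dg_le_two_of_card_four (h : Opt G k t X L T) {Q : Finset V} (hQ : Q ∈ L) (hQ4 : Q.card = 4)
    {y : V} (hy : y ∈ X \ un T) : dg G Q y ≤ 2 := by
  by_contra! h3
  obtain ⟨w, hw, hyw⟩ := dg_pos.1 (show 0 < dg G Q y by omega)
  have hw2 := h.lay.two Q hQ w hw
  obtain ⟨u, hu⟩ := inter_nonempty_of_card_lt_card_add_card (filter_subset (G.Adj y) Q)
    (filter_subset (G.Adj w) Q) (show Q.card < dg G Q y + dg G Q w by omega)
  obtain ⟨hu1, hu2⟩ := mem_inter.1 hu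
  obtain ⟨huQ, hyu⟩ := mem_filter.1 hu1
  exact h.not_adj hy (h.cycle_sub hQ hw) (h.cycle_sub hQ huQ) hyw hyu (mem_filter.1 hu2).2

end Opt

/-- A cycle of length four all of whose vertices are high, next to a star. -/
structure StarCycle (G : SimpleGraph V) (k t : ℕ) (X : Finset V) (L T : Finset (Finset V))
    (U : Finset V) (c : V) (C : Finset V) : Prop where
  opt : Opt G k t X L T
  star : Star G k t X L T U c
  mem : C ∈ L
  card : C.card = 4
  high : ∀ v ∈ C, phi k (dg G X v) = 1
  out : ∀ Q ∈ L, Q ≠ C → ∀ y ∈ C, dg G Q y ≤ 2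

namespace StarCycle

lemma center_mem (h : StarCycle G k t X L T U c C) : c ∈ X \ un T :=
  Opt.rest_sub' h.star.center

lemma leaf_mem (h : StarCycle G k t X L T U c C) {u : V} (hu : u ∈ U) : u ∈ X \ un T :=
  Opt.rest_sub' (h.star.sub hu)

lemma exists_pair (h : StarCycle G k t X L T U c C) : ∃ a ∈ C, ∃ b ∈ C, a ≠ b ∧
    (∀ u ∈ U, ∀ v ∈ C, G.Adj u v ↔ v = a ∨ v = b) := by
  obtain ⟨l, hl⟩ := card_pos.1 (show 0 < U.card by have := h.star.three; omega)
  obtain ⟨a, ha, b, hb, hab, hla, hlb⟩ := Opt.exists_two (h.star.cycle C h.mem l hl)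
  have hu : ∀ u ∈ U, ∀ v ∈ C, G.Adj l v → G.Adj u v := fun u hu v hv hlv => by
    by_cases hul : u = l
    · exact hul ▸ hlv
    exact h.opt.cfg.mid_adj h.opt.pack' (h.leaf_mem hl) (h.opt.cycle_sub h.mem hv) (h.leaf_mem hu)
      hlv (h.star.mid l hl) (h.star.mid u hu) hul
  refine ⟨a, ha, b, hb, hab, fun u hu' v hv => ⟨fun huv => ?_, ?_⟩⟩
  · have e : ({a, b} : Finset V) = C.filter (G.Adj u) := by
      refine eq_of_subset_of_card_le ?_ ?_
      · simp only [insert_subset_iff, singleton_subset_iff, mem_filter]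
        exact ⟨⟨ha, hu u hu' a ha hla⟩, ⟨hb, hu u hu' b hb hlb⟩⟩
      · rw [card_pair hab]
        exact (h.star.cycle C h.mem u hu').le
    have : v ∈ ({a, b} : Finset V) := e ▸ mem_filter.2 ⟨hv, huv⟩
    simpa using this
  · rintro (rfl | rfl)
    exacts [hu u hu' v hv hla, hu u hu' v hv hlb]

/-- The budget of a vertex of the cycle with no neighbour among the leaves. -/
lemma budget (h : StarCycle G k t X L T U c C) {a : V} (ha : a ∈ C) (hn : ∀ u ∈ U, ¬ G.Adj u a) :
    1 ≤ ∑ D ∈ T, ((dg G D a : ℤ) - 2) := by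
  have e := h.opt.budget (h.opt.cycle_phi_nonneg h.mem ha)
  rw [h.high a ha] at e
  have e1 : dg G (rest X L T) a ≤ 1 := by
    have : dg G (rest X L T) a ≤ dg G {c} a := card_le_card fun v hv => by
      obtain ⟨hv, hav⟩ := mem_filter.1 hv
      have hvp := h.opt.cross_phi_nonneg h.mem hv ha hav.symm
      rw [h.star.pos_eq] at hvp
      rcases mem_insert.1 hvp with rfl | hvU
      · exact mem_filter.2 ⟨mem_singleton_self _, hav⟩
      · exact absurd hav.symm (hn v hvU)
    exact this.trans (dg_le_card _ _)
  have e2 : ∑ Q ∈ L, ((dg G Q a : ℤ) - 2) ≤ 0 := sum_nonpos fun Q hQ => by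
    by_cases hQC : Q = C
    · rw [hQC, h.opt.lay.two C h.mem a ha]
      norm_num
    · have := h.out Q hQ hQC a ha
      omega
  have := h.star.tot
  omega

lemma false_of_class (h : StarCycle G k t X L T U c C) {a b d e : V} (ha : a ∈ C) (hb : b ∈ C)
    (hd : d ∈ C) (he : e ∈ C) (hab : a ≠ b) (hde : d ≠ e) (hbd : b ≠ d) (hbe : b ≠ e)
    (had : a ≠ d) (hae : a ≠ e) (hadj : ∀ u ∈ U, ∀ v ∈ C, G.Adj u v ↔ v = a ∨ v = b)
    {D : Finset V} (hD : D ∈ T) (hf : Full G d D) (h2 : 2 ≤ dg G D e) : False := by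
  have hDc := (h.opt.pack.prop D hD).1
  have hU3 := h.star.three
  have hUC : ∀ u ∈ U, u ∉ C := fun u hu huC =>
    disjoint_left.1 (Opt.disjoint_cycle_rest h.mem) huC (h.star.sub hu)
  have hcC : c ∉ C := fun hcC => disjoint_left.1 (Opt.disjoint_cycle_rest h.mem) hcC h.star.center
  have hzn : ∀ z ∈ D, z ∉ X \ un T := fun z hz hz' => (mem_sdiff.1 hz').2 (subset_un hD hz)
  have hCX : ∀ v ∈ C, v ∈ X \ un T := fun v hv => h.opt.cycle_sub h.mem hv
  have hcommon : ∀ p q : V, 2 ≤ dg G D p → 2 ≤ dg G D q → ∃ z ∈ D, G.Adj p z ∧ G.Adj q z := by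
    intro p q hp hq
    obtain ⟨z, hz⟩ := inter_nonempty_of_card_lt_card_add_card (filter_subset (G.Adj p) D)
      (filter_subset (G.Adj q) D) (show D.card < dg G D p + dg G D q by omega)
    obtain ⟨hz1, hz2⟩ := mem_inter.1 hz
    exact ⟨z, (mem_filter.1 hz1).1, (mem_filter.1 hz1).2, (mem_filter.1 hz2).2⟩
  -- the cycle through `a`, `b` and two leaves, next to a second cycle
  have key : ∀ x ∈ U, ∀ y ∈ U, x ≠ y → ∀ z ∈ D, ∀ p q, p ∈ rest X L T ∪ C → q ∈ rest X L T ∪ C →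
      p ∉ ({x, a, y, b, d, c} : Finset V) → q ∉ ({x, a, y, b, d, c} : Finset V) → p ≠ q →
      G.Adj p z → G.Adj q z → G.Adj p c → G.Adj q c → False := by
    intro x hx y hy hxy z hz p q hp hq hp' hq' hpq hpz hqz hpc hqc
    have hm : ∀ v ∈ rest X L T ∪ C, v ∈ X \ un T := fun v hv =>
      union_subset Opt.rest_sub' (h.opt.cycle_sub h.mem) hv
    have hzc : z ≠ c := fun e => hzn z hz (e ▸ h.center_mem)
    have hzx : z ≠ x := fun e => hzn z hz (e ▸ h.leaf_mem hx)
    have hzy : z ≠ y := fun e => hzn z hz (e ▸ h.leaf_mem hy)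
    have hza : z ≠ a := fun e => hzn z hz (e ▸ hCX a ha)
    have hzb : z ≠ b := fun e => hzn z hz (e ▸ hCX b hb)
    have hcx : c ≠ x := fun e => h.star.notMem (e ▸ hx)
    have hcy : c ≠ y := fun e => h.star.notMem (e ▸ hy)
    have hca : c ≠ a := fun e => hcC (e ▸ ha)
    have hcb : c ≠ b := fun e => hcC (e ▸ hb)
    have hdx : x ≠ d := fun e => hUC x hx (e ▸ hd)
    have hdy : y ≠ d := fun e => hUC y hy (e ▸ hd)
    have hcd : c ≠ d := fun e => hcC (e ▸ hd)
    have hins : ∀ v ∈ rest X L T ∪ C, v ≠ d → v ∈ insert z (rest X L T ∪ C.erase d) :=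
      fun v hv hvd => mem_insert_of_mem (by
        rcases mem_union.1 hv with hv | hv
        exacts [mem_union_left _ hv, mem_union_right _ (mem_erase.2 ⟨hvd, hv⟩)])
    simp only [mem_insert, mem_singleton, not_or] at hp' hq'
    refine h.opt.false_of_swap h.star.tot h.mem hD hd hf hz (S₁ := {x, a, y, b})
      (S₂ := {z, p, c, q})
      (cyc_four ((hadj x hx a ha).2 (Or.inl rfl)) ((hadj y hy a ha).2 (Or.inl rfl)).symm
        ((hadj y hy b hb).2 (Or.inr rfl)) ((hadj x hx b hb).2 (Or.inr rfl)).symm hxy hab)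
      (cyc_four hpz.symm hpc hqc.symm hqz hzc hpq) ?_ ?_
    · simp only [disjoint_insert_left, disjoint_singleton_left, mem_insert, mem_singleton, not_or]
      exact ⟨⟨hzx.symm, Ne.symm hp'.1, hcx.symm, Ne.symm hq'.1⟩,
        ⟨hza.symm, Ne.symm hp'.2.1, hca.symm, Ne.symm hq'.2.1⟩,
        ⟨hzy.symm, Ne.symm hp'.2.2.1, hcy.symm, Ne.symm hq'.2.2.1⟩,
        hzb.symm, Ne.symm hp'.2.2.2.1, hcb.symm, Ne.symm hq'.2.2.2.1⟩
    · refine union_subset ?_ ?_ <;> simp only [insert_subset_iff, singleton_subset_iff]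
      · exact ⟨hins x (mem_union_left _ (h.star.sub hx)) hdx, hins a (mem_union_right _ ha) had,
          hins y (mem_union_left _ (h.star.sub hy)) hdy, hins b (mem_union_right _ hb) hbd⟩
      · exact ⟨mem_insert_self _ _, hins p hp hp'.2.2.2.2.1,
          hins c (mem_union_left _ h.star.center) hcd, hins q hq hq'.2.2.2.2.1⟩
  have hleaf : ∀ u ∈ U, ∀ x ∈ U, ∀ y ∈ U, u ≠ x → u ≠ y →
      u ∉ ({x, a, y, b, d, c} : Finset V) := by
    intro u hu x hx y hy hux huy
    simp only [mem_insert, mem_singleton, not_or]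
    exact ⟨hux, fun e => hUC u hu (e ▸ ha), huy, fun e => hUC u hu (e ▸ hb),
      fun e => hUC u hu (e ▸ hd), fun e => h.star.notMem (e ▸ hu)⟩
  by_cases h4 : 4 ≤ U.card
  · obtain ⟨W, hWU, hW⟩ := exists_subset_card_eq h4
    obtain ⟨x, y, p, q, hxy, hxp, hxq, hyp, hyq, hpq, rfl⟩ := card_eq_four.1 hW
    simp only [insert_subset_iff, singleton_subset_iff] at hWU
    obtain ⟨hx, hy, hp, hq⟩ := hWU
    obtain ⟨z, hz, hpz, hqz⟩ :=
      hcommon p q (h.star.tri h4 D hD p hp).ge (h.star.tri h4 D hD q hq).ge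
    exact key x hx y hy hxy z hz p q (mem_union_left _ (h.star.sub hp))
      (mem_union_left _ (h.star.sub hq)) (hleaf p hp x hx y hy hxp.symm hyp.symm)
      (hleaf q hq x hx y hy hxq.symm hyq.symm) hpq hpz hqz (h.star.adj p hp) (h.star.adj q hq)
  have hU : U.card = 3 := by omega
  have hc2 : 2 ≤ dg G C c := by
    have e1 := h.opt.le_sum_cross h.mem h.out
    rw [h.opt.sum_cross_eq h.mem, h.star.pos_eq, sum_insert h.star.notMem,
      sum_congr rfl (h.star.cycle C h.mem), sum_congr rfl h.high, sum_const, sum_const, hU,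
      h.card] at e1
    simp only [nsmul_eq_mul, smul_eq_mul] at e1
    push_cast at e1
    omega
  have hcn : ∀ v ∈ C, (v = a ∨ v = b) → ¬ G.Adj c v := fun v hv hvab => by
    obtain ⟨l, hl⟩ := card_pos.1 (show 0 < U.card by omega)
    exact h.opt.not_adj (h.leaf_mem hl) h.center_mem (hCX v hv) (h.star.adj l hl)
      ((hadj l hl v hv).2 hvab)
  have hCe : C = {a, b, d, e} := by
    refine (eq_of_subset_of_card_le (by simp [insert_subset_iff, ha, hb, hd, he]) ?_).symm
    rw [h.card, card_insert_of_notMem (by simp [hab, had, hae]),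
      card_insert_of_notMem (by simp [hbd, hbe]), card_pair hde]
  have hce : G.Adj c e := by
    by_contra hn
    have : dg G C c ≤ dg G {d} c := card_le_card fun v hv => by
      obtain ⟨hv, hcv⟩ := mem_filter.1 hv
      have hv' := hv
      rw [hCe] at hv'
      simp only [mem_insert, mem_singleton] at hv'
      rcases hv' with hva | hvb | rfl | rfl
      · exact absurd hcv (hcn v hv (Or.inl hva))
      · exact absurd hcv (hcn v hv (Or.inr hvb))
      · exact mem_filter.2 ⟨mem_singleton_self _, hcv⟩
      · exact absurd hcv hn
    have := this.trans (dg_le_card _ _)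
    rw [card_singleton] at this
    omega
  obtain ⟨p, hp, hp2⟩ : ∃ p ∈ U, 2 ≤ dg G D p := by
    by_contra! hcon
    have e1 := h.star.sum_tri D hD
    have e2 := sum_le_card fun u hu => Nat.lt_succ_iff.1 (hcon u hu)
    omega
  obtain ⟨x, y, hxy, hxy'⟩ := card_eq_two.1 (show (U.erase p).card = 2 by
    rw [card_erase_of_mem hp, hU])
  obtain ⟨hxp, hx⟩ := mem_erase.1 (show x ∈ U.erase p by simp [hxy'])
  obtain ⟨hyp, hy⟩ := mem_erase.1 (show y ∈ U.erase p by simp [hxy'])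
  obtain ⟨z, hz, hpz, hez⟩ := hcommon p e hp2 h2
  refine key x hx y hy hxy z hz p e (mem_union_left _ (h.star.sub hp)) (mem_union_right _ he)
    (hleaf p hp x hx y hy hxp.symm hyp.symm) ?_ (fun e' => hUC p hp (e' ▸ he)) hpz hez
    (h.star.adj p hp) hce.symm
  simp only [mem_insert, mem_singleton, not_or]
  exact ⟨fun e' => hUC x hx (e' ▸ he), hae.symm, fun e' => hUC y hy (e' ▸ he), hbe.symm, hde.symm,
    fun e' => hcC (e' ▸ he)⟩

theorem false (h : StarCycle G k t X L T U c C) : False := by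
  obtain ⟨a, ha, b, hb, hab, hadj⟩ := h.exists_pair
  have hba : b ∈ C.erase a := mem_erase.2 ⟨hab.symm, hb⟩
  obtain ⟨d, e, hde, heq⟩ := card_eq_two.1 (show ((C.erase a).erase b).card = 2 by
    rw [card_erase_of_mem hba, card_erase_of_mem ha, h.card])
  have hd : d ∈ (C.erase a).erase b := by simp [heq]
  have he : e ∈ (C.erase a).erase b := by simp [heq]
  simp only [mem_erase] at hd he
  have hn : ∀ v ∈ C, v ≠ a → v ≠ b → ∀ u ∈ U, ¬ G.Adj u v := fun v hv hva hvb u hu huv => by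
    rcases (hadj u hu v hv).1 huv with h' | h'
    exacts [hva h', hvb h']
  have b1 := h.budget hd.2.2 (hn d hd.2.2 hd.2.1 hd.1)
  have b2 := h.budget he.2.2 (hn e he.2.2 he.2.1 he.1)
  obtain ⟨D, hD, hlt⟩ : ∃ D ∈ T, 4 < dg G D d + dg G D e := by
    by_contra! hcon
    have : ∑ D ∈ T, (((dg G D d : ℤ) - 2) + ((dg G D e : ℤ) - 2)) ≤ 0 := sum_nonpos fun D hD => by
      have := hcon D hD
      omega
    rw [sum_add_distrib] at this
    omega
  have hDc := (h.opt.pack.prop D hD).1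
  have e1 := dg_le_card (G := G) D d
  have e2 := dg_le_card (G := G) D e
  rcases le_or_gt 3 (dg G D d) with h3 | h3
  · exact h.false_of_class ha hb hd.2.2 he.2.2 hab hde (Ne.symm hd.1) (Ne.symm he.1)
      (Ne.symm hd.2.1) (Ne.symm he.2.1) hadj hD (full_of_card_le (by omega)) (by omega)
  · exact h.false_of_class ha hb he.2.2 hd.2.2 hab hde.symm (Ne.symm he.1) (Ne.symm hd.1)
      (Ne.symm he.2.1) (Ne.symm hd.2.1) hadj hD (full_of_card_le (by omega)) (by omega)

end StarCycle

theorem Opt.false (h : Opt G k t X L T) : False := by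
  rcases L.eq_empty_or_nonempty with rfl | hL
  · exact h.not_empty
  obtain ⟨H, hH, hHmax, hHout, hHmin⟩ := h.lay.head hL
  have hH4 := h.head_card_le hH hHout (hHmin T h.pack)
  have h4 : ∀ Q ∈ L, Q.card = 4 := fun Q hQ =>
    le_antisymm ((hHmax Q hQ).trans hH4) (h.lay.four Q hQ)
  have hout : ∀ C ∈ L, ∀ Q ∈ L, Q ≠ C → ∀ y ∈ C, dg G Q y ≤ 2 := fun C hC Q hQ _ y hy =>
    h.dg_le_two_of_card_four hQ (h4 Q hQ) (h.cycle_sub hC hy)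
  have hw := h.weight_le
  have hlt := h.lay.card_lt h.cfg
  have hpos := card_pos.2 hL
  have hr := Opt.sum_rest_add G k X L T
  have hsub : pos G k X L T ⊆ rest X L T := filter_subset _ _
  have hrc := card_le_card hsub
  rcases le_or_gt 3 (leaves G k X L T).card with h3 | h3
  · obtain ⟨c, hs⟩ := h.exists_star h3
    have h1 := hs.sum_pos_le
    have htot := hs.tot
    obtain ⟨C, hC, hC4⟩ := exists_lt_of_mul_card_lt_sum (s := L) (m := 3)
      (f := fun Q => ∑ v ∈ Q, phi k (dg G X v)) (by omega)
    refine StarCycle.false ⟨h, hs, hC, h4 C hC, ?_, hout C hC⟩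
    refine (sum_eq_sum_iff_of_le fun v _ => phi_le_one _ _).1 ?_
    refine le_antisymm (sum_le_sum fun v _ => phi_le_one _ _) ?_
    rw [sum_const, nsmul_eq_mul, h4 C hC]
    exact hC4
  · have hp := (h.pos_card_le (by omega)).1
    have h1 := sum_phi_le (S := pos G k X L T) k (dg G X)
    obtain ⟨C, hC, hC3⟩ := exists_lt_of_mul_card_lt_sum (s := L) (m := 2)
      (f := fun Q => ∑ v ∈ Q, phi k (dg G X v)) (by omega)
    have e1 := h.le_sum_cross hC (hout C hC)
    have e2 := h.sum_cross_le hC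
    have e3 := h4 C hC
    omega

theorem Bad.false (h : Bad G k X) : False := by
  obtain ⟨t, L, T, hO⟩ := h.exists_opt
  exact hO.false

end longest

lemma dg_univ {V : Type*} [Fintype V] (G : SimpleGraph V) [DecidableRel G.Adj] (v : V) :
    dg G univ v = G.degree v := by
  rw [dg, ← SimpleGraph.card_neighborFinset_eq_degree]
  congr 1
  ext w
  simp

lemma wt_univ {V : Type*} [Fintype V] (G : SimpleGraph V) [DecidableRel G.Adj] {k : ℕ}
    (hk : 1 ≤ k) : Wt G k univ = (highSet G k).card - (lowSet G k).card := by
  simp only [Wt, highSet, lowSet, card_filter, Nat.cast_sum, ← sum_sub_distrib, dg_univ, phi]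
  refine sum_congr rfl fun v _ => ?_
  split_ifs <;> omega

end DisjointCycles

/-- If `|H_k(G)| - |L_k(G)| ≥ 3k` then `G` contains `k` disjoint cycles. -/
theorem kkm_3k {V : Type*} [Fintype V] (G : SimpleGraph V) [DecidableRel G.Adj]
    (k : ℕ) (hk : 2 ≤ k)
    (h : (lowSet G k).card + 3 * k ≤ (highSet G k).card) :
    HasDisjointCycles G k := by
  obtain ⟨c, hc, -, hd⟩ := DisjointCycles.exists_walks
    (DisjointCycles.has_of_wt (X := Finset.univ) (fun _ _ _ h => h.false) hk G (by
      rw [DisjointCycles.wt_univ G (by omega)]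
      omega))
  exact ⟨c, hc, hd⟩
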